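/- arXiv:1511.02296 — 2 statements merged into one kernel-verified Lean document; each statement's English description precedes it below -/
import Mathlib

section
/- There is a universal constant C > 0 with the following property. For every n ≥ 1 and every ε ∈ (0,1/4], there exists a function A mapping sequences of m value profiles in [0,∞)ⁿ to measurable DSIC and IR mechanisms such that: for every product Borel probability distribution D = D¹ × ⋯ × Dⁿ on [0,∞)ⁿ in which every Dⁱ is regular, if m ≥ C·n·ε^{−4}·(log(n/ε))², then the expectation over m i.i.d. samples from D of Rev(A(samples), D) is at least (1 − C·ε)·Opt(D). -/
open MeasureTheory

/-- A (direct-revelation) mechanism for `n` buyers and one item: an allocation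
rule and a payment rule on value profiles. -/
structure Mech (n : ℕ) where
  alloc : (Fin n → ℝ) → Fin n → ℝ
  pay : (Fin n → ℝ) → Fin n → ℝ

/-- Allocation probabilities are in `[0,1]` and sum to at most `1`. -/
def Mech.Valid {n : ℕ} (M : Mech n) : Prop :=
  ∀ v : Fin n → ℝ, (∀ i, 0 ≤ M.alloc v i ∧ M.alloc v i ≤ 1) ∧ ∑ i, M.alloc v i ≤ 1

/-- Dominant strategy incentive compatibility (on nonnegative value profiles). -/
def Mech.DSIC {n : ℕ} (M : Mech n) : Prop :=
  ∀ (i : Fin n) (v : Fin n → ℝ), (∀ j, 0 ≤ v j) → ∀ v' : ℝ, 0 ≤ v' →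
    v i * M.alloc (Function.update v i v') i - M.pay (Function.update v i v') i ≤
      v i * M.alloc v i - M.pay v i

/-- Individual rationality (on nonnegative value profiles). -/
def Mech.IR {n : ℕ} (M : Mech n) : Prop :=
  ∀ v : Fin n → ℝ, (∀ j, 0 ≤ v j) → ∀ i, 0 ≤ v i * M.alloc v i - M.pay v i

/-- Measurability of the allocation and payment rules. -/
def Mech.Meas {n : ℕ} (M : Mech n) : Prop :=
  (∀ i, Measurable fun v => M.alloc v i) ∧ (∀ i, Measurable fun v => M.pay v i)

/-- A measurable DSIC and IR mechanism. -/
def Mech.Good {n : ℕ} (M : Mech n) : Prop := M.Valid ∧ M.DSIC ∧ M.IR ∧ M.Meas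

/-- Expected revenue of mechanism `M` on value distribution `D`. -/
noncomputable def Rev {n : ℕ} (M : Mech n) (D : Measure (Fin n → ℝ)) : ℝ :=
  ∫ v, ∑ i, M.pay v i ∂D

/-- Optimal revenue: supremum of revenue over measurable DSIC and IR mechanisms. -/
noncomputable def Opt {n : ℕ} (D : Measure (Fin n → ℝ)) : ℝ :=
  sSup {r : ℝ | ∃ M : Mech n, M.Good ∧ r = Rev M D}


/-- The value at quantile `q`: `v(q) = inf {t ≥ 0 : F(t) ≥ 1-q}` where `F` is
the CDF of `D`. -/
noncomputable def qval (D : Measure ℝ) (q : ℝ) : ℝ :=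
  sInf {t : ℝ | 0 ≤ t ∧ ENNReal.ofReal (1 - q) ≤ D (Set.Iic t)}

/-- A distribution on `[0,∞)` is regular if its revenue curve in quantile
space, `R(q) = q·v(q)`, is concave on `[0,1]`. -/
def Regular (D : Measure ℝ) : Prop :=
  ConcaveOn ℝ (Set.Icc (0 : ℝ) 1) (fun q => q * qval D q)

namespace RSC
open Function Finset
open scoped ENNReal

/-- Normalised mechanism. -/
structure NM {n : ℕ} (x p : (Fin n → ℝ) → Fin n → ℝ) : Prop where
  mx : ∀ i, Measurable fun v => x v i
  mp : ∀ i, Measurable fun v => p v i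
  x0 : ∀ v i, 0 ≤ x v i
  x1 : ∀ v, ∑ i, x v i ≤ 1
  p0 : ∀ v i, 0 ≤ p v i
  ic : ∀ v i s t, 0 ≤ s → 0 ≤ t →
    s * x (update v i t) i - p (update v i t) i ≤ s * x (update v i s) i - p (update v i s) i
  ir : ∀ v i s, 0 ≤ s → p (update v i s) i ≤ s * x (update v i s) i
  ib : ∀ v i, p v i ≤ max (v i) 0

set_option linter.unusedSectionVars false
section basic
variable {n : ℕ} {x p : (Fin n → ℝ) → Fin n → ℝ}

lemma NM.xle (h : NM x p) (v i) : x v i ≤ 1 :=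
  (Finset.single_le_sum (f := fun i => x v i) (fun j _ => h.x0 v j) (mem_univ i)).trans (h.x1 v)

lemma NM.xmono (h : NM x p) (v i) {s t : ℝ} (hs : 0 ≤ s) (hst : s ≤ t) :
    x (update v i s) i ≤ x (update v i t) i := by
  rcases hst.eq_or_lt with rfl | hlt
  · rfl
  have h1 := h.ic v i s t hs (hs.trans hst)
  have h2 := h.ic v i t s (hs.trans hst) hs
  by_contra! hc
  nlinarith

lemma NM.pmono (h : NM x p) (v i) {s t : ℝ} (hs : 0 ≤ s) (hst : s ≤ t) :
    p (update v i s) i ≤ p (update v i t) i := by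
  have h1 := h.ic v i s t hs (hs.trans hst)
  have := h.xmono v i hs hst
  nlinarith

lemma NM.good (h : NM x p) : (Mech.mk x p).Good := by
  refine ⟨fun v => ⟨fun i => ⟨h.x0 v i, h.xle v i⟩, h.x1 v⟩, ?_, ?_, h.mx, h.mp⟩
  · intro i v hv v' hv'
    have := h.ic v i (v i) v' (hv i) hv'
    simpa using this
  · intro v hv i
    have := h.ir v i (v i) (hv i)
    simp only [update_eq_self] at this
    simp only; linarith

/-- every good mechanism is dominated by a normalised one -/
lemma exists_NM (M : Mech n) (hM : M.Good) :
    ∃ x p, NM (n := n) x p ∧ ∀ v : Fin n → ℝ, (∀ i, 0 ≤ v i) → ∀ i, M.pay v i ≤ p v i := by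
  obtain ⟨hV, hD, hI, hm1, hm2⟩ := hM
  set P : (Fin n → ℝ) → (Fin n → ℝ) := fun v i => max (v i) 0 with hP
  have hPm : Measurable P := by
    rw [hP]; fun_prop
  have hP0 : ∀ v i, 0 ≤ P v i := fun v i => le_max_right _ _
  have hPu : ∀ v i s, 0 ≤ s → P (update v i s) = update (P v) i s := by
    intro v i s hs
    ext j
    by_cases hj : j = i
    · subst hj; simp [hP, hs]
    · simp [hP, hj]
  have hu0 : ∀ v i (s:ℝ), 0 ≤ s → ∀ j, 0 ≤ update (P v) i s j := by
    intro v i s hs j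
    by_cases hj : j = i
    · subst hj; simpa
    · simp [hj, hP0]
  refine ⟨fun v i => M.alloc (P v) i, fun v i => M.pay (P v) i - M.pay (update (P v) i 0) i,
    ⟨fun i => (hm1 i).comp hPm, ?_, fun v i => ((hV _).1 i).1, fun v => (hV _).2, ?_, ?_, ?_, ?_⟩, ?_⟩
  · intro i
    refine ((hm2 i).comp hPm).sub ((hm2 i).comp ?_)
    rw [measurable_pi_iff]
    intro j
    by_cases hj : j = i
    · subst hj; simp
    · simp only [update_of_ne hj]; exact (measurable_pi_apply j).comp hPm
  · intro v i
    have := hD i (update (P v) i 0) (hu0 v i 0 le_rfl) (P v i) (hP0 v i)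
    simp at this
    simpa using this
  · intro v i s t hs ht
    have := hD i (update (P v) i s) (hu0 v i s hs) t ht
    simp at this
    simp only [hPu _ _ _ hs, hPu _ _ _ ht, update_idem]
    linarith
  · intro v i s hs
    have h1 := hD i (update (P v) i s) (hu0 v i s hs) 0 le_rfl
    have h2 := hI (update (P v) i 0) (hu0 v i 0 le_rfl) i
    have h3 := ((hV (update (P v) i 0)).1 i).1
    simp at h1 h2
    simp only [hPu _ _ _ hs, update_idem]
    have := mul_nonneg hs h3
    linarith
  · intro v i
    have h1 := hI (P v) (hP0 v) i
    have h2 := hD i (update (P v) i 0) (hu0 v i 0 le_rfl) (P v i) (hP0 v i)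
    have h4 := hD i (P v) (hP0 v) 0 le_rfl
    have h5 := ((hV (update (P v) i 0)).1 i).1
    have h6 := ((hV (P v)).1 i).2
    have h3 : P v i * M.alloc (P v) i ≤ P v i * 1 := mul_le_mul_of_nonneg_left h6 (hP0 v i)
    have h7 := mul_nonneg (hP0 v i) h5
    show _ ≤ P v i
    linarith
  · intro v hv i
    have hPv : P v = v := by ext j; simp [hP, hv j]
    have h2 := hI (update (P v) i 0) (hu0 v i 0 le_rfl) i
    simp at h2
    simp only [hPv] at h2 ⊢
    linarith

end basic

section resample
variable {n : ℕ} (D : Fin n → Measure ℝ) [∀ i, IsProbabilityMeasure (D i)]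

lemma measurable_upd (i : Fin n) :
    Measurable (fun z : (Fin n → ℝ) × ℝ => update z.1 i z.2) := by
  rw [measurable_pi_iff]
  intro j
  by_cases hj : j = i
  · subst hj; simpa using measurable_snd
  · simp only [update_of_ne hj]; fun_prop

lemma map_update (i : Fin n) :
    ((Measure.pi D).prod (D i)).map (fun z => update z.1 i z.2) = Measure.pi D := by
  refine (Measure.pi_eq fun s hs => ?_).symm
  rw [Measure.map_apply (measurable_upd i) (MeasurableSet.univ_pi hs)]
  have : (fun z : (Fin n → ℝ) × ℝ => update z.1 i z.2) ⁻¹' (Set.univ.pi s) =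
      (Set.univ.pi (update s i Set.univ)) ×ˢ s i := by
    ext ⟨v, t⟩
    simp only [Set.mem_preimage, Set.mem_pi, Set.mem_univ, true_implies, Set.mem_prod]
    constructor
    · intro h
      refine ⟨fun j => ?_, by simpa using h i⟩
      by_cases hj : j = i
      · subst hj; simp
      · simpa [hj] using h j
    · rintro ⟨h1, h2⟩ j
      by_cases hj : j = i
      · subst hj; simpa
      · simpa [hj] using h1 j
  rw [this, Measure.prod_prod, Measure.pi_pi, ← Finset.mul_prod_erase univ _ (mem_univ i),
    ← Finset.mul_prod_erase univ (fun j => D j (s j)) (mem_univ i)]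
  simp only [update_self, measure_univ, one_mul]
  rw [mul_comm]
  congr 1
  refine Finset.prod_congr rfl fun j hj => ?_
  rw [update_of_ne (Finset.ne_of_mem_erase hj)]

lemma resample (i : Fin n) {g : (Fin n → ℝ) → ℝ≥0∞} (hg : Measurable g) :
    ∫⁻ v, g v ∂(Measure.pi D) = ∫⁻ v, ∫⁻ t, g (update v i t) ∂(D i) ∂(Measure.pi D) := by
  conv_lhs => rw [← map_update D i]
  rw [lintegral_map hg (measurable_upd i), lintegral_prod]
  exact (hg.comp (measurable_upd i)).aemeasurable

lemma resample' (i : Fin n) {g : (Fin n → ℝ) → ℝ≥0∞} (hg : Measurable g) :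
    ∫⁻ v, g v ∂(Measure.pi D) = ∫⁻ t, ∫⁻ v, g (update v i t) ∂(Measure.pi D) ∂(D i) := by
  rw [resample D i hg, lintegral_lintegral_swap]
  exact (hg.comp (measurable_upd i)).aemeasurable
end resample

section reg
/-- tail probability -/
noncomputable def tl (D : Measure ℝ) (t : ℝ) : ℝ := D.real (Set.Ici t)

variable (D : Measure ℝ) [IsProbabilityMeasure D]

lemma tl_nonneg (t) : 0 ≤ tl D t := measureReal_nonneg
lemma tl_le_one (t) : tl D t ≤ 1 := measureReal_le_one
lemma tl_anti {s t : ℝ} (h : s ≤ t) : tl D t ≤ tl D s :=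
  measureReal_mono (Set.Ici_subset_Ici.2 h)

lemma Iio_eq (t) : D (Set.Iio t) = ENNReal.ofReal (1 - tl D t) := by
  have : D.real (Set.Iio t) = 1 - tl D t := by
    rw [tl, ← Set.compl_Ici, probReal_compl_eq_one_sub measurableSet_Ici]
  rw [← this, ofReal_measureReal]

lemma qval_le {s q : ℝ} (hs : 0 ≤ s) (hq : tl D s ≤ q) : qval D q ≤ s := by
  refine csInf_le ⟨0, fun y hy => hy.1⟩ ⟨hs, ?_⟩
  refine le_trans ?_ (measure_mono (Set.Iio_subset_Iic_self))
  rw [Iio_eq]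
  exact ENNReal.ofReal_le_ofReal (by linarith)

lemma le_qval {t q : ℝ} (hq0 : 0 < q) (hq : q < tl D t) : t ≤ qval D q := by
  refine le_csInf ?_ ?_
  · have h1 : Filter.Tendsto (fun x => D (Set.Iic x)) Filter.atTop (nhds 1) := by
      have := tendsto_measure_Iic_atTop D
      rwa [measure_univ] at this
    have h2 : ENNReal.ofReal (1 - q) < 1 := by
      rw [← ENNReal.ofReal_one, ENNReal.ofReal_lt_ofReal_iff one_pos]; linarith
    obtain ⟨x, hx, hx0⟩ := ((h1.eventually (lt_mem_nhds h2)).and (Filter.eventually_ge_atTop 0)).exists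
    exact ⟨x, hx0, hx.le⟩
  · rintro y ⟨hy0, hy⟩
    by_contra! hc
    have h1 : D (Set.Iic y) ≤ D (Set.Iio t) := measure_mono (Set.Iic_subset_Iio.2 hc)
    have h2 := hy.trans h1
    rw [Iio_eq] at h2
    have h3 := tl_le_one D t
    rw [ENNReal.ofReal_le_ofReal_iff (by linarith)] at h2
    linarith

lemma qval_nonneg (q) : 0 ≤ qval D q := Real.sInf_nonneg fun _ h => h.1

lemma reg_tail (hR : Regular D) {s t : ℝ} (hs : 0 < s) (hst : s ≤ t) :
    t * tl D t * (1 - tl D s) ≤ s * tl D s := by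
  have hs0 := tl_nonneg D s
  have hs1 := tl_le_one D s
  have hts := tl_anti D hst
  have ht0 : 0 < t := hs.trans_le hst
  have key : ∀ q, 0 < q → q < tl D t → t * q * (1 - tl D s) ≤ s * tl D s := by
    intro q hq0 hq
    set S := tl D s with hS
    have hS0 : 0 < S := hq0.trans (hq.trans_le hts)
    have hq1 : q < 1 := by linarith
    have h1q : (0:ℝ) < 1 - q := by linarith
    have hR' : ConcaveOn ℝ (Set.Icc (0 : ℝ) 1) (fun q => q * qval D q) := hR
    have hc := hR'.2 (show q ∈ Set.Icc (0:ℝ) 1 from ⟨hq0.le, hq1.le⟩)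
      (show (1:ℝ) ∈ Set.Icc (0:ℝ) 1 from ⟨zero_le_one, le_rfl⟩)
      (show 0 ≤ (1 - S) / (1 - q) from div_nonneg (by linarith) h1q.le)
      (show 0 ≤ (S - q) / (1 - q) from div_nonneg (by linarith) h1q.le)
      (by field_simp; ring)
    have e : ((1 - S) / (1 - q)) • q + ((S - q) / (1 - q)) • (1:ℝ) = S := by
      simp only [smul_eq_mul]; field_simp; ring
    rw [e] at hc
    simp only [smul_eq_mul, one_mul] at hc
    have a1 := le_qval D hq0 hq
    have a2 := qval_le D hs.le (le_refl S)
    have a3 := qval_nonneg D 1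
    have a4 : 0 ≤ (S - q) / (1 - q) * qval D 1 := mul_nonneg (div_nonneg (by linarith) h1q.le) a3
    have a5 : (1 - S) * (q * t) ≤ (1 - S) / (1 - q) * (q * qval D q) := by
      have b1 : (1 - S) ≤ (1 - S) / (1 - q) := by
        rw [le_div_iff₀ h1q]; nlinarith
      have b2 : q * t ≤ q * qval D q := mul_le_mul_of_nonneg_left a1 hq0.le
      exact mul_le_mul b1 b2 (by positivity) (div_nonneg (by linarith) h1q.le)
    have a6 : S * qval D S ≤ S * s := mul_le_mul_of_nonneg_left a2 hS0.le
    nlinarith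
  rcases (tl_nonneg D t).eq_or_lt with h0 | hpos
  · rw [← h0]; simp; positivity
  · by_contra! hc
    have h1 : 0 < 1 - tl D s := by
      by_contra! h
      have : t * tl D t * (1 - tl D s) ≤ 0 := mul_nonpos_of_nonneg_of_nonpos (by positivity) h
      have : 0 ≤ s * tl D s := by positivity
      linarith
    have h2 : s * tl D s / (t * (1 - tl D s)) < tl D t := by
      rw [div_lt_iff₀ (by positivity)]; linarith
    obtain ⟨q, hq1, hq2⟩ := exists_between h2
    have hq0 : 0 < q := lt_of_le_of_lt (by positivity) hq1
    have := key q hq0 hq2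
    rw [div_lt_iff₀ (by positivity)] at hq1
    linarith

lemma single_buyer (hR : Regular D) {X P : ℝ → ℝ}
    (ic : ∀ s t, 0 ≤ s → 0 ≤ t → s * X t - P t ≤ s * X s - P s)
    (hX : ∀ t, X t ≤ 1) {ε u : ℝ} (hε : 0 < ε) (hu : 0 < u) (hq : tl D u < 1) (hP : 0 ≤ P u) :
    ∫⁻ t in Set.Ici u, ENNReal.ofReal (P t) ∂D ≤
      ENNReal.ofReal (tl D u * (P u + (1 + ε) * u * (1 - X u) / (1 - tl D u))) := by
  have xmono : ∀ s t, 0 ≤ s → s ≤ t → X s ≤ X t := by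
    intro s t hs hst
    rcases hst.eq_or_lt with rfl | hlt
    · rfl
    have h1 := ic s t hs (hs.trans hst)
    have h2 := ic t s (hs.trans hst) hs
    by_contra! hc
    nlinarith
  have pmono : ∀ s t, 0 ≤ s → s ≤ t → P s ≤ P t := by
    intro s t hs hst
    have h1 := ic s t hs (hs.trans hst)
    have := xmono s t hs hst
    nlinarith
  set b : ℕ → ℝ := fun j => u * (1 + ε) ^ j with hb
  have hb0 : ∀ j, 0 < b j := fun j => by positivity
  have hbs : ∀ j, b (j + 1) = (1 + ε) * b j := fun j => by simp only [hb, pow_succ]; ring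
  have hbm : Monotone b := monotone_nat_of_le_succ fun j => by
    rw [hbs]; nlinarith [hb0 j]
  have hbu : ∀ j, u ≤ b j := fun j => by
    have := hbm (Nat.zero_le j); simpa [hb] using this
  have hb00 : b 0 = u := by simp [hb]
  set Δ : ℕ → ℝ := fun j => X (b (j + 1)) - X (b j) with hΔ
  have hΔ0 : ∀ j, 0 ≤ Δ j := fun j => sub_nonneg.2 (xmono _ _ (hb0 j).le (hbm (Nat.le_succ j)))
  have hsum : ∀ N, P (b N) - P u ≤ ∑ j ∈ range N, (1 + ε) * b j * Δ j := by
    intro N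
    induction N with
    | zero => simp [hb00]
    | succ N ih =>
      rw [Finset.sum_range_succ]
      have := ic (b (N+1)) (b N) (hb0 _).le (hb0 _).le
      rw [hbs] at this
      simp only [hΔ, hbs] at ih ⊢
      linarith
  have hq1 : 0 < 1 - tl D u := by linarith
  have pt : ∀ t ∈ Set.Ici u, ENNReal.ofReal (P t) ≤ ENNReal.ofReal (P u) +
      ∑' j, (Set.Ici (b j)).indicator (fun _ => ENNReal.ofReal ((1 + ε) * b j * Δ j)) t := by
    intro t ht
    have ht : u ≤ t := ht
    obtain ⟨l, hl1, hl2⟩ := exists_nat_pow_near (x := t / u) (y := 1 + ε)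
      (by rw [le_div_iff₀ hu]; linarith) (by linarith)
    rw [le_div_iff₀ hu] at hl1
    rw [div_lt_iff₀ hu] at hl2
    have h1 : P t ≤ P u + ∑ j ∈ range (l + 1), (1 + ε) * b j * Δ j := by
      have := pmono t (b (l+1)) (by linarith) (by simp only [hb]; linarith)
      have := hsum (l+1)
      linarith
    refine (ENNReal.ofReal_le_ofReal h1).trans ?_
    rw [ENNReal.ofReal_add hP (Finset.sum_nonneg fun j _ =>
      mul_nonneg (mul_nonneg (by linarith) (hb0 j).le) (hΔ0 j)),
      ENNReal.ofReal_sum_of_nonneg fun j _ =>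
      mul_nonneg (mul_nonneg (by linarith) (hb0 j).le) (hΔ0 j)]
    gcongr
    refine le_trans (le_of_eq ?_) (ENNReal.sum_le_tsum (range (l + 1)))
    refine Finset.sum_congr rfl fun j hj => ?_
    rw [Set.indicator_of_mem]
    have : b j ≤ b l := hbm (Nat.lt_succ_iff.1 (Finset.mem_range.1 hj))
    show b j ≤ t
    refine this.trans ?_
    simp only [hb]; linarith
  calc ∫⁻ t in Set.Ici u, ENNReal.ofReal (P t) ∂D
      ≤ ∫⁻ t in Set.Ici u, (ENNReal.ofReal (P u) + ∑' j, (Set.Ici (b j)).indicator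
          (fun _ => ENNReal.ofReal ((1 + ε) * b j * Δ j)) t) ∂D :=
        setLIntegral_mono' measurableSet_Ici pt
    _ = ENNReal.ofReal (P u) * D (Set.Ici u) + ∑' j, ∫⁻ t in Set.Ici u, (Set.Ici (b j)).indicator
          (fun _ => ENNReal.ofReal ((1 + ε) * b j * Δ j)) t ∂D := by
        rw [lintegral_add_left measurable_const, lintegral_tsum, setLIntegral_const]
        intro j
        exact (measurable_const.indicator measurableSet_Ici).aemeasurable
    _ ≤ ENNReal.ofReal (P u) * D (Set.Ici u) +
        ∑' j, ENNReal.ofReal ((1 + ε) * (u * tl D u / (1 - tl D u)) * Δ j) := by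
        gcongr with j
        refine (setLIntegral_le_lintegral _ _).trans ?_
        rw [lintegral_indicator_const measurableSet_Ici, ← ofReal_measureReal,
          ← ENNReal.ofReal_mul (mul_nonneg (mul_nonneg (by linarith) (hb0 j).le) (hΔ0 j))]
        refine ENNReal.ofReal_le_ofReal ?_
        have h1 : b j * tl D (b j) ≤ u * tl D u / (1 - tl D u) := by
          rw [le_div_iff₀ hq1]; exact reg_tail D hR hu (hbu j)
        have : (1 + ε) * Δ j * (b j * tl D (b j)) ≤ (1 + ε) * Δ j * (u * tl D u / (1 - tl D u)) :=
          mul_le_mul_of_nonneg_left h1 (mul_nonneg (by linarith) (hΔ0 j))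
        unfold tl at this ⊢
        linarith
    _ ≤ ENNReal.ofReal (P u) * D (Set.Ici u) +
        ENNReal.ofReal ((1 + ε) * (u * tl D u / (1 - tl D u)) * (1 - X u)) := by
        gcongr
        have hc : 0 ≤ (1 + ε) * (u * tl D u / (1 - tl D u)) :=
          mul_nonneg (by linarith) (div_nonneg (mul_nonneg hu.le (tl_nonneg D u)) hq1.le)
        refine ENNReal.tsum_le_of_sum_range_le fun N => ?_
        rw [← ENNReal.ofReal_sum_of_nonneg fun j _ => mul_nonneg hc (hΔ0 j), ← Finset.mul_sum]
        refine ENNReal.ofReal_le_ofReal (mul_le_mul_of_nonneg_left ?_ hc)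
        simp only [hΔ]
        rw [Finset.sum_range_sub (fun j => X (b j)), hb00]
        linarith [hX (b N)]
    _ = _ := by
        rw [← ofReal_measureReal, ← ENNReal.ofReal_mul hP, ← ENNReal.ofReal_add]
        · congr 1
          unfold tl; ring
        · exact mul_nonneg hP (tl_nonneg D u)
        · exact mul_nonneg (mul_nonneg (by linarith)
            (div_nonneg (mul_nonneg hu.le (tl_nonneg D u)) hq1.le)) (by linarith [hX u])
end reg
end RSC

namespace RSC
open Function Finset
open scoped ENNReal
set_option linter.unusedSectionVars false

section trunc
variable {n : ℕ} (D : Fin n → Measure ℝ) [∀ i, IsProbabilityMeasure (D i)]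
  {x p : (Fin n → ℝ) → Fin n → ℝ}

/-- expected revenue in `ℝ≥0∞` -/
noncomputable def LRev (p : (Fin n → ℝ) → Fin n → ℝ) : ℝ≥0∞ :=
  ∫⁻ v, ∑ i, ENNReal.ofReal (p v i) ∂(Measure.pi D)

/-- optimal revenue in `ℝ≥0∞` -/
noncomputable def WW : ℝ≥0∞ :=
  ⨆ z : {z : ((Fin n → ℝ) → Fin n → ℝ) × ((Fin n → ℝ) → Fin n → ℝ) // NM z.1 z.2}, LRev D z.1.2

lemma LRev_le_WW (h : NM x p) : LRev D p ≤ WW D :=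
  le_iSup (fun z : {z : ((Fin n → ℝ) → Fin n → ℝ) × ((Fin n → ℝ) → Fin n → ℝ) // NM z.1 z.2} =>
    LRev D z.1.2) ⟨(x, p), h⟩

lemma meas_sum (h : NM x p) : Measurable fun v => ∑ i, ENNReal.ofReal (p v i) :=
  Finset.measurable_sum _ fun i _ => (h.mp i).ennreal_ofReal

/-- ignoring bidder `j` -/
lemma NM.ignore (h : NM x p) (j : Fin n) (t : ℝ) :
    NM (fun v i => if i = j then 0 else x (update v j t) i)
      (fun v i => if i = j then 0 else p (update v j t) i) := by
  have hm : Measurable fun v : Fin n → ℝ => update v j t :=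
    (measurable_upd j).comp (measurable_id.prodMk measurable_const)
  refine ⟨?_, ?_, ?_, ?_, ?_, ?_, ?_, ?_⟩
  · intro i
    by_cases hi : i = j
    · simp [hi]
    · simp only [hi, if_false]; exact (h.mx i).comp hm
  · intro i
    by_cases hi : i = j
    · simp [hi]
    · simp only [hi, if_false]; exact (h.mp i).comp hm
  · intro v i
    split_ifs
    · rfl
    · exact h.x0 _ _
  · intro v
    refine le_trans (Finset.sum_le_sum fun i _ => ?_) (h.x1 (update v j t))
    split_ifs
    · exact h.x0 _ _
    · rfl
  · intro v i
    split_ifs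
    · rfl
    · exact h.p0 _ _
  · intro v i s t' hs ht
    split_ifs with hi
    · simp
    · rw [update_comm hi, update_comm hi]; exact h.ic _ i s t' hs ht
  · intro v i s hs
    split_ifs with hi
    · simp
    · rw [update_comm hi]; exact h.ir _ i s hs
  · intro v i
    split_ifs with hi
    · exact le_max_right _ _
    · have := h.ib (update v j t) i
      rwa [update_of_ne hi] at this

/-- some other bidder is above `u` -/
def oth (u : ℝ) (i : Fin n) (v : Fin n → ℝ) : Prop := ∃ j, j ≠ i ∧ u ≤ v j

open Classical in
noncomputable def tx (u : ℝ) (x : (Fin n → ℝ) → Fin n → ℝ) : (Fin n → ℝ) → Fin n → ℝ :=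
  fun v i => if oth u i v then 0 else if u ≤ v i then 1 else x v i

open Classical in
noncomputable def tp (u : ℝ) (x p : (Fin n → ℝ) → Fin n → ℝ) : (Fin n → ℝ) → Fin n → ℝ :=
  fun v i => if oth u i v then 0 else
    if u ≤ v i then p (update v i u) i + u * (1 - x (update v i u) i) else p v i

lemma meas_oth (u : ℝ) (i : Fin n) : MeasurableSet {v : Fin n → ℝ | oth u i v} := by
  have : {v : Fin n → ℝ | oth u i v} = ⋃ j, ⋃ (_ : j ≠ i), {v | u ≤ v j} := by
    ext v; simp [oth]
  rw [this]
  exact MeasurableSet.iUnion fun j => MeasurableSet.iUnion fun _ =>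
    measurableSet_le measurable_const (measurable_pi_apply j)

lemma oth_update (u : ℝ) (i : Fin n) (v : Fin n → ℝ) (t : ℝ) :
    oth u i (update v i t) ↔ oth u i v := by
  unfold oth
  refine exists_congr fun j => and_congr_right fun hj => ?_
  rw [update_of_ne hj]

lemma NM.trunc (h : NM x p) {u : ℝ} (hu : 0 < u) : NM (tx u x) (tp u x p) := by
  classical
  have hm : ∀ i, Measurable fun v : Fin n → ℝ => update v i u := fun i =>
    (measurable_upd i).comp (measurable_id.prodMk measurable_const)
  refine ⟨?_, ?_, ?_, ?_, ?_, ?_, ?_, ?_⟩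
  · intro i
    exact Measurable.ite (meas_oth u i) measurable_const
      (Measurable.ite (measurableSet_le measurable_const (measurable_pi_apply i)) measurable_const
        (h.mx i))
  · intro i
    refine Measurable.ite (meas_oth u i) measurable_const
      (Measurable.ite (measurableSet_le measurable_const (measurable_pi_apply i)) ?_ (h.mp i))
    exact ((h.mp i).comp (hm i)).add ((measurable_const.sub ((h.mx i).comp (hm i))).const_mul u)
  · intro v i
    unfold tx; split_ifs
    · rfl
    · exact zero_le_one
    · exact h.x0 _ _
  · intro v
    by_cases ht : ∃ i, u ≤ v i
    · obtain ⟨i, hi⟩ := ht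
      rw [Finset.sum_eq_single i]
      · unfold tx; split_ifs <;> norm_num
      · intro j _ hj
        unfold tx; rw [if_pos ⟨i, hj.symm, hi⟩]
      · simp
    · refine le_trans (Finset.sum_le_sum fun i _ => ?_) (h.x1 v)
      unfold tx
      rw [if_neg (fun ⟨j, hj⟩ => ht ⟨j, hj.2⟩), if_neg (fun hj => ht ⟨i, hj⟩)]
  · intro v i
    unfold tp; split_ifs
    · rfl
    · exact add_nonneg (h.p0 _ _) (mul_nonneg hu.le (by linarith [h.xle (update v i u) i]))
    · exact h.p0 _ _
  · intro v i s t hs ht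
    have hle := h.xle (update v i u) i
    have hle2 := h.xle (update v i t) i
    unfold tx tp
    simp only [oth_update, update_self, update_idem]
    split_ifs with h1 h2 h3 h3
    · simp
    · linarith
    · have := h.ic v i s u hs hu.le
      have : s * (1 - x (update v i u) i) ≤ u * (1 - x (update v i u) i) :=
        mul_le_mul_of_nonneg_right (not_le.1 h3).le (by linarith)
      linarith
    · have := h.ic v i u t hu.le ht
      have : (s - u) * x (update v i t) i ≤ (s - u) * 1 :=
        mul_le_mul_of_nonneg_left hle2 (by linarith)
      linarith
    · exact h.ic v i s t hs ht
  · intro v i s hs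
    unfold tx tp
    simp only [oth_update, update_self, update_idem]
    split_ifs with h1 h2
    · simp
    · have := h.ir v i u hu.le
      linarith
    · exact h.ir v i s hs
  · intro v i
    unfold tp
    split_ifs with h1 h2
    · exact le_max_right _ _
    · have h3 := h.ir v i u hu.le
      exact le_trans (by linarith) (h2.trans (le_max_left _ _))
    · exact h.ib v i

lemma tp_le (h : NM x p) {u : ℝ} (hu : 0 < u) (v i) : tp u x p v i ≤ u := by
  unfold tp
  split_ifs with h1 h2
  · exact hu.le
  · have h3 := h.ir v i u hu.le
    linarith
  · exact (h.ib v i).trans (max_le (not_le.1 h2).le hu.le)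

lemma tp_top {u t : ℝ} (ht : u ≤ t) (v : Fin n → ℝ) (i j : Fin n) :
    tp u x p (update v i t) j = tp u x p (update v i u) j := by
  unfold tp
  by_cases hj : j = i
  · subst hj
    simp only [update_self, update_idem, le_refl, ht, if_true]
    congr 1
    rw [oth_update, oth_update]
  · rw [if_pos ⟨i, Ne.symm hj, by simpa using ht⟩, if_pos ⟨i, Ne.symm hj, by simp⟩]

lemma trunc_single (hR : ∀ i, Regular (D i)) (h : NM x p) {u ε q : ℝ} (hu : 0 < u) (hε : 0 < ε)
    (hq : ∀ i, tl (D i) u ≤ q) (hq0 : 0 ≤ q) (hq1 : q < 1) (i : Fin n) (v : Fin n → ℝ) (hv : ¬ oth u i v) :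
    ∫⁻ t, ENNReal.ofReal (p (update v i t) i) ∂(D i) ≤
      ENNReal.ofReal ((1 + ε) / (1 - q)) *
        ∫⁻ t, ENNReal.ofReal (tp u x p (update v i t) i) ∂(D i) := by
  have hκ : 1 ≤ (1 + ε) / (1 - q) := by
    rw [le_div_iff₀ (by linarith)]; linarith
  have hmi : Measurable fun t : ℝ => update v i t :=
    (measurable_upd i).comp (measurable_const.prodMk measurable_id)
  have hm : Measurable fun t => ENNReal.ofReal (tp u x p (update v i t) i) :=
    (((h.trunc hu).mp i).comp hmi).ennreal_ofReal
  rw [← lintegral_add_compl (fun t => ENNReal.ofReal (p (update v i t) i)) (measurableSet_Ici (a := u)),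
    ← lintegral_add_compl (fun t => ENNReal.ofReal (tp u x p (update v i t) i))
      (measurableSet_Ici (a := u)), mul_add]
  refine add_le_add ?_ ?_
  · have hb := single_buyer (D i) (hR i) (X := fun t => x (update v i t) i)
      (P := fun t => p (update v i t) i) (fun s t hs ht => h.ic v i s t hs ht)
      (fun t => h.xle _ _) hε hu ((hq i).trans_lt hq1) (h.p0 _ _)
    refine hb.trans ?_
    have e : ∫⁻ t in Set.Ici u, ENNReal.ofReal (tp u x p (update v i t) i) ∂(D i) =
        ENNReal.ofReal (tl (D i) u *
          (p (update v i u) i + u * (1 - x (update v i u) i))) := by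
      rw [setLIntegral_congr_fun (g := fun _ => ENNReal.ofReal
        (p (update v i u) i + u * (1 - x (update v i u) i))) measurableSet_Ici]
      · rw [setLIntegral_const, ← ofReal_measureReal, ← ENNReal.ofReal_mul']
        · rw [mul_comm]; rfl
        · exact measureReal_nonneg
      · intro t ht
        have ht : u ≤ t := ht
        simp only [tp, oth_update, hv, if_false, update_self, ht, if_true, update_idem]
    rw [e, ← ENNReal.ofReal_mul (by linarith)]
    refine ENNReal.ofReal_le_ofReal ?_
    have t0 := tl_nonneg (D i) u
    have a1 : (1 + ε) * u * (1 - x (update v i u) i) / (1 - tl (D i) u) ≤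
        (1 + ε) / (1 - q) * (u * (1 - x (update v i u) i)) := by
      have : (1 + ε) * u * (1 - x (update v i u) i) / (1 - tl (D i) u) ≤
        (1 + ε) * u * (1 - x (update v i u) i) / (1 - q) := by
        refine div_le_div_of_nonneg_left ?_ (by linarith) (by linarith [hq i])
        exact mul_nonneg (by positivity) (by linarith [h.xle (update v i u) i])
      refine this.trans (le_of_eq (by ring))
    have a2 : p (update v i u) i ≤ (1 + ε) / (1 - q) * p (update v i u) i :=
      le_mul_of_one_le_left (h.p0 _ _) hκ
    calc _ ≤ tl (D i) u * ((1 + ε) / (1 - q) * p (update v i u) i +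
            (1 + ε) / (1 - q) * (u * (1 - x (update v i u) i))) :=
          mul_le_mul_of_nonneg_left (add_le_add a2 a1) t0
      _ = _ := by ring
  · rw [← lintegral_const_mul _ hm]
    refine setLIntegral_mono' measurableSet_Ici.compl fun t ht => ?_
    have ht : ¬ u ≤ t := ht
    simp only [tp, oth_update, hv, if_false, update_self, ht]
    refine le_mul_of_one_le_left zero_le ?_
    rw [← ENNReal.ofReal_one]; exact ENNReal.ofReal_le_ofReal hκ

lemma trunc_bound (hR : ∀ i, Regular (D i)) (h : NM x p) {u ε q : ℝ} (hu : 0 < u) (hε : 0 < ε)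
    (hq : ∀ i, tl (D i) u ≤ q) (hq0 : 0 ≤ q) (hq1 : q < 1) :
    LRev D p ≤ (∑ j, ENNReal.ofReal (tl (D j) u)) * WW D +
      ENNReal.ofReal ((1 + ε) / (1 - q)) * LRev D (tp u x p) := by
  classical
  set g1 : Fin n → (Fin n → ℝ) → ℝ≥0∞ := fun j v =>
    if u ≤ v j then ∑ i, (if i = j then 0 else ENNReal.ofReal (p v i)) else 0 with hg1
  set g2 : Fin n → (Fin n → ℝ) → ℝ≥0∞ := fun i v =>
    if oth u i v then 0 else ENNReal.ofReal (p v i) with hg2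
  have mg1 : ∀ j, Measurable (g1 j) := by
    intro j
    refine Measurable.ite (measurableSet_le measurable_const (measurable_pi_apply j)) ?_
      measurable_const
    refine Finset.measurable_sum _ fun i _ => ?_
    by_cases hi : i = j
    · simp [hi]
    · simpa [hi] using (h.mp i).ennreal_ofReal
  have mg2 : ∀ j, Measurable (g2 j) := by
    intro j
    exact Measurable.ite (meas_oth u j) measurable_const (h.mp j).ennreal_ofReal
  have hpt : ∀ v, ∑ i, ENNReal.ofReal (p v i) ≤ ∑ j, g1 j v + ∑ i, g2 i v := by
    intro v
    have e : ∑ j, g1 j v = ∑ i, ∑ j, (if u ≤ v j then (if i = j then 0 else ENNReal.ofReal (p v i)) else 0) := by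
      rw [Finset.sum_comm]
      refine Finset.sum_congr rfl fun j _ => ?_
      simp only [hg1]; split_ifs <;> simp
    rw [e, ← Finset.sum_add_distrib]
    refine Finset.sum_le_sum fun i _ => ?_
    by_cases ho : oth u i v
    · obtain ⟨j, hj1, hj2⟩ := ho
      refine le_trans ?_ (le_add_right (Finset.single_le_sum
        (f := fun j => if u ≤ v j then (if i = j then 0 else ENNReal.ofReal (p v i)) else 0)
        (fun _ _ => zero_le) (mem_univ j)))
      simp [hj2, Ne.symm hj1]
    · simp [hg2, ho]
  have h1 : ∀ j, ∫⁻ v, g1 j v ∂(Measure.pi D) ≤ ENNReal.ofReal (tl (D j) u) * WW D := by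
    intro j
    rw [resample' D j (mg1 j)]
    have : ∀ t, ∫⁻ v, g1 j (update v j t) ∂(Measure.pi D) ≤
        (Set.Ici u).indicator (fun _ => WW D) t := by
      intro t
      by_cases ht : u ≤ t
      · rw [Set.indicator_of_mem (show t ∈ Set.Ici u from ht)]
        refine le_trans (le_of_eq ?_) (LRev_le_WW D (h.ignore j t))
        unfold LRev
        refine lintegral_congr fun v => ?_
        simp only [hg1, update_self, ht, if_true]
        refine Finset.sum_congr rfl fun i _ => ?_
        split_ifs <;> simp
      · simp [hg1, ht]
    refine (lintegral_mono this).trans ?_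
    rw [lintegral_indicator_const measurableSet_Ici, ← ofReal_measureReal, mul_comm]
    rfl
  have h2 : ∀ i, ∫⁻ v, g2 i v ∂(Measure.pi D) ≤ ENNReal.ofReal ((1 + ε) / (1 - q)) *
      ∫⁻ v, ENNReal.ofReal (tp u x p v i) ∂(Measure.pi D) := by
    intro i
    have mt := ((h.trunc hu).mp i).ennreal_ofReal
    rw [resample D i (mg2 i), resample D i mt, ← lintegral_const_mul']
    · refine lintegral_mono fun v => ?_
      by_cases ho : oth u i v
      · simp [hg2, oth_update, ho]
      · simp only [hg2, oth_update, ho, if_false]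
        exact trunc_single D hR h hu hε hq hq0 hq1 i v ho
    · exact ENNReal.ofReal_ne_top
  unfold LRev
  refine (lintegral_mono hpt).trans ?_
  rw [lintegral_add_left (Finset.measurable_sum _ fun j _ => mg1 j),
    lintegral_finsetSum _ fun j _ => mg1 j, lintegral_finsetSum _ fun j _ => mg2 j,
    lintegral_finsetSum _ fun j _ => ((h.trunc hu).mp j).ennreal_ofReal, Finset.sum_mul, Finset.mul_sum]
  exact add_le_add (Finset.sum_le_sum fun j _ => h1 j) (Finset.sum_le_sum fun j _ => h2 j)

lemma exists_tail (D : Measure ℝ) [IsProbabilityMeasure D] : ∃ u0 : ℝ, ∀ u, u0 ≤ u → tl D u < 1 / 2 := by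
  have h1 : Filter.Tendsto (fun x => D (Set.Iic x)) Filter.atTop (nhds 1) := by
    have := tendsto_measure_Iic_atTop D
    rwa [measure_univ] at this
  have h2 : ENNReal.ofReal (1 / 2) < 1 := by
    rw [← ENNReal.ofReal_one, ENNReal.ofReal_lt_ofReal_iff one_pos]; norm_num
  obtain ⟨y, hy⟩ := (h1.eventually (lt_mem_nhds h2)).exists
  refine ⟨y + 1, fun u hu => ?_⟩
  have h3 : D (Set.Iic y) ≤ D (Set.Iio u) := measure_mono (Set.Iic_subset_Iio.2 (by linarith))
  have h4 := hy.trans_le h3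
  rw [Iio_eq, ENNReal.ofReal_lt_ofReal_iff_of_nonneg (by norm_num)] at h4
  linarith

lemma WW_lt_top (h0 : ∀ i, D i (Set.Iio 0) = 0) (hR : ∀ i, Regular (D i)) : WW D < ∞ := by
  choose u0 hu0 using fun i => exists_tail (D i)
  set u : ℝ := max 1 (∑ i, |u0 i|) with hu
  have hu1 : 0 < u := lt_of_lt_of_le one_pos (le_max_left _ _)
  have huu : ∀ i, u0 i ≤ u := fun i => (le_abs_self _).trans
    ((Finset.single_le_sum (f := fun i => |u0 i|) (fun _ _ => abs_nonneg _) (mem_univ i)).trans (le_max_right _ _))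
  have hq : ∀ i, tl (D i) u < 1 / 2 := fun i => hu0 i u (huu i)
  refine lt_of_le_of_lt (iSup_le (a := ENNReal.ofReal (n * (6 * u))) ?_) ENNReal.ofReal_lt_top
  rintro ⟨⟨x, p⟩, h⟩
  have h : NM x p := h
  show LRev D p ≤ _
  unfold LRev
  rw [lintegral_finsetSum _ fun j _ => (h.mp j).ennreal_ofReal, ENNReal.ofReal_mul (by positivity),
    ENNReal.ofReal_natCast]
  have key : ∀ i, ∫⁻ v, ENNReal.ofReal (p v i) ∂(Measure.pi D) ≤ ENNReal.ofReal (6 * u) := by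
    intro i
    rw [resample D i (h.mp i).ennreal_ofReal]
    have : ∀ v, ∫⁻ t, ENNReal.ofReal (p (update v i t) i) ∂(D i) ≤ ENNReal.ofReal (6 * u) := by
      intro v
      have hx := h.x0 (update v i u) i
      have hx1 := h.xle (update v i u) i
      have hpu : p (update v i u) i ≤ u := (h.ir v i u hu1.le).trans (mul_le_of_le_one_right hu1.le hx1)
      rw [← lintegral_add_compl _ (measurableSet_Ici (a := u)),
        show 6 * u = 5 * u + u by ring, ENNReal.ofReal_add (by positivity) hu1.le]
      refine add_le_add ?_ ?_
      · refine (single_buyer (D i) (hR i) (X := fun t => x (update v i t) i)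
          (P := fun t => p (update v i t) i) (fun s t hs ht => h.ic v i s t hs ht)
          (fun t => h.xle _ _) one_pos hu1 ((hq i).trans (by norm_num)) (h.p0 _ _)).trans ?_
        refine ENNReal.ofReal_le_ofReal ?_
        have t0 := tl_nonneg (D i) u
        have a1 : (1 + 1) * u * (1 - x (update v i u) i) / (1 - tl (D i) u) ≤ 4 * u := by
          rw [div_le_iff₀ (by linarith [hq i])]
          nlinarith [hq i]
        calc _ ≤ 1 * (u + 4 * u) := by
              refine mul_le_mul (tl_le_one _ _) (add_le_add hpu a1) ?_ zero_le_one
              refine add_nonneg (h.p0 _ _) (div_nonneg (mul_nonneg (by positivity) (by linarith)) (by linarith [hq i]))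
          _ = _ := by ring
      · have hae : ∀ᵐ t ∂((D i).restrict (Set.Ici u)ᶜ), ENNReal.ofReal (p (update v i t) i) ≤ ENNReal.ofReal u := by
          rw [ae_restrict_iff' measurableSet_Ici.compl]
          have : ∀ᵐ t ∂(D i), ¬ t < 0 := by
            rw [ae_iff]; simp only [not_not]; exact h0 i
          filter_upwards [this] with t ht htu
          refine ENNReal.ofReal_le_ofReal (le_trans ?_ hpu)
          exact h.pmono v i (not_lt.1 ht) (le_of_lt (not_le.1 (show ¬ u ≤ t from htu)))
        refine (lintegral_mono_ae hae).trans ?_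
        rw [lintegral_const]
        refine mul_le_of_le_one_right zero_le ?_
        rw [Measure.restrict_apply_univ]; exact prob_le_one
    refine (lintegral_mono this).trans ?_
    simp
  refine (Finset.sum_le_sum fun i _ => key i).trans ?_
  simp
end trunc
end RSC

namespace RSC
open Function Finset
open scoped ENNReal
set_option linter.unusedSectionVars false

section grid
variable {n : ℕ}

structure Grid (a : ℕ → ℝ) : Prop where
  mono : Monotone a
  zero : a 0 = 0
  pos : ∀ l, 0 < a (l + 1)

lemma Grid.nonneg {a : ℕ → ℝ} (ha : Grid a) (l : ℕ) : 0 ≤ a l := by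
  rw [← ha.zero]; exact ha.mono (Nat.zero_le l)

open Classical in
/-- index of the grid cell containing `v` -/
noncomputable def cell (a : ℕ → ℝ) (k : ℕ) (v : ℝ) : ℕ := Nat.findGreatest (fun l => a l ≤ v) k

lemma cell_le (a : ℕ → ℝ) (k : ℕ) (v : ℝ) : cell a k v ≤ k := by
  classical exact Nat.findGreatest_le k

lemma le_cell {a : ℕ → ℝ} (ha : Grid a) {k : ℕ} {v : ℝ} {l : ℕ} (hl : l < k) :
    l + 1 ≤ cell a k v ↔ a (l + 1) ≤ v := by
  classical
  constructor
  · intro h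
    have h1 : cell a k v ≠ 0 := by omega
    have := Nat.findGreatest_of_ne_zero (rfl : cell a k v = _) h1
    exact (ha.mono h).trans this
  · intro h
    exact Nat.le_findGreatest hl h

lemma meas_cell (a : ℕ → ℝ) (k : ℕ) : Measurable (cell a k) := by
  classical
  refine measurable_findGreatest fun l _ => ?_
  exact measurableSet_le measurable_const measurable_id

structure IsRule (y : (Fin n → ℕ) → Fin n → ℝ) : Prop where
  y0 : ∀ c i, 0 ≤ y c i
  y1 : ∀ c, ∑ i, y c i ≤ 1
  mono : ∀ c i l, y (update c i l) i ≤ y (update c i (l + 1)) i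

/-- payment of a grid rule -/
def gpay (a : ℕ → ℝ) (y : (Fin n → ℕ) → Fin n → ℝ) (c : Fin n → ℕ) (i : Fin n) : ℝ :=
  ∑ l ∈ range (c i), a (l + 1) * (y (update c i (l + 1)) i - y (update c i l) i)

lemma IsRule.y_sub {y : (Fin n → ℕ) → Fin n → ℝ} (c : Fin n → ℕ) (i : Fin n) (N : ℕ) :
    ∑ l ∈ range N, (y (update c i (l + 1)) i - y (update c i l) i) =
      y (update c i N) i - y (update c i 0) i :=
  Finset.sum_range_sub (fun l => y (update c i l) i) N

lemma gpay_nonneg {a : ℕ → ℝ} (ha : Grid a) {y : (Fin n → ℕ) → Fin n → ℝ} (hy : IsRule y)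
    (c i) : 0 ≤ gpay a y c i :=
  Finset.sum_nonneg fun l _ => mul_nonneg (ha.nonneg _) (sub_nonneg.2 (hy.mono c i l))

lemma gpay_le {a : ℕ → ℝ} {y : (Fin n → ℕ) → Fin n → ℝ} (hy : IsRule y)
    (c i) {B : ℝ} (hB0 : 0 ≤ B) (hB : ∀ l, l < c i → a (l + 1) ≤ B) : gpay a y c i ≤ B * y c i := by
  have h1 : gpay a y c i ≤ ∑ l ∈ range (c i), B * (y (update c i (l + 1)) i - y (update c i l) i) :=
    Finset.sum_le_sum fun l hl => mul_le_mul_of_nonneg_right (hB l (Finset.mem_range.1 hl))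
      (sub_nonneg.2 (hy.mono c i l))
  rw [← Finset.mul_sum, IsRule.y_sub, update_eq_self] at h1
  refine h1.trans (mul_le_mul_of_nonneg_left ?_ hB0)
  linarith [hy.y0 (update c i 0) i]

lemma sum_gpay_le {a : ℕ → ℝ} (ha : Grid a) {y : (Fin n → ℕ) → Fin n → ℝ} (hy : IsRule y)
    {k : ℕ} (c : Fin n → ℕ) (hc : ∀ i, c i ≤ k) : ∑ i, gpay a y c i ≤ a k := by
  calc ∑ i, gpay a y c i ≤ ∑ i, a k * y c i :=
        Finset.sum_le_sum fun i _ => gpay_le hy c i (ha.nonneg k)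
          fun l hl => ha.mono (by have := hc i; omega)
    _ ≤ a k * 1 := by
        rw [← Finset.mul_sum]; exact mul_le_mul_of_nonneg_left (hy.y1 c) (ha.nonneg k)
    _ = a k := mul_one _

/-- cell profile -/
noncomputable def cl (a : ℕ → ℝ) (k : ℕ) (v : Fin n → ℝ) : Fin n → ℕ := fun i => cell a k (v i)

lemma cl_update (a : ℕ → ℝ) (k : ℕ) (v : Fin n → ℝ) (i : Fin n) (s : ℝ) :
    cl a k (update v i s) = update (cl a k v) i (cell a k s) := by
  ext j
  by_cases hj : j = i
  · subst hj; simp [cl]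
  · simp [cl, hj]

lemma meas_cl (a : ℕ → ℝ) (k : ℕ) : Measurable (cl (n := n) a k) := by
  rw [measurable_pi_iff]
  exact fun i => (meas_cell a k).comp (measurable_pi_apply i)

lemma sum_range_max {f : ℕ → ℝ} {k l l' : ℕ} (hl' : l' ≤ k)
    (h1 : ∀ j < l, 0 ≤ f j) (h2 : ∀ j, l ≤ j → j < k → f j ≤ 0) :
    ∑ j ∈ range l', f j ≤ ∑ j ∈ range l, f j := by
  rcases le_total l' l with h | h
  · refine Finset.sum_le_sum_of_subset_of_nonneg (Finset.range_mono h) fun j hj _ => ?_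
    exact h1 j (Finset.mem_range.1 hj)
  · have := Finset.sum_Ico_eq_sub f h
    have h3 : ∑ j ∈ Finset.Ico l l', f j ≤ 0 := Finset.sum_nonpos fun j hj => by
      rw [Finset.mem_Ico] at hj
      exact h2 j hj.1 (by omega)
    linarith

lemma grid_NM {a : ℕ → ℝ} (ha : Grid a) (k : ℕ) {y : (Fin n → ℕ) → Fin n → ℝ} (hy : IsRule y) :
    NM (fun v i => y (cl a k v) i) (fun v i => gpay a y (cl a k v) i) := by
  refine ⟨?_, ?_, fun v i => hy.y0 _ _, fun v => hy.y1 _, fun v i => gpay_nonneg ha hy _ _, ?_, ?_, ?_⟩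
  · intro i
    exact (Measurable.of_discrete (f := fun c => y c i)).comp (meas_cl a k)
  · intro i
    exact (Measurable.of_discrete (f := fun c => gpay a y c i)).comp (meas_cl a k)
  · intro v i s t hs ht
    simp only [cl_update]
    set c := cl a k v
    have e : ∀ N, s * y (update c i N) i - gpay a y (update c i N) i = s * y (update c i 0) i +
        ∑ l ∈ range N, (s - a (l + 1)) * (y (update c i (l + 1)) i - y (update c i l) i) := by
      intro N
      have := IsRule.y_sub (y := y) c i N
      simp only [gpay, update_self, update_idem, sub_mul, Finset.sum_sub_distrib]
      rw [← Finset.mul_sum, this]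
      ring
    rw [e, e]
    gcongr 1
    refine sum_range_max (cell_le a k t) (fun j hj => ?_) (fun j hj hjk => ?_)
    · refine mul_nonneg (sub_nonneg.2 ?_) (sub_nonneg.2 (hy.mono c i j))
      have := cell_le a k s
      exact (le_cell ha (by omega)).1 hj
    · refine mul_nonpos_of_nonpos_of_nonneg (sub_nonpos.2 ?_) (sub_nonneg.2 (hy.mono c i j))
      by_contra! hc
      have := (le_cell ha hjk).2 hc.le
      omega
  · intro v i s hs
    simp only [cl_update]
    refine gpay_le hy _ i hs fun l hl => ?_
    simp only [update_self] at hl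
    have := cell_le a k s
    exact (le_cell ha (by omega)).1 hl
  · intro v i
    refine (gpay_le hy _ i (le_max_right (v i) 0) fun l hl => ?_).trans
      (mul_le_of_le_one_right (le_max_right _ _) ?_)
    · have hl : l < cell a k (v i) := hl
      have := cell_le a k (v i)
      exact ((le_cell ha (by omega)).1 hl).trans (le_max_left _ _)
    · exact (Finset.single_le_sum (f := fun i => y (cl a k v) i) (fun j _ => hy.y0 _ j)
        (mem_univ i)).trans (hy.y1 _)

/-- admissible representatives -/
structure WOK (a : ℕ → ℝ) (k : ℕ) (w : ℕ → ℝ) : Prop where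
  lo : ∀ l, l ≤ k → a l ≤ w l
  hi : ∀ l, l < k → w l ≤ a (l + 1)
  top : ∀ l, k ≤ l → w l = a k

lemma cell_nonneg_iff {a : ℕ → ℝ} (ha : Grid a) {k : ℕ} (t : ℝ) (ht : 0 ≤ t) :
    a (cell a k t) ≤ t := by
  rcases Nat.eq_zero_or_eq_succ_pred (cell a k t) with h | h
  · rw [h, ha.zero]; exact ht
  · have h1 := cell_le a k t
    rw [h]
    refine (le_cell ha (k := k) (by omega)).1 (by omega)

lemma round_one {a : ℕ → ℝ} (ha : Grid a) {k : ℕ} (hk : 0 < k) (D : Measure ℝ) [IsProbabilityMeasure D]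
    (h0 : D (Set.Iio 0) = 0) {h : ℝ → ℝ≥0∞} (hm : Measurable h) {B : ℝ≥0∞} (hBt : B ≠ ∞)
    (hB : ∀ t, h t ≤ B) (htop : ∀ t, a k ≤ t → h t = h (a k)) :
    ∃ w, WOK a k w ∧ ∫⁻ t, h t ∂D ≤ ∫⁻ t, h (w (cell a k t)) ∂D := by
  classical
  set C : ℕ → Set ℝ := fun l => cell a k ⁻¹' {l} ∩ Set.Ici 0 with hC
  have mC : ∀ l, MeasurableSet (C l) := fun l =>
    (meas_cell a k (measurableSet_singleton l)).inter measurableSet_Ici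
  have hex : ∀ l, ∃ t, (l < k → (a l ≤ t ∧ t ≤ a (l + 1))) ∧ (k ≤ l → t = a k) ∧
      ∫⁻ t in C l, h t ∂D ≤ h t * D (C l) := by
    intro l
    by_cases hl : k ≤ l
    · refine ⟨a k, fun h => by omega, fun _ => rfl, ?_⟩
      rw [← setLIntegral_const]
      refine setLIntegral_mono' (mC l) fun t ht => ?_
      rw [htop]
      have h1 : cell a k t = l := ht.1
      have h2 := cell_le a k t
      have := cell_nonneg_iff ha (k := k) t ht.2
      have e : cell a k t = k := by omega
      rwa [e] at this
    · by_cases hz : D (C l) = 0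
      · refine ⟨a l, fun h => ⟨le_rfl, ha.mono (Nat.le_succ l)⟩, fun h => by omega, ?_⟩
        rw [setLIntegral_measure_zero _ _ hz]; exact zero_le
      · have hfin : ∫⁻ t in C l, h t ∂D ≠ ∞ := by
          refine ne_of_lt (lt_of_le_of_lt (lintegral_mono hB) ?_)
          rw [lintegral_const]
          exact ENNReal.mul_lt_top hBt.lt_top (measure_lt_top _ _)
        obtain ⟨t, ht, hle⟩ := exists_setLAverage_le hz (mC l).nullMeasurableSet hfin
        have h1 : cell a k t = l := ht.1
        refine ⟨t, fun _ => ⟨?_, ?_⟩, fun h => by omega, ?_⟩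
        · have := cell_nonneg_iff ha (k := k) t ht.2
          rwa [h1] at this
        · by_contra! hc
          have := (le_cell ha (k := k) (l := l) (by omega)).2 hc.le
          omega
        · rw [setLAverage_eq] at hle
          exact (ENNReal.div_le_iff hz (measure_ne_top _ _)).1 hle
  choose w hw1 hw2 hw3 using hex
  refine ⟨w, ⟨fun l hl => ?_, fun l hl => (hw1 l hl).2, fun l hl => hw2 l hl⟩, ?_⟩
  · rcases hl.lt_or_eq with h | rfl
    · exact (hw1 l h).1
    · rw [hw2 l le_rfl]
  have hU : (⋃ l ∈ range (k + 1), C l) = Set.Ici 0 := by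
    ext t
    simp only [Set.mem_iUnion, hC, Set.mem_inter_iff, Set.mem_preimage, Set.mem_singleton_iff, Finset.mem_range]
    constructor
    · rintro ⟨l, hl, h1, h2⟩; exact h2
    · intro ht
      exact ⟨_, Nat.lt_succ_of_le (cell_le a k t), rfl, ht⟩
  have hae : ∀ f : ℝ → ℝ≥0∞, ∫⁻ t, f t ∂D = ∑ l ∈ range (k + 1), ∫⁻ t in C l, f t ∂D := by
    intro f
    rw [← lintegral_biUnion_finset _ (fun l _ => mC l), hU]
    · rw [← lintegral_add_compl f (measurableSet_Ici (a := (0:ℝ))), Set.compl_Ici,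
        setLIntegral_measure_zero (Set.Iio 0) _ h0, add_zero]
    · intro l _ l' _ hll
      refine Set.disjoint_left.2 fun t ht ht' => hll ?_
      exact (show cell a k t = l from ht.1).symm.trans ht'.1
  rw [hae, hae]
  refine Finset.sum_le_sum fun l _ => (hw3 l).trans ?_
  rw [← setLIntegral_const]
  refine setLIntegral_mono' (mC l) fun t ht => ?_
  rw [show cell a k t = l from ht.1]

open Classical in
noncomputable def rnd (a : ℕ → ℝ) (k : ℕ) (S : Finset (Fin n)) (w : Fin n → ℕ → ℝ) (v : Fin n → ℝ) : Fin n → ℝ :=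
  fun i => if i ∈ S then w i (cell a k (v i)) else v i

lemma meas_rnd (a : ℕ → ℝ) (k : ℕ) (S : Finset (Fin n)) (w : Fin n → ℕ → ℝ) : Measurable (rnd a k S w) := by
  rw [measurable_pi_iff]
  intro i
  unfold rnd
  by_cases hi : i ∈ S
  · simp only [hi, if_true]
    exact (Measurable.of_discrete (f := w i)).comp ((meas_cell a k).comp (measurable_pi_apply i))
  · simp only [hi, if_false]; exact measurable_pi_apply i

lemma round_all {a : ℕ → ℝ} (ha : Grid a) {k : ℕ} (hk : 0 < k) (D : Fin n → Measure ℝ)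
    [∀ i, IsProbabilityMeasure (D i)] (h0 : ∀ i, D i (Set.Iio 0) = 0)
    {g : (Fin n → ℝ) → ℝ≥0∞} (hm : Measurable g) {B : ℝ≥0∞} (hBt : B ≠ ∞)
    (hB : ∀ t, g t ≤ B) (htop : ∀ v i t, a k ≤ t → g (update v i t) = g (update v i (a k)))
    (S : Finset (Fin n)) :
    ∃ w : Fin n → ℕ → ℝ, (∀ i, WOK a k (w i)) ∧
      ∫⁻ v, g v ∂(Measure.pi D) ≤ ∫⁻ v, g (rnd a k S w v) ∂(Measure.pi D) := by
  classical
  induction S using Finset.induction_on with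
  | empty =>
    refine ⟨fun _ l => if l < k then a l else a k, fun i => ⟨?_, ?_, ?_⟩, ?_⟩
    · intro l hl
      rcases hl.lt_or_eq with h | rfl
      · simp [h]
      · simp
    · intro l hl; simp only [hl, if_true]; exact ha.mono (Nat.le_succ l)
    · intro l hl; simp [not_lt.2 hl]
    · unfold rnd; simp
  | insert i S hi ih =>
    obtain ⟨w, hw, hle⟩ := ih
    set g' : (Fin n → ℝ) → ℝ≥0∞ := fun v => g (rnd a k S w v) with hg'
    have mg' : Measurable g' := hm.comp (meas_rnd a k S w)
    have hr : ∀ v t, rnd a k S w (update v i t) = update (rnd a k S w v) i t := by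
      intro v t
      ext j
      by_cases hj : j = i
      · subst hj; simp [rnd, hi]
      · simp [rnd, hj]
    obtain ⟨w', hw', hle'⟩ := round_one ha hk (D i) (h0 i)
      (h := fun t => ∫⁻ v, g' (update v i t) ∂(Measure.pi D))
      ((mg'.comp (measurable_upd i)).lintegral_prod_left') hBt
      (fun t => (lintegral_mono fun v => hB _).trans (by simp))
      (fun t ht => lintegral_congr fun v => by
        simp only [hg', hr]; exact htop _ _ _ ht)
    refine ⟨update w i w', fun j => ?_, hle.trans ?_⟩
    · by_cases hj : j = i
      · subst hj; simpa
      · simpa [hj] using hw j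
    · have e1 := resample' D i mg'
      have e2 := resample' D i (g := fun v => g (rnd a k (insert i S) (update w i w') v))
        (hm.comp (meas_rnd _ _ _ _))
      change ∫⁻ v, g' v ∂(Measure.pi D) ≤ _
      rw [e1, e2]
      refine hle'.trans (le_of_eq (lintegral_congr fun t => lintegral_congr fun v => ?_))
      show g _ = g _
      congr 1
      ext j
      by_cases hj : j = i
      · subst hj; simp [rnd, hi]
      · simp [rnd, hj]

lemma discretize {a : ℕ → ℝ} (ha : Grid a) {k : ℕ} (hk : 0 < k) {ε : ℝ} (hε : 0 < ε)
    (hag : ∀ l, 1 ≤ l → a (l + 1) ≤ (1 + ε) * a l)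
    (D : Fin n → Measure ℝ)
    [∀ i, IsProbabilityMeasure (D i)] (h0 : ∀ i, D i (Set.Iio 0) = 0)
    {x p : (Fin n → ℝ) → Fin n → ℝ} (h : NM x p) (hp : ∀ v i, p v i ≤ a k)
    (htop : ∀ v i t j, a k ≤ t → p (update v i t) j = p (update v i (a k)) j) :
    ∃ y : (Fin n → ℕ) → Fin n → ℝ, IsRule y ∧
      LRev D p ≤ ENNReal.ofReal (1 + ε) * LRev D (fun v i => gpay a y (cl a k v) i) +
        ENNReal.ofReal (a 1) := by
  classical
  obtain ⟨w, hw, hle⟩ := round_all ha hk D h0 (meas_sum h)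
    (B := ∑ i : Fin n, ENNReal.ofReal (a k))
    (ENNReal.sum_ne_top.2 fun _ _ => ENNReal.ofReal_ne_top)
    (fun v => Finset.sum_le_sum fun i _ => ENNReal.ofReal_le_ofReal (hp v i))
    (fun v i t ht => Finset.sum_congr rfl fun j _ => by rw [htop v i t j ht]) univ
  have hw0 : ∀ i l, 0 ≤ w i l := by
    intro i l
    rcases lt_or_ge l k with hl | hl
    · exact (ha.nonneg l).trans ((hw i).lo l hl.le)
    · rw [(hw i).top l hl]; exact ha.nonneg k
  have hwm : ∀ i l, w i l ≤ w i (l + 1) := by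
    intro i l
    rcases lt_or_ge l k with hl | hl
    · exact ((hw i).hi l hl).trans ((hw i).lo (l + 1) hl)
    · rw [(hw i).top l hl, (hw i).top (l + 1) (by omega)]
  have hwu : ∀ (c : Fin n → ℕ) i l, (fun j => w j (update c i l j)) =
      update (fun j => w j (c j)) i (w i l) := by
    intro c i l
    ext j
    by_cases hj : j = i
    · subst hj; simp
    · simp [hj]
  set y : (Fin n → ℕ) → Fin n → ℝ := fun c i => x (fun j => w j (c j)) i with hy
  have hyR : IsRule y := by
    refine ⟨fun c i => h.x0 _ _, fun c => h.x1 _, fun c i l => ?_⟩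
    simp only [hy, hwu]
    exact h.xmono _ i (hw0 i l) (hwm i l)
  refine ⟨y, hyR, hle.trans ?_⟩
  have hone : ∀ (c : Fin n → ℕ) i N, N ≤ k → p (update (fun j => w j (c j)) i (w i N)) i ≤
      a 1 * y (update c i 0) i + (1 + ε) *
        ∑ l ∈ range N, a (l + 1) * (y (update c i (l + 1)) i - y (update c i l) i) := by
    intro c i N hN
    induction N with
    | zero =>
      simp only [Finset.range_zero, Finset.sum_empty, mul_zero, add_zero, hy, hwu]
      refine (h.ir _ i _ (hw0 i 0)).trans ?_
      exact mul_le_mul_of_nonneg_right ((hw i).hi 0 hk) (h.x0 _ _)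
    | succ N ih =>
      have ih := ih (by omega)
      rw [Finset.sum_range_succ, mul_add]
      have h1 := h.ic (fun j => w j (c j)) i (w i (N + 1)) (w i N) (hw0 _ _) (hw0 _ _)
      have h2 : w i (N + 1) * (y (update c i (N + 1)) i - y (update c i N) i) ≤
          (1 + ε) * (a (N + 1)) * (y (update c i (N + 1)) i - y (update c i N) i) := by
        refine mul_le_mul_of_nonneg_right ?_ (sub_nonneg.2 (hyR.mono c i N))
        rcases hN.lt_or_eq with hl | hl
        · exact ((hw i).hi (N + 1) hl).trans (hag (N + 1) (by omega))
        · rw [(hw i).top (N + 1) hl.ge, hl]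
          have := ha.nonneg k
          nlinarith
      have e1 : y (update c i (N + 1)) i = x (update (fun j => w j (c j)) i (w i (N + 1))) i := by
        simp only [hy, hwu]
      have e2 : y (update c i N) i = x (update (fun j => w j (c j)) i (w i N)) i := by
        simp only [hy, hwu]
      rw [e1, e2] at h2 ⊢
      linarith
  have hpt : ∀ v : Fin n → ℝ, ∑ i, ENNReal.ofReal (p (rnd a k univ w v) i) ≤
      ENNReal.ofReal (1 + ε) * ∑ i, ENNReal.ofReal (gpay a y (cl a k v) i) + ENNReal.ofReal (a 1) := by
    intro v
    set c := cl a k v with hc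
    have hrv : rnd a k univ w v = fun j => w j (c j) := by
      ext j; simp [rnd, hc, cl]
    rw [hrv, ← ENNReal.ofReal_sum_of_nonneg fun i _ => h.p0 _ i,
      ← ENNReal.ofReal_sum_of_nonneg fun i _ => gpay_nonneg ha hyR _ i,
      ← ENNReal.ofReal_mul (by linarith), ← ENNReal.ofReal_add
        (mul_nonneg (by linarith) (Finset.sum_nonneg fun i _ => gpay_nonneg ha hyR _ i)) (ha.nonneg 1)]
    refine ENNReal.ofReal_le_ofReal ?_
    have h1 : ∀ i, p (fun j => w j (c j)) i ≤ a 1 * y c i + (1 + ε) * gpay a y c i := by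
      intro i
      have := hone c i (c i) (cell_le a k (v i))
      rw [update_eq_self] at this
      refine this.trans ?_
      unfold gpay
      gcongr
      · exact ha.nonneg 1
      · have := IsRule.y_sub (y := y) c i (c i)
        rw [update_eq_self] at this
        have h3 : 0 ≤ ∑ l ∈ range (c i), (y (update c i (l + 1)) i - y (update c i l) i) :=
          Finset.sum_nonneg fun l _ => sub_nonneg.2 (hyR.mono c i l)
        linarith
    calc ∑ i, p (fun j => w j (c j)) i ≤ ∑ i, (a 1 * y c i + (1 + ε) * gpay a y c i) :=
          Finset.sum_le_sum fun i _ => h1 i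
      _ = a 1 * ∑ i, y c i + (1 + ε) * ∑ i, gpay a y c i := by
          rw [Finset.sum_add_distrib, Finset.mul_sum, Finset.mul_sum]
      _ ≤ a 1 * 1 + (1 + ε) * ∑ i, gpay a y c i := by
          gcongr
          · exact ha.nonneg 1
          · exact hyR.y1 c
      _ = _ := by ring
  refine (lintegral_mono hpt).trans (le_of_eq ?_)
  rw [lintegral_add_right _ measurable_const, lintegral_const_mul _ (meas_sum (grid_NM ha k hyR))]
  simp [LRev]
end grid
end RSC

namespace RSC
open Function Finset
open scoped ENNReal
set_option linter.unusedSectionVars false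

section approx
variable {n : ℕ}

noncomputable def ga (ε θ : ℝ) : ℕ → ℝ
  | 0 => 0
  | l + 1 => ε * θ * (1 + ε) ^ l

lemma ga_grid {ε θ : ℝ} (hε : 0 < ε) (hθ : 0 < θ) : Grid (ga ε θ) := by
  refine ⟨monotone_nat_of_le_succ fun l => ?_, rfl, fun l => ?_⟩
  · cases l with
    | zero => simp only [ga]; positivity
    | succ l =>
      simp only [ga]
      gcongr
      · linarith
      · omega
  · simp only [ga]; positivity

lemma ga_ratio {ε θ : ℝ} (l : ℕ) (hl : 1 ≤ l) :
    ga ε θ (l + 1) ≤ (1 + ε) * ga ε θ l := by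
  obtain ⟨l, rfl⟩ := Nat.exists_eq_add_of_le' hl
  simp only [ga, pow_succ]
  apply le_of_eq; ring

/-- number of grid points -/
lemma exists_k {ε : ℝ} (hε : 0 < ε) (hε' : ε ≤ 1 / 4) :
    ∃ k : ℕ, 0 < k ∧ (∀ θ, 0 < θ → θ / ε ≤ ga ε θ k ∧ ga ε θ k ≤ 2 * θ / ε) ∧
      (k + 1 : ℝ) ≤ 6 * Real.log (1 / ε) / ε := by
  have h1 : 1 ≤ 1 / ε ^ 2 := by
    rw [le_div_iff₀ (by positivity)]; nlinarith
  obtain ⟨l, hl1, hl2⟩ := exists_nat_pow_near h1 (show 1 < 1 + ε by linarith)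
  refine ⟨l + 2, by omega, ?_, ?_⟩
  · intro θ hθ
    have hl3 : (1 + ε) ^ (l + 1) ≤ 2 * (1 / ε ^ 2) := by
      rw [pow_succ, mul_comm]
      exact mul_le_mul (by linarith) hl1 (by positivity) (by norm_num)
    have e : ga ε θ (l + 2) = ε * θ * (1 + ε) ^ (l + 1) := rfl
    rw [e]
    have e1 : θ / ε = ε * θ * (1 / ε ^ 2) := by field_simp
    have e2 : 2 * θ / ε = ε * θ * (2 * (1 / ε ^ 2)) := by field_simp
    rw [e1, e2]
    exact ⟨mul_le_mul_of_nonneg_left hl2.le (by positivity), mul_le_mul_of_nonneg_left hl3 (by positivity)⟩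
  · have hL : 1 ≤ Real.log (1 / ε) := by
      rw [Real.le_log_iff_exp_le (by positivity)]
      have := Real.exp_one_lt_d9
      have : (4:ℝ) ≤ 1 / ε := by rw [le_div_iff₀ hε]; linarith
      linarith
    have a1 : l * Real.log (1 + ε) ≤ 2 * Real.log (1 / ε) := by
      have := Real.log_le_log (by positivity) hl1
      rw [Real.log_pow] at this
      have e : 1 / ε ^ 2 = (1 / ε) ^ 2 := by rw [one_div_pow]
      rw [e, Real.log_pow] at this
      exact_mod_cast this
    have a2 : ε * (4 / 5) ≤ Real.log (1 + ε) := by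
      have := Real.one_sub_inv_le_log_of_pos (show 0 < 1 + ε by linarith)
      refine le_trans ?_ this
      have e : 1 - (1 + ε)⁻¹ = ε / (1 + ε) := by field_simp; ring
      rw [e, le_div_iff₀ (by linarith)]
      nlinarith
    rw [le_div_iff₀ hε]
    push_cast
    have a3 : l * (ε * (4 / 5)) ≤ l * Real.log (1 + ε) := by gcongr
    nlinarith

lemma posted (D : Fin n → Measure ℝ) [∀ i, IsProbabilityMeasure (D i)] {θ : ℝ} (hθ : 0 < θ) :
    ENNReal.ofReal θ * (Measure.pi D) {v | ∃ i, θ ≤ v i} ≤ WW D := by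
  classical
  set a : ℕ → ℝ := fun l => θ * l with ha
  have hG : Grid a := ⟨fun l l' h => by simp only [ha]; gcongr, by simp [ha], fun l => by
    simp only [ha]; positivity⟩
  set y : (Fin n → ℕ) → Fin n → ℝ := fun c i => if 1 ≤ c i ∧ ∀ j < i, c j = 0 then 1 else 0 with hy
  have hyu : ∀ c i l, y (update c i l) i = if 1 ≤ l ∧ ∀ j < i, c j = 0 then 1 else 0 := by
    intro c i l
    simp only [hy, update_self]
    refine if_congr (and_congr_right fun _ => forall₂_congr fun j hj => ?_) rfl rfl
    rw [update_of_ne hj.ne]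
  have hR : IsRule y := by
    refine ⟨fun c i => by simp only [hy]; split_ifs <;> norm_num, fun c => ?_, fun c i l => ?_⟩
    · by_cases hc : ∃ i, 1 ≤ c i ∧ ∀ j < i, c j = 0
      · obtain ⟨i, hi⟩ := hc
        rw [Finset.sum_eq_single i]
        · simp only [hy]; split_ifs <;> norm_num
        · intro j _ hj
          simp only [hy]; rw [if_neg]
          rintro ⟨h1, h2⟩
          rcases lt_or_gt_of_ne hj with h | h
          · have := hi.2 j h; omega
          · have := h2 i h; omega
        · simp
      · rw [Finset.sum_eq_zero]
        · norm_num
        · intro i _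
          simp only [hy]; rw [if_neg fun h => hc ⟨i, h⟩]
    · rw [hyu, hyu]
      by_cases h : ∀ j < i, c j = 0
      · by_cases hl : 1 ≤ l
        · rw [if_pos ⟨hl, h⟩, if_pos ⟨by omega, h⟩]
        · rw [if_neg fun h => hl h.1]; split_ifs <;> norm_num
      · simp [h]
  refine le_trans ?_ (LRev_le_WW D (grid_NM hG 1 hR))
  have hms : MeasurableSet {v : Fin n → ℝ | ∃ i, θ ≤ v i} := by
    have : {v : Fin n → ℝ | ∃ i, θ ≤ v i} = ⋃ i, {v | θ ≤ v i} := by ext; simp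
    rw [this]
    exact MeasurableSet.iUnion fun i => measurableSet_le measurable_const (measurable_pi_apply i)
  rw [← lintegral_indicator_const hms]
  refine lintegral_mono fun v => ?_
  by_cases hv : ∃ i, θ ≤ v i
  · rw [Set.indicator_of_mem (show v ∈ {v : Fin n → ℝ | ∃ i, θ ≤ v i} from hv)]
    have hcl : ∀ i, θ ≤ v i ↔ 1 ≤ cl a 1 v i := by
      intro i
      have := le_cell hG (k := 1) (v := v i) (l := 0) one_pos
      simp only [ha, zero_add, Nat.cast_one, mul_one] at this
      exact this.symm
    obtain ⟨i, hi, hmin⟩ := WellFounded.has_min (wellFounded_lt (α := Fin n)) {i | θ ≤ v i} hv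
    have hi1 := (hcl i).1 hi
    have hi2 : ∀ j < i, cl a 1 v j = 0 := by
      intro j hj
      by_contra hc
      exact hmin j ((hcl j).2 (by omega)) hj
    have hc1 : cl a 1 v i = 1 := le_antisymm (cell_le a 1 (v i)) hi1
    refine le_trans ?_ (Finset.single_le_sum
      (f := fun i => ENNReal.ofReal (gpay a y (cl a 1 v) i)) (fun _ _ => zero_le) (mem_univ i))
    refine ENNReal.ofReal_le_ofReal ?_
    rw [gpay, hc1]
    simp only [Finset.sum_range_one, hyu]
    rw [if_pos ⟨le_rfl, hi2⟩, if_neg (by simp)]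
    simp [ha]
  · rw [Set.indicator_of_notMem (show v ∉ {v : Fin n → ℝ | ∃ i, θ ≤ v i} from hv)]
    exact zero_le

/-- probability that the maximum value is at least `θ` -/
noncomputable def pm (D : Fin n → Measure ℝ) (θ : ℝ) : ℝ := (Measure.pi D).real {v | ∃ i, θ ≤ v i}

lemma meas_max (θ : ℝ) : MeasurableSet {v : Fin n → ℝ | ∃ i, θ ≤ v i} := by
  have : {v : Fin n → ℝ | ∃ i, θ ≤ v i} = ⋃ i, {v | θ ≤ v i} := by ext; simp
  rw [this]
  exact MeasurableSet.iUnion fun i => measurableSet_le measurable_const (measurable_pi_apply i)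

lemma pm_eq (D : Fin n → Measure ℝ) [∀ i, IsProbabilityMeasure (D i)] (θ : ℝ) :
    1 - pm D θ = ∏ i, (1 - tl (D i) θ) := by
  rw [pm, ← probReal_compl_eq_one_sub (meas_max θ)]
  have : {v : Fin n → ℝ | ∃ i, θ ≤ v i}ᶜ = Set.univ.pi fun _ => Set.Iio θ := by
    ext v; simp
  rw [this, measureReal_def, Measure.pi_pi, ENNReal.toReal_prod]
  refine Finset.prod_congr rfl fun i _ => ?_
  rw [Iio_eq, ENNReal.toReal_ofReal (by linarith [tl_le_one (D i) θ])]

lemma tails (D : Fin n → Measure ℝ) [∀ i, IsProbabilityMeasure (D i)] (hR : ∀ i, Regular (D i))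
    {θ u ε : ℝ} (hθ : 0 < θ) (hε : 0 < ε) (hε' : ε ≤ 1 / 4) (hu : θ / ε ≤ u) (H : pm D (2 * θ) ≤ 3 / 4) :
    ∑ i, tl (D i) u ≤ 16 * ε := by
  have hp := pm_eq D (2 * θ)
  have hQ0 := fun i => tl_nonneg (D i) (2 * θ)
  have hQ1 := fun i => tl_le_one (D i) (2 * θ)
  have hQ : ∀ i, 1 / 4 ≤ 1 - tl (D i) (2 * θ) := by
    intro i
    have h1 : ∏ i, (1 - tl (D i) (2 * θ)) ≤ 1 - tl (D i) (2 * θ) := by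
      rw [← Finset.mul_prod_erase univ _ (mem_univ i)]
      refine mul_le_of_le_one_right (by linarith [hQ1 i]) (Finset.prod_le_one ?_ ?_)
      · intro j _; linarith [hQ1 j]
      · intro j _; linarith [hQ0 j]
    linarith
  have hS : ∑ i, tl (D i) (2 * θ) ≤ 2 := by
    by_contra! hc
    have h1 : ∏ i, (1 - tl (D i) (2 * θ)) ≤ Real.exp (- ∑ i, tl (D i) (2 * θ)) := by
      rw [← Finset.sum_neg_distrib, Real.exp_sum]
      refine Finset.prod_le_prod ?_ ?_
      · intro j _; linarith [hQ1 j]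
      · intro j _; exact Real.one_sub_le_exp_neg _
    have h2 : Real.exp (- ∑ i, tl (D i) (2 * θ)) < Real.exp (-2) := Real.exp_lt_exp.2 (by linarith)
    have h3 : Real.exp (-2) ≤ 1 / 4 := by
      rw [Real.exp_neg, show (2:ℝ) = 1 + 1 by norm_num, Real.exp_add]
      have := Real.add_one_le_exp (1:ℝ)
      rw [one_div]
      apply inv_anti₀ (by norm_num)
      nlinarith
    linarith
  have hu2 : 2 * θ ≤ u := by
    refine le_trans ?_ hu
    rw [le_div_iff₀ hε]; nlinarith
  have hq : ∀ i, tl (D i) u ≤ 8 * ε * tl (D i) (2 * θ) := by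
    intro i
    have h1 := reg_tail (D i) (hR i) (show 0 < 2 * θ by linarith) hu2
    have h2 := hQ i
    have h3 := tl_nonneg (D i) u
    have h4 : u * tl (D i) u * (1 / 4) ≤ 2 * θ * tl (D i) (2 * θ) :=
      le_trans (mul_le_mul_of_nonneg_left h2 (mul_nonneg (by linarith) h3)) h1
    have h5 : θ / ε * tl (D i) u ≤ u * tl (D i) u := mul_le_mul_of_nonneg_right hu h3
    have h6 : θ / ε * tl (D i) u ≤ 8 * θ * tl (D i) (2 * θ) := by linarith
    rw [div_mul_eq_mul_div, div_le_iff₀ hε] at h6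
    have h7 : θ * tl (D i) u ≤ θ * (8 * ε * tl (D i) (2 * θ)) := by linarith
    exact le_of_mul_le_mul_left h7 hθ
  calc ∑ i, tl (D i) u ≤ ∑ i, 8 * ε * tl (D i) (2 * θ) := Finset.sum_le_sum fun i _ => hq i
    _ = 8 * ε * ∑ i, tl (D i) (2 * θ) := by rw [Finset.mul_sum]
    _ ≤ 8 * ε * 2 := by gcongr
    _ = _ := by ring

lemma theta_le (D : Fin n → Measure ℝ) [∀ i, IsProbabilityMeasure (D i)]
    (h0 : ∀ i, D i (Set.Iio 0) = 0) (hR : ∀ i, Regular (D i))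
    {θ : ℝ} (hθ : 0 < θ) (H : 1 / 4 ≤ pm D θ) : θ / 4 ≤ (WW D).toReal := by
  have := posted D hθ
  rw [← ofReal_measureReal, ← ENNReal.ofReal_mul hθ.le] at this
  have h2 := (ENNReal.ofReal_le_iff_le_toReal (WW_lt_top D h0 hR).ne).1 this
  unfold pm at H
  nlinarith

lemma approx (D : Fin n → Measure ℝ) [∀ i, IsProbabilityMeasure (D i)]
    (h0 : ∀ i, D i (Set.Iio 0) = 0) (hR : ∀ i, Regular (D i))
    {θ ε : ℝ} (hθ : 0 < θ) (hε : 0 < ε) (hε' : ε ≤ 1 / 64) {k : ℕ} (hk : 0 < k)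
    (hk1 : θ / ε ≤ ga ε θ k)
    (H1 : 1 / 4 ≤ pm D θ) (H2 : pm D (2 * θ) ≤ 3 / 4) :
    ∃ y : (Fin n → ℕ) → Fin n → ℝ, IsRule y ∧
      (1 - 40 * ε) * (WW D).toReal ≤ (LRev D (fun v i => gpay (ga ε θ) y (cl (ga ε θ) k v) i)).toReal := by
  have hT := WW_lt_top D h0 hR
  have hth := theta_le D h0 hR hθ H1
  set W := (WW D).toReal with hW
  have hW0 : 0 < W := by linarith
  have hWe : WW D = ENNReal.ofReal W := (ENNReal.ofReal_toReal hT.ne).symm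
  have hlt : ENNReal.ofReal ((1 - ε) * W) < WW D := by
    rw [hWe]; exact (ENNReal.ofReal_lt_ofReal_iff hW0).2 (by nlinarith)
  obtain ⟨⟨⟨x, p⟩, h⟩, hp⟩ := lt_iSup_iff.1 hlt
  have h : NM x p := h
  have hp : ENNReal.ofReal ((1 - ε) * W) < LRev D p := hp
  have hG := ga_grid hε hθ
  set u := ga ε θ k with hu
  have hu0 : 0 < u := lt_of_lt_of_le (by positivity) hk1
  have hta := tails D hR hθ hε (by linarith) hk1 H2
  have hq : ∀ i, tl (D i) u ≤ 16 * ε := fun i =>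
    (Finset.single_le_sum (f := fun i => tl (D i) u) (fun j _ => tl_nonneg _ _) (mem_univ i)).trans hta
  have hb := trunc_bound D hR h hu0 hε hq (by linarith) (by linarith)
  obtain ⟨y, hy, hyl⟩ := discretize hG hk hε (fun l hl => ga_ratio l hl) D h0 (h.trunc hu0)
    (fun v i => tp_le h hu0 v i) (fun v i t j ht => tp_top ht v i j)
  refine ⟨y, hy, ?_⟩
  set V := (LRev D (fun v i => gpay (ga ε θ) y (cl (ga ε θ) k v) i)).toReal with hV
  have hVe : LRev D (fun v i => gpay (ga ε θ) y (cl (ga ε θ) k v) i) = ENNReal.ofReal V :=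
    (ENNReal.ofReal_toReal (lt_of_le_of_lt (LRev_le_WW D (grid_NM hG k hy)) hT).ne).symm
  have hV0 : 0 ≤ V := ENNReal.toReal_nonneg
  have ha1 : ga ε θ 1 = ε * θ := by simp [ga]
  have hL1 : LRev D (tp u x p) ≤ ENNReal.ofReal ((1 + ε) * V + ε * θ) := by
    rw [hVe, ← ENNReal.ofReal_mul (by linarith), ha1, ← ENNReal.ofReal_add (by positivity) (by positivity)] at hyl
    exact hyl
  have hκ : 0 ≤ (1 + ε) / (1 - 16 * ε) := div_nonneg (by linarith) (by linarith)
  have hfin : (1 - ε) * W ≤ 16 * ε * W + (1 + ε) / (1 - 16 * ε) * ((1 + ε) * V + ε * θ) := by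
    have : ENNReal.ofReal ((1 - ε) * W) ≤
        ENNReal.ofReal (16 * ε * W + (1 + ε) / (1 - 16 * ε) * ((1 + ε) * V + ε * θ)) := by
      refine hp.le.trans (hb.trans ?_)
      rw [ENNReal.ofReal_add (by positivity) (mul_nonneg hκ (by positivity)), ENNReal.ofReal_mul (by positivity),
        ENNReal.ofReal_mul hκ]
      refine add_le_add ?_ (mul_le_mul_right hL1 _)
      rw [hWe, ← ENNReal.ofReal_sum_of_nonneg fun j _ => tl_nonneg _ _]
      exact mul_le_mul_left (ENNReal.ofReal_le_ofReal hta) _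
    exact (ENNReal.ofReal_le_ofReal_iff
      (add_nonneg (by positivity) (mul_nonneg hκ (by positivity)))).1 this
  have h1 : (1 - 17 * ε) * W * (1 - 16 * ε) ≤ (1 + ε) * ((1 + ε) * V + ε * (4 * W)) := by
    have h2 : (1 - 17 * ε) * W ≤ (1 + ε) / (1 - 16 * ε) * ((1 + ε) * V + ε * (4 * W)) := by
      have : (1 + ε) / (1 - 16 * ε) * ((1 + ε) * V + ε * θ) ≤
          (1 + ε) / (1 - 16 * ε) * ((1 + ε) * V + ε * (4 * W)) := by
        refine mul_le_mul_of_nonneg_left ?_ hκ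
        have : ε * θ ≤ ε * (4 * W) := mul_le_mul_of_nonneg_left (by linarith) hε.le
        linarith
      linarith
    rw [div_mul_eq_mul_div, le_div_iff₀ (by linarith)] at h2
    exact h2
  have h2 : (1 - 40 * ε) * W * ((1 + ε) * (1 + ε)) ≤ V * ((1 + ε) * (1 + ε)) := by
    have e : (1 - 40 * ε) * ((1 + ε) * (1 + ε)) ≤ (1 - 17 * ε) * (1 - 16 * ε) - (1 + ε) * (ε * 4) := by
      nlinarith [mul_nonneg hε.le hε.le, mul_nonneg (mul_nonneg hε.le hε.le) hε.le]
    nlinarith [mul_le_mul_of_nonneg_right e hW0.le]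
  exact le_of_mul_le_mul_right h2 (by positivity)
end approx
end RSC

namespace RSC
open Function Finset
open scoped ENNReal
set_option linter.unusedSectionVars false

section freq
variable {J : Type*} [Fintype J] {Ω : Type*} [MeasurableSpace Ω]

/-- empirical frequency -/
noncomputable def fr (B : Set Ω) (s : J → Ω) : ℝ :=
  (∑ j, B.indicator (fun _ => (1:ℝ)) (s j)) / Fintype.card J

lemma fr_nonneg (B : Set Ω) (s : J → Ω) : 0 ≤ fr B s :=
  div_nonneg (Finset.sum_nonneg fun j _ => Set.indicator_nonneg (fun _ _ => zero_le_one) _) (by positivity)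

lemma fr_le_one (B : Set Ω) (s : J → Ω) : fr B s ≤ 1 := by
  refine div_le_one_of_le₀ ?_ (by positivity)
  calc ∑ j, B.indicator (fun _ => (1:ℝ)) (s j) ≤ ∑ j : J, 1 :=
        Finset.sum_le_sum fun j _ => Set.indicator_le_self' (fun _ _ => zero_le_one) _
    _ = _ := by simp

lemma meas_fr {B : Set Ω} (hB : MeasurableSet B) : Measurable (fr (J := J) B) := by
  refine Measurable.div_const (Finset.measurable_sum _ fun j _ => ?_) _
  exact (measurable_const.indicator hB).comp (measurable_pi_apply j)

variable (μ : Measure Ω) [IsProbabilityMeasure μ]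

lemma memLp_ind {B : Set Ω} (hB : MeasurableSet B) : MemLp (B.indicator (fun _ => (1:ℝ))) 2 μ :=
  memLp_indicator_const 2 hB 1 (Or.inr (measure_ne_top _ _))

lemma fr_memLp {B : Set Ω} (hB : MeasurableSet B) : MemLp (fr (J := J) B) 2 (Measure.pi fun _ => μ) := by
  refine MemLp.of_bound (meas_fr hB).aestronglyMeasurable 1 (Filter.Eventually.of_forall fun s => ?_)
  rw [Real.norm_eq_abs, abs_of_nonneg (fr_nonneg B s)]
  exact fr_le_one B s

lemma fr_mean [Nonempty J] {B : Set Ω} (hB : MeasurableSet B) :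
    ∫ s, fr (J := J) B s ∂(Measure.pi fun _ => μ) = μ.real B := by
  unfold fr
  rw [integral_div, integral_finsetSum]
  · have : ∀ j : J, ∫ s : J → Ω, B.indicator (fun _ => (1:ℝ)) (s j) ∂(Measure.pi fun _ => μ) = μ.real B := by
      intro j
      have := (measurePreserving_eval (fun _ : J => μ) j).map_eq
      rw [← integral_indicator_one hB]
      conv_rhs => rw [← this]
      rw [integral_map (measurable_pi_apply j).aemeasurable]
      · rfl
      · exact (measurable_const.indicator hB).aestronglyMeasurable
    simp only [this, Finset.sum_const, Finset.card_univ, nsmul_eq_mul]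
    field_simp
  · intro j _
    refine Integrable.of_bound (C := 1)
      ((measurable_const.indicator hB).comp (measurable_pi_apply j)).aestronglyMeasurable
      (Filter.Eventually.of_forall fun s => ?_)
    rw [Real.norm_eq_abs, abs_of_nonneg (Set.indicator_nonneg (fun _ _ => zero_le_one) _)]
    exact Set.indicator_le_self' (fun _ _ => zero_le_one) _

lemma fr_var [Nonempty J] {B : Set Ω} (hB : MeasurableSet B) :
    ProbabilityTheory.variance (fr (J := J) B) (Measure.pi fun _ => μ) =
      μ.real B * (1 - μ.real B) / Fintype.card J := by
  have h1 := ProbabilityTheory.variance_sum_pi (μ := fun _ : J => μ)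
    (X := fun _ => B.indicator (fun _ => (1:ℝ))) (fun _ => memLp_ind μ hB)
  have h2 : ProbabilityTheory.variance (B.indicator (fun _ => (1:ℝ))) μ = μ.real B * (1 - μ.real B) := by
    rw [ProbabilityTheory.variance_eq_sub (memLp_ind μ hB)]
    have e1 : (B.indicator (fun _ => (1:ℝ))) ^ 2 = B.indicator (fun _ => (1:ℝ)) := by
      ext ω; by_cases h : ω ∈ B <;> simp [h]
    have e2 : ∫ ω, B.indicator (fun _ => (1:ℝ)) ω ∂μ = μ.real B := integral_indicator_one hB
    rw [e1, e2]; ring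
  have e : fr (J := J) B = fun s => (Fintype.card J : ℝ)⁻¹ *
      (∑ j : J, fun s : J → Ω => B.indicator (fun _ => (1:ℝ)) (s j)) s := by
    ext s; simp [fr, div_eq_inv_mul]
  rw [e, ProbabilityTheory.variance_const_mul, h1]
  simp only [h2, Finset.sum_const, Finset.card_univ, nsmul_eq_mul]
  field_simp

lemma fr_sq [Nonempty J] {B : Set Ω} (hB : MeasurableSet B) :
    ∫ s, (fr (J := J) B s) ^ 2 ∂(Measure.pi fun _ => μ) =
      μ.real B ^ 2 + μ.real B * (1 - μ.real B) / Fintype.card J := by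
  have h1 := ProbabilityTheory.variance_eq_sub (fr_memLp (J := J) μ hB)
  rw [fr_var μ hB, fr_mean μ hB] at h1
  have : ∫ s, (fr (J := J) B s) ^ 2 ∂(Measure.pi fun _ => μ) =
    ∫ s, ((fr (J := J) B) ^ 2) s ∂(Measure.pi fun _ => μ) := rfl
  rw [this]; linarith

lemma fr_cheb [Nonempty J] {B : Set Ω} (hB : MeasurableSet B) :
    (Measure.pi fun _ : J => μ).real {s | 1 / 4 ≤ |fr B s - μ.real B|} ≤ 4 / Fintype.card J := by
  have h1 := ProbabilityTheory.meas_ge_le_variance_div_sq (fr_memLp (J := J) μ hB) (c := 1/4) (by norm_num)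
  rw [fr_mean μ hB, fr_var μ hB] at h1
  have h2 := ENNReal.toReal_mono ENNReal.ofReal_ne_top h1
  have hc : (0:ℝ) < Fintype.card J := by exact_mod_cast Fintype.card_pos
  have hp : 0 ≤ 1 - μ.real B := by linarith [measureReal_le_one (μ := μ) (s := B)]
  have hp' : 0 ≤ μ.real B := measureReal_nonneg
  rw [ENNReal.toReal_ofReal (by positivity)] at h2
  refine h2.trans ?_
  rw [div_div, div_le_div_iff₀ (by positivity) hc]
  have : μ.real B * (1 - μ.real B) ≤ 1 / 4 := by nlinarith [sq_nonneg (μ.real B - 1/2)]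
  nlinarith

lemma fr_null {B : Set Ω} (hB0 : μ B = 0) :
    ∀ᵐ s ∂(Measure.pi fun _ : J => μ), fr B s = 0 := by
  have : ∀ᵐ s ∂(Measure.pi fun _ : J => μ), ∀ j, s j ∉ B := by
    rw [ae_all_iff]
    intro j
    refine (measurePreserving_eval (fun _ : J => μ) j).quasiMeasurePreserving.ae (p := fun ω => ω ∉ B) ?_
    rw [ae_iff]; simpa using hB0
  filter_upwards [this] with s hs
  simp [fr, hs]

end freq

section swap
variable {J : Type*} [Fintype J] {n : ℕ} (D : Fin n → Measure ℝ) [∀ i, IsProbabilityMeasure (D i)]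

lemma swap_map : (Measure.pi fun _ : J => Measure.pi D).map (fun s i j => s j i) =
    Measure.pi fun i => Measure.pi fun _ : J => D i := by
  symm
  have hms : Measurable (fun (s : J → Fin n → ℝ) (i : Fin n) (j : J) => s j i) := by
    rw [measurable_pi_iff]; intro i
    rw [measurable_pi_iff]; intro j
    exact (measurable_pi_apply i).comp (measurable_pi_apply j)
  refine Measure.pi_eq_generateFrom
    (C := fun _ => Set.image Set.univ.pi (Set.univ.pi fun _ : J => {s : Set ℝ | MeasurableSet s}))
    (fun i => generateFrom_pi) (fun i => isPiSystem_pi) (fun i => ?_) ?_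
  · refine ⟨fun _ => Set.univ, fun _ => ⟨fun _ => Set.univ, ?_, ?_⟩, fun _ => measure_lt_top _ _, Set.iUnion_const _⟩
    · intro j _; exact (MeasurableSet.univ : MeasurableSet (Set.univ : Set ℝ))
    · simp
  · intro S hS
    choose T hT1 hT2 using hS
    have hT1' : ∀ i j, MeasurableSet (T i j) := fun i j => hT1 i j (Set.mem_univ j)
    have hSm : MeasurableSet (Set.univ.pi S) := by
      refine MeasurableSet.univ_pi fun i => ?_
      rw [← hT2 i]; exact MeasurableSet.univ_pi fun j => hT1' i j
    rw [Measure.map_apply hms hSm]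
    have : (fun (s : J → Fin n → ℝ) (i : Fin n) (j : J) => s j i) ⁻¹' (Set.univ.pi S) =
        Set.univ.pi fun j => Set.univ.pi fun i => T i j := by
      ext s
      simp only [← hT2, Set.mem_preimage, Set.mem_pi, Set.mem_univ, true_implies]
      exact forall_comm
    rw [this, Measure.pi_pi]
    simp only [Measure.pi_pi, ← hT2]
    exact Finset.prod_comm

lemma swap_integral {G : Fin n → (J → ℝ) → ℝ} (hG : ∀ i, Measurable (G i)) :
    ∫ s, ∏ i, G i (fun j => s j i) ∂(Measure.pi fun _ : J => Measure.pi D) =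
      ∏ i, ∫ t, G i t ∂(Measure.pi fun _ : J => D i) := by
  rw [← integral_fintype_prod_eq_prod, ← swap_map D, integral_map]
  · have hms : Measurable (fun (s : J → Fin n → ℝ) (i : Fin n) (j : J) => s j i) := by
      rw [measurable_pi_iff]; intro i
      rw [measurable_pi_iff]; intro j
      exact (measurable_pi_apply i).comp (measurable_pi_apply j)
    exact hms.aemeasurable
  · exact (Finset.measurable_prod _ fun i _ => (hG i).comp (measurable_pi_apply i)).aestronglyMeasurable
end swap

section learn
variable {n : ℕ}

/-- value of `F` under product of cell probabilities `Q` -/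
noncomputable def val (k : ℕ) (Q : Fin n → ℕ → ℝ) (F : (Fin n → ℕ) → ℝ) : ℝ :=
  ∑ c ∈ Fintype.piFinset (fun _ : Fin n => range (k + 1)), (∏ i, Q i (c i)) * F c

lemma val_diff (k : ℕ) {P Q : Fin n → ℕ → ℝ} (hP : ∀ i l, 0 ≤ P i l)
    (hP1 : ∀ i, ∑ l ∈ range (k + 1), P i l = 1) (hQ1 : ∀ i, ∑ l ∈ range (k + 1), Q i l = 1)
    (hPQ : ∀ i l, P i l = 0 → Q i l = 0) (F : (Fin n → ℕ) → ℝ) {r : ℝ} (hr : 0 < r) :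
    |val k Q F - val k P F| ≤ r / 2 * val k P (fun c => F c ^ 2) +
      (∏ i, ∑ l ∈ range (k + 1), Q i l ^ 2 / P i l - 1) / (2 * r) := by
  have hprod : ∀ R : Fin n → ℕ → ℝ, ∏ i, ∑ l ∈ range (k + 1), R i l =
      ∑ c ∈ Fintype.piFinset (fun _ : Fin n => range (k + 1)), ∏ i, R i (c i) := by
    intro R
    exact Finset.prod_univ_sum (fun _ : Fin n => range (k + 1)) R
  have hP' := hprod P
  have hQ' := hprod Q
  simp only [hP1, hQ1, Finset.prod_const_one] at hP' hQ'
  rw [hprod, val, val, val, ← Finset.sum_sub_distrib]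
  refine (Finset.abs_sum_le_sum_abs _ _).trans ?_
  have key : ∀ c : Fin n → ℕ, |(∏ i, Q i (c i)) * F c - (∏ i, P i (c i)) * F c| ≤
      r / 2 * ((∏ i, P i (c i)) * F c ^ 2) +
      (∏ i, (Q i (c i) ^ 2 / P i (c i)) - 2 * (∏ i, Q i (c i)) + ∏ i, P i (c i)) / (2 * r) := by
    intro c
    rw [Finset.prod_div_distrib, Finset.prod_pow]
    have hpn : 0 ≤ ∏ i, P i (c i) := Finset.prod_nonneg fun i _ => hP _ _
    rcases hpn.eq_or_lt with h | h
    · have : ∏ i, Q i (c i) = 0 := by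
        obtain ⟨i, _, hi⟩ := Finset.prod_eq_zero_iff.1 h.symm
        exact Finset.prod_eq_zero (mem_univ i) (hPQ _ _ hi)
      rw [this, ← h]; simp
    · set p := ∏ i, P i (c i)
      set q := ∏ i, Q i (c i)
      have e : r / 2 * (p * F c ^ 2) + (q ^ 2 / p - 2 * q + p) / (2 * r) =
          (p * r * F c) ^ 2 / (2 * r * p) + (q - p) ^ 2 / (2 * r * p) := by
        field_simp; ring
      rw [e, ← add_div, le_div_iff₀ (by positivity), ← sub_mul, abs_mul]
      have h1 := sq_abs (F c)
      have h2 := sq_abs (q - p)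
      have : |q - p| * |F c| * (2 * r * p) = 2 * |q - p| * (p * r * |F c|) := by ring
      rw [this]
      have h3 : (p * r * F c) ^ 2 = (p * r * |F c|) ^ 2 := by rw [mul_pow, mul_pow _ |F c|, h1]
      rw [h3, ← h2]
      nlinarith [sq_nonneg (|q - p| - p * r * |F c|)]
  refine (Finset.sum_le_sum fun c _ => key c).trans (le_of_eq ?_)
  rw [Finset.sum_add_distrib, ← Finset.mul_sum, ← Finset.sum_div, Finset.sum_add_distrib,
    Finset.sum_sub_distrib, ← Finset.mul_sum, ← hP', ← hQ']
  ring

/-- true cell probabilities -/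
noncomputable def cp (a : ℕ → ℝ) (k : ℕ) (D : Fin n → Measure ℝ) (i : Fin n) (l : ℕ) : ℝ :=
  (D i).real (cell a k ⁻¹' {l})

variable (a : ℕ → ℝ) (k : ℕ)

lemma ms_cell (l : ℕ) : MeasurableSet (cell a k ⁻¹' {l}) := meas_cell a k (measurableSet_singleton l)

lemma ind_sum (t : ℝ) (G : ℕ → ℝ) :
    ∑ l ∈ range (k + 1), (cell a k ⁻¹' {l}).indicator (fun _ => (1:ℝ)) t * G l = G (cell a k t) := by
  rw [Finset.sum_eq_single (cell a k t)]
  · simp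
  · intro l _ hl
    rw [Set.indicator_of_notMem, zero_mul]
    exact fun h => hl (show cell a k t = l from h).symm
  · intro h
    exact absurd (Finset.mem_range.2 (Nat.lt_succ_of_le (cell_le a k t))) h

lemma ind_sum_one (t : ℝ) :
    ∑ l ∈ range (k + 1), (cell a k ⁻¹' {l}).indicator (fun _ => (1:ℝ)) t = 1 := by
  have := ind_sum a k t fun _ => 1
  simpa using this

variable (D : Fin n → Measure ℝ) [∀ i, IsProbabilityMeasure (D i)]

lemma int_ind {B : Set ℝ} (hB : MeasurableSet B) (i : Fin n) :
    Integrable (B.indicator fun _ => (1:ℝ)) (D i) := (integrable_const 1).indicator hB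

lemma cp_sum (i : Fin n) : ∑ l ∈ range (k + 1), cp a k D i l = 1 := by
  have : ∀ l, cp a k D i l = ∫ t, (cell a k ⁻¹' {l}).indicator (fun _ => (1:ℝ)) t ∂(D i) := fun l =>
    (integral_indicator_one (ms_cell a k l)).symm
  simp only [this]
  rw [← integral_finsetSum _ fun l _ => int_ind D (ms_cell a k l) i]
  simp [ind_sum_one]

lemma val_eq (F : (Fin n → ℕ) → ℝ) :
    ∫ v, F (cl a k v) ∂(Measure.pi D) = val k (cp a k D) F := by
  have h1 : ∀ v : Fin n → ℝ, F (cl a k v) = ∑ c ∈ Fintype.piFinset (fun _ : Fin n => range (k + 1)),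
      (∏ i, (cell a k ⁻¹' {c i}).indicator (fun _ => (1:ℝ)) (v i)) * F c := by
    intro v
    rw [Finset.sum_eq_single (cl a k v)]
    · simp [cl]
    · intro c _ hc
      obtain ⟨i, hi⟩ := Function.ne_iff.1 hc
      rw [Finset.prod_eq_zero (mem_univ i), zero_mul]
      rw [Set.indicator_of_notMem]
      exact fun h => hi (show cell a k (v i) = c i from h).symm
    · intro h
      refine absurd ?_ h
      rw [Fintype.mem_piFinset]
      exact fun i => Finset.mem_range.2 (Nat.lt_succ_of_le (cell_le a k (v i)))
  simp only [h1]
  rw [integral_finsetSum]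
  · refine Finset.sum_congr rfl fun c _ => ?_
    rw [integral_mul_const,
      integral_fintype_prod_eq_prod (fun i t => (cell a k ⁻¹' {c i}).indicator (fun _ => (1:ℝ)) t)]
    congr 1
    refine Finset.prod_congr rfl fun i _ => ?_
    exact integral_indicator_one (ms_cell a k (c i))
  · intro c _
    refine Integrable.mul_const ?_ _
    refine Integrable.of_bound (C := 1) (Finset.measurable_prod _ fun i _ =>
      (measurable_const.indicator (ms_cell a k (c i))).comp (measurable_pi_apply i)).aestronglyMeasurable
      (Filter.Eventually.of_forall fun v => ?_)
    rw [Real.norm_eq_abs, abs_of_nonneg (Finset.prod_nonneg fun i _ =>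
      Set.indicator_nonneg (fun _ _ => zero_le_one) _)]
    exact Finset.prod_le_one (fun i _ => Set.indicator_nonneg (fun _ _ => zero_le_one) _)
      fun i _ => Set.indicator_le_self' (fun _ _ => zero_le_one) _

variable {J : Type*} [Fintype J]

/-- empirical cell probabilities -/
noncomputable def emp (s : J → Fin n → ℝ) (i : Fin n) (l : ℕ) : ℝ :=
  fr (cell a k ⁻¹' {l}) (fun j => s j i)

lemma emp_sum [Nonempty J] (s : J → Fin n → ℝ) (i : Fin n) : ∑ l ∈ range (k + 1), emp a k s i l = 1 := by
  unfold emp fr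
  rw [← Finset.sum_div, Finset.sum_comm]
  simp only [ind_sum_one]
  simp

lemma emp_null : ∀ᵐ s ∂(Measure.pi fun _ : J => Measure.pi D),
    ∀ i l, cp a k D i l = 0 → emp a k s i l = 0 := by
  rw [ae_all_iff]; intro i
  rw [ae_all_iff]; intro l
  by_cases h : cp a k D i l = 0
  · have h0 : (Measure.pi D) ((fun v => v i) ⁻¹' (cell a k ⁻¹' {l})) = 0 := by
      rw [(measurePreserving_eval D i).measure_preimage (ms_cell a k l).nullMeasurableSet]
      rwa [cp, measureReal_eq_zero_iff] at h
    filter_upwards [fr_null (J := J) (Measure.pi D) h0] with s hs _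
    exact hs
  · exact Filter.Eventually.of_forall fun s h' => absurd h' h

/-- chi-square quantity -/
noncomputable def chi (s : J → Fin n → ℝ) : ℝ :=
  ∏ i, ∑ l ∈ range (k + 1), emp a k s i l ^ 2 / cp a k D i l - 1

lemma meas_G (i : Fin n) : Measurable fun t : J → ℝ =>
    ∑ l ∈ range (k + 1), fr (cell a k ⁻¹' {l}) t ^ 2 / cp a k D i l :=
  Finset.measurable_sum _ fun l _ => ((meas_fr (ms_cell a k l)).pow_const 2).div_const _

lemma chi_integral [Nonempty J] :
    ∫ s, chi a k D s ∂(Measure.pi fun _ : J => Measure.pi D) ≤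
      (1 + (k + 1) / Fintype.card J) ^ n - 1 := by
  have hG0 : ∀ i (t : J → ℝ), 0 ≤ ∑ l ∈ range (k + 1), fr (cell a k ⁻¹' {l}) t ^ 2 / cp a k D i l :=
    fun i t => Finset.sum_nonneg fun l _ => div_nonneg (sq_nonneg _) measureReal_nonneg
  unfold chi
  rw [integral_sub]
  · have := swap_integral (J := J) D (G := fun i t =>
      ∑ l ∈ range (k + 1), fr (cell a k ⁻¹' {l}) t ^ 2 / cp a k D i l) (meas_G a k D)
    unfold emp
    rw [this]
    simp only [integral_const, probReal_univ, smul_eq_mul, mul_one]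
    gcongr
    have e : (1 + ((k:ℝ)+1)/Fintype.card J)^n = ∏ _i : Fin n, (1 + ((k:ℝ)+1)/Fintype.card J) := by simp
    rw [e]
    refine Finset.prod_le_prod (fun i _ => integral_nonneg (hG0 i)) fun i _ => ?_
    rw [integral_finsetSum]
    · have h1 : ∀ l, ∫ t, fr (J := J) (cell a k ⁻¹' {l}) t ^ 2 / cp a k D i l ∂(Measure.pi fun _ => D i) ≤
          cp a k D i l + 1 / Fintype.card J := by
        intro l
        rw [integral_div, fr_sq (D i) (ms_cell a k l)]
        have hp : 0 ≤ (D i).real (cell a k ⁻¹' {l}) := measureReal_nonneg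
        rcases hp.eq_or_lt with h | h
        · rw [cp, ← h]; simp
        · rw [cp]
          set q := (D i).real (cell a k ⁻¹' {l})
          have e : (q ^ 2 + q * (1 - q) / Fintype.card J) / q = q + (1 - q) / Fintype.card J := by
            field_simp
          rw [e]
          gcongr; linarith
      refine (Finset.sum_le_sum fun l _ => h1 l).trans (le_of_eq ?_)
      rw [Finset.sum_add_distrib, cp_sum]
      simp
      ring
    · intro l _
      exact ((fr_memLp (D i) (ms_cell a k l)).integrable_sq).div_const _
  · refine Integrable.of_bound (C := ∏ i, ∑ l ∈ range (k + 1), 1 / cp a k D i l)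
      (Measurable.aestronglyMeasurable ?_) (Filter.Eventually.of_forall fun s => ?_)
    · refine Finset.measurable_prod _ fun i _ => (meas_G a k D i).comp ?_
      rw [measurable_pi_iff]; intro j
      exact (measurable_pi_apply i).comp (measurable_pi_apply j)
    · have h0 : 0 ≤ ∏ i, ∑ l ∈ range (k+1), emp a k s i l^2/cp a k D i l :=
        Finset.prod_nonneg fun i _ => hG0 i _
      rw [Real.norm_eq_abs, abs_of_nonneg h0]
      refine Finset.prod_le_prod (fun i _ => hG0 i _) fun i _ => Finset.sum_le_sum fun l _ => ?_
      refine div_le_div_of_nonneg_right ?_ measureReal_nonneg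
      exact pow_le_one₀ (fr_nonneg _ _) (fr_le_one _ _)
  · exact integrable_const 1

lemma chi_integrable : Integrable (chi a k D) (Measure.pi fun _ : J => Measure.pi D) := by
  have hG0 : ∀ i (t : J → ℝ), 0 ≤ ∑ l ∈ range (k + 1), fr (cell a k ⁻¹' {l}) t ^ 2 / cp a k D i l :=
    fun i t => Finset.sum_nonneg fun l _ => div_nonneg (sq_nonneg _) measureReal_nonneg
  unfold chi
  refine Integrable.sub ?_ (integrable_const 1)
  refine Integrable.of_bound (C := ∏ i, ∑ l ∈ range (k + 1), 1 / cp a k D i l)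
      (Measurable.aestronglyMeasurable ?_) (Filter.Eventually.of_forall fun s => ?_)
  · refine Finset.measurable_prod _ fun i _ => (meas_G a k D i).comp ?_
    rw [measurable_pi_iff]; intro j
    exact (measurable_pi_apply i).comp (measurable_pi_apply j)
  · have h0 : 0 ≤ ∏ i, ∑ l ∈ range (k+1), emp a k s i l^2/cp a k D i l :=
        Finset.prod_nonneg fun i _ => hG0 i _
    rw [Real.norm_eq_abs, abs_of_nonneg h0]
    refine Finset.prod_le_prod (fun i _ => hG0 i _) fun i _ => Finset.sum_le_sum fun l _ => ?_
    refine div_le_div_of_nonneg_right ?_ measureReal_nonneg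
    exact pow_le_one₀ (fr_nonneg _ _) (fr_le_one _ _)
end learn
end RSC

namespace RSC
open Function Finset
open scoped ENNReal
set_option linter.unusedSectionVars false

section sel
variable {n : ℕ}

/-- total payment of a grid rule -/
def fpay (a : ℕ → ℝ) (y : (Fin n → ℕ) → Fin n → ℝ) (c : Fin n → ℕ) : ℝ := ∑ i, gpay a y c i

lemma fpay_nonneg {a : ℕ → ℝ} (ha : Grid a) {y : (Fin n → ℕ) → Fin n → ℝ} (hy : IsRule y) (c) :
    0 ≤ fpay a y c := Finset.sum_nonneg fun i _ => gpay_nonneg ha hy c i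

lemma fpay_le {a : ℕ → ℝ} (ha : Grid a) {y : (Fin n → ℕ) → Fin n → ℝ} (hy : IsRule y) {k : ℕ}
    {c : Fin n → ℕ} (hc : c ∈ Fintype.piFinset (fun _ : Fin n => range (k + 1))) :
    fpay a y c ≤ a k := by
  refine sum_gpay_le ha hy c fun i => ?_
  have := Fintype.mem_piFinset.1 hc i
  exact Nat.lt_succ_iff.1 (Finset.mem_range.1 this)

lemma zero_rule : IsRule (fun (_ : Fin n → ℕ) (_ : Fin n) => (0:ℝ)) :=
  ⟨fun _ _ => le_rfl, fun _ => by simp, fun _ _ _ => le_rfl⟩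

/-- near-optimal rule for given cell probabilities -/
def IsBest (a : ℕ → ℝ) (k : ℕ) (δ : ℝ) (Q : Fin n → ℕ → ℝ) (y : (Fin n → ℕ) → Fin n → ℝ) : Prop :=
  IsRule y ∧ ∀ y', IsRule y' → val k Q (fpay a y') - δ ≤ val k Q (fpay a y)

lemma exists_best {a : ℕ → ℝ} (ha : Grid a) (k : ℕ) {δ : ℝ} (hδ : 0 < δ) (Q : Fin n → ℕ → ℝ) :
    ∃ y, IsBest a k δ Q y := by
  set S : Set ℝ := {z | ∃ y, IsRule y ∧ z = val k Q (fpay a y)} with hS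
  have hne : S.Nonempty := ⟨_, _, zero_rule, rfl⟩
  have hb : BddAbove S := by
    refine ⟨∑ c ∈ Fintype.piFinset (fun _ : Fin n => range (k + 1)), |∏ i, Q i (c i)| * a k, ?_⟩
    rintro z ⟨y, hy, rfl⟩
    refine Finset.sum_le_sum fun c hc => ?_
    calc (∏ i, Q i (c i)) * fpay a y c ≤ |∏ i, Q i (c i)| * fpay a y c :=
          mul_le_mul_of_nonneg_right (le_abs_self _) (fpay_nonneg ha hy c)
      _ ≤ _ := mul_le_mul_of_nonneg_left (fpay_le ha hy hc) (abs_nonneg _)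
  obtain ⟨z, ⟨y, hy, rfl⟩, hz⟩ := exists_lt_of_lt_csSup hne (show sSup S - δ < sSup S by linarith)
  refine ⟨y, hy, fun y' hy' => ?_⟩
  have := le_csSup hb (show val k Q (fpay a y') ∈ S from ⟨y', hy', rfl⟩)
  linarith

open Classical in
/-- chosen near-optimal rule -/
noncomputable def best (a : ℕ → ℝ) (k : ℕ) (δ : ℝ) (Q : Fin n → ℕ → ℝ) : (Fin n → ℕ) → Fin n → ℝ :=
  if h : ∃ y, IsBest a k δ Q y then h.choose else fun _ _ => 0

lemma best_rule (a : ℕ → ℝ) (k : ℕ) (δ : ℝ) (Q : Fin n → ℕ → ℝ) : IsRule (best a k δ Q) := by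
  unfold best
  split_ifs with h
  · exact h.choose_spec.1
  · exact zero_rule

lemma best_spec {a : ℕ → ℝ} (ha : Grid a) (k : ℕ) {δ : ℝ} (hδ : 0 < δ) (Q : Fin n → ℕ → ℝ) :
    IsBest a k δ Q (best a k δ Q) := by
  have h := exists_best ha k hδ Q
  unfold best
  rw [dif_pos h]
  exact h.choose_spec

variable {J : Type*} [Fintype J]

/-- empirical frequencies from the cell matrix -/
noncomputable def empc (C : J → Fin n → ℕ) (i : Fin n) (l : ℕ) : ℝ :=
  (∑ j, if C j i = l then (1:ℝ) else 0) / Fintype.card J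

lemma emp_eq (a : ℕ → ℝ) (k : ℕ) (s : J → Fin n → ℝ) :
    emp a k s = empc (fun j => cl a k (s j)) := by
  funext i l
  unfold emp fr empc cl
  congr 1
  refine Finset.sum_congr rfl fun j _ => ?_
  by_cases h : cell a k (s j i) = l
  · rw [if_pos h, Set.indicator_of_mem (show s j i ∈ cell a k ⁻¹' {l} from h)]
  · rw [if_neg h, Set.indicator_of_notMem (show s j i ∉ cell a k ⁻¹' {l} from h)]

/-- the learned rule -/
noncomputable def learned (a : ℕ → ℝ) (k : ℕ) (δ : ℝ) (s : J → Fin n → ℝ) : (Fin n → ℕ) → Fin n → ℝ :=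
  best a k δ (empc (fun j => cl a k (s j)))

lemma meas_learned (a : ℕ → ℝ) (k : ℕ) (δ : ℝ) (Φ : ((Fin n → ℕ) → Fin n → ℝ) → ℝ) :
    Measurable fun s : J → Fin n → ℝ => Φ (learned a k δ s) := by
  have h1 : Measurable fun s : J → Fin n → ℝ => fun j => cl a k (s j) := by
    rw [measurable_pi_iff]
    exact fun j => (meas_cl a k).comp (measurable_pi_apply j)
  exact (Measurable.of_discrete (f := fun C : J → Fin n → ℕ => Φ (best a k δ (empc C)))).comp h1

variable (a : ℕ → ℝ) (k : ℕ) (D : Fin n → Measure ℝ) [∀ i, IsProbabilityMeasure (D i)]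

/-- revenue of a grid rule -/
noncomputable def rv (y : (Fin n → ℕ) → Fin n → ℝ) : ℝ := val k (cp a k D) (fpay a y)

lemma rv_Rev (x : (Fin n → ℝ) → Fin n → ℝ) (y : (Fin n → ℕ) → Fin n → ℝ) :
    Rev (Mech.mk x (fun v i => gpay a y (cl a k v) i)) (Measure.pi D) = rv a k D y :=
  val_eq a k D (fpay a y)

variable {a}

lemma rv_LRev (ha : Grid a) {y : (Fin n → ℕ) → Fin n → ℝ} (hy : IsRule y) :
    (LRev D (fun v i => gpay a y (cl a k v) i)).toReal = rv a k D y := by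
  rw [rv, ← val_eq a k D, integral_eq_lintegral_of_nonneg_ae
    (Filter.Eventually.of_forall fun v => fpay_nonneg ha hy _)
    ((Measurable.of_discrete (f := fpay a y)).comp (meas_cl a k)).aestronglyMeasurable]
  unfold LRev fpay
  congr 1
  refine lintegral_congr fun v => ?_
  rw [ENNReal.ofReal_sum_of_nonneg fun i _ => gpay_nonneg ha hy _ _]

lemma rv_le (ha : Grid a) (hW : WW D < ∞) {y : (Fin n → ℕ) → Fin n → ℝ} (hy : IsRule y) :
    rv a k D y ≤ (WW D).toReal := by
  rw [← rv_LRev k D ha hy]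
  exact ENNReal.toReal_mono hW.ne (LRev_le_WW D (grid_NM ha k hy))

lemma rv_nonneg (ha : Grid a) {y : (Fin n → ℕ) → Fin n → ℝ} (hy : IsRule y) : 0 ≤ rv a k D y := by
  rw [← rv_LRev k D ha hy]; exact ENNReal.toReal_nonneg

lemma val_sq_le (ha : Grid a) (hW : WW D < ∞) {y : (Fin n → ℕ) → Fin n → ℝ} (hy : IsRule y) :
    val k (cp a k D) (fun c => fpay a y c ^ 2) ≤ a k * (WW D).toReal := by
  refine le_trans ?_ (mul_le_mul_of_nonneg_left (rv_le k D ha hW hy) (ha.nonneg k))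
  unfold rv val
  rw [Finset.mul_sum]
  refine Finset.sum_le_sum fun c hc => ?_
  have h1 := fpay_le ha hy hc
  have h2 := fpay_nonneg ha hy c
  have h3 : 0 ≤ ∏ i, cp a k D i (c i) := Finset.prod_nonneg fun i _ => measureReal_nonneg
  calc (∏ i, cp a k D i (c i)) * fpay a y c ^ 2 = (∏ i, cp a k D i (c i)) * fpay a y c * fpay a y c := by ring
    _ ≤ (∏ i, cp a k D i (c i)) * fpay a y c * a k := mul_le_mul_of_nonneg_left h1 (by positivity)
    _ = _ := by ring

lemma learn_pt [Nonempty J] (ha : Grid a) (hW : WW D < ∞) {y : (Fin n → ℕ) → Fin n → ℝ}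
    (hy : IsRule y) {δ r : ℝ} (hδ : 0 < δ) (hr : 0 < r) {s : J → Fin n → ℝ}
    (hs : ∀ i l, cp a k D i l = 0 → emp a k s i l = 0) :
    rv a k D y - δ - r * (a k * (WW D).toReal) - chi a k D s / r ≤ rv a k D (learned a k δ s) := by
  have hd : ∀ y, IsRule y → |val k (emp a k s) (fpay a y) - rv a k D y| ≤
      r / 2 * (a k * (WW D).toReal) + chi a k D s / (2 * r) := by
    intro y hy
    have h := val_diff k (P := cp a k D) (fun i l => measureReal_nonneg) (cp_sum a k D)
      (emp_sum a k s) hs (fpay a y) hr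
    have h' := mul_le_mul_of_nonneg_left (val_sq_le k D ha hW hy) (show 0 ≤ r / 2 by positivity)
    unfold rv chi
    linarith
  have h1 := (abs_le.1 (hd y hy)).1
  have h2 := (abs_le.1 (hd _ (best_rule a k δ (emp a k s)))).2
  have h3 := (best_spec ha k hδ (emp a k s)).2 y hy
  have h4 : learned a k δ s = best a k δ (emp a k s) := by rw [emp_eq]; rfl
  rw [h4]
  have e : chi a k D s / r = chi a k D s / (2 * r) + chi a k D s / (2 * r) := by field_simp; ring
  rw [e]
  linarith

lemma learned_rule (a : ℕ → ℝ) (δ : ℝ) (s : J → Fin n → ℝ) : IsRule (learned a k δ s) :=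
  best_rule _ _ _ _

lemma learned_integrable (ha : Grid a) (hW : WW D < ∞) (δ : ℝ) :
    Integrable (fun s : J → Fin n → ℝ => rv a k D (learned a k δ s))
      (Measure.pi fun _ : J => Measure.pi D) := by
  refine Integrable.of_bound (C := (WW D).toReal) (meas_learned a k δ _).aestronglyMeasurable
    (Filter.Eventually.of_forall fun s => ?_)
  rw [Real.norm_eq_abs, abs_of_nonneg (rv_nonneg k D ha (learned_rule k a δ s))]
  exact rv_le k D ha hW (learned_rule k a δ s)

lemma learn_int [Nonempty J] (ha : Grid a) (hW : WW D < ∞) {y : (Fin n → ℕ) → Fin n → ℝ}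
    (hy : IsRule y) {δ r : ℝ} (hδ : 0 < δ) (hr : 0 < r) :
    rv a k D y - δ - r * (a k * (WW D).toReal) - ((1 + (k + 1) / Fintype.card J) ^ n - 1) / r ≤
      ∫ s : J → Fin n → ℝ, rv a k D (learned a k δ s) ∂(Measure.pi fun _ : J => Measure.pi D) := by
  have h1 : ∫ s : J → Fin n → ℝ, (rv a k D y - δ - r * (a k * (WW D).toReal) - chi a k D s / r)
      ∂(Measure.pi fun _ : J => Measure.pi D) ≤
      ∫ s : J → Fin n → ℝ, rv a k D (learned a k δ s) ∂(Measure.pi fun _ : J => Measure.pi D) := by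
    refine integral_mono_ae ?_ (learned_integrable k D ha hW δ) ?_
    · exact (integrable_const _).sub ((chi_integrable a k D).div_const r)
    · filter_upwards [emp_null (J := J) a k D] with s hs
      exact learn_pt k D ha hW hy hδ hr hs
  rw [integral_sub (integrable_const _) ((chi_integrable a k D).div_const r), integral_div,
    integral_const, probReal_univ, one_smul] at h1
  refine le_trans ?_ h1
  have := chi_integral (J := J) a k D
  gcongr
end sel

section good
variable {n : ℕ} (D : Fin n → Measure ℝ) [∀ i, IsProbabilityMeasure (D i)]
variable {J : Type*} [Fintype J]

lemma pow_bound {x : ℝ} (hx : 0 ≤ x) (n : ℕ) (h : n * x ≤ 1) : (1 + x) ^ n - 1 ≤ 2 * (n * x) := by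
  have h1 : (1 + x) ^ n ≤ Real.exp (n * x) := by
    rw [Real.exp_nat_mul]
    exact pow_le_pow_left₀ (by linarith) (by linarith [Real.add_one_le_exp x]) n
  have hnx : 0 ≤ n * x := by positivity
  have h2 := Real.abs_exp_sub_one_le (x := n * x) (by rw [abs_of_nonneg hnx]; exact h)
  rw [abs_of_nonneg hnx] at h2
  linarith [(abs_le.1 h2).2]

lemma learn_good [Nonempty J] (h0 : ∀ i, D i (Set.Iio 0) = 0) (hR : ∀ i, Regular (D i))
    {θ ε : ℝ} (hθ : 0 < θ) (hε : 0 < ε) (hε' : ε ≤ 1 / 64) {k : ℕ} (hk : 0 < k)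
    (hk1 : θ / ε ≤ ga ε θ k) (hk2 : ga ε θ k ≤ 2 * θ / ε)
    (H1 : 1 / 4 ≤ pm D θ) (H2 : pm D (2 * θ) ≤ 3 / 4)
    (hm : n * ((k + 1 : ℝ) / Fintype.card J) ≤ ε ^ 3) :
    (1 - 61 * ε) * (WW D).toReal ≤
      ∫ s : J → Fin n → ℝ, rv (ga ε θ) k D (learned (ga ε θ) k (ε * θ) s)
        ∂(Measure.pi fun _ : J => Measure.pi D) := by
  obtain ⟨y, hy, hV⟩ := approx D h0 hR hθ hε hε' hk hk1 H1 H2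
  have ha := ga_grid hε hθ
  have hW := WW_lt_top D h0 hR
  rw [rv_LRev k D ha hy] at hV
  have hu : 0 < ga ε θ k := lt_of_lt_of_le (by positivity) hk1
  have ht := theta_le D h0 hR hθ H1
  set u := ga ε θ k with hu'
  set W := (WW D).toReal with hWd
  have hr : 0 < ε / u := by positivity
  have h := learn_int (J := J) k D ha hW hy (show 0 < ε * θ by positivity) hr
  refine le_trans ?_ h
  have hp := pow_bound (x := (k + 1 : ℝ) / Fintype.card J) (by positivity) n
    (hm.trans (pow_le_one₀ hε.le (by linarith)))
  have e1 : ε / u * (u * W) = ε * W := by field_simp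
  have e2 : ((1 + ((k:ℝ) + 1) / Fintype.card J) ^ n - 1) / (ε / u) ≤ 16 * ε * W := by
    rw [div_le_iff₀ hr]
    have e3 : ε / u ≥ ε ^ 2 / (8 * W) := by
      have hW0 : 0 < W := by linarith
      rw [ge_iff_le, div_le_div_iff₀ (by positivity) hu]
      have : u * ε ≤ 2 * θ := (le_div_iff₀ hε).1 hk2
      nlinarith
    have hW0 : 0 < W := by linarith
    calc _ ≤ 2 * ε ^ 3 := by linarith
      _ = 16 * ε * W * (ε ^ 2 / (8 * W)) := by field_simp; ring
      _ ≤ _ := mul_le_mul_of_nonneg_left e3 (by positivity)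
  rw [← hu', ← hWd] at *
  rw [e1]
  have : ε * θ ≤ 4 * ε * W := by nlinarith
  linarith
end good
end RSC

namespace RSC
open Function Finset
open scoped ENNReal
set_option linter.unusedSectionVars false

section theta
variable {n : ℕ} {J : Type*} [Fintype J]

/-- the max value is at least `2^l` -/
def mx (n : ℕ) (l : ℤ) : Set (Fin n → ℝ) := {v | ∃ i, (2:ℝ) ^ l ≤ v i}

/-- empirical median test -/
def cond (l : ℤ) (s : J → Fin n → ℝ) : Prop := 1 / 2 ≤ fr (mx n l) s

def gd (l : ℤ) (s : J → Fin n → ℝ) : Prop := cond l s ∧ ¬ cond (l + 1) s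

lemma meas_cond (l : ℤ) : MeasurableSet {s : J → Fin n → ℝ | cond l s} :=
  measurableSet_le measurable_const (meas_fr (meas_max _))

lemma meas_gd (l : ℤ) : MeasurableSet {s : J → Fin n → ℝ | gd l s} :=
  (meas_cond l).inter (meas_cond (l + 1)).compl

lemma cond_anti {l l' : ℤ} (h : l ≤ l') {s : J → Fin n → ℝ} (hc : cond l' s) : cond l s := by
  unfold cond fr at *
  refine hc.trans ?_
  gcongr with j _
  have hsub : mx n l' ⊆ mx n l := by
    rintro v ⟨i, hi⟩
    exact ⟨i, le_trans (zpow_le_zpow_right₀ (by norm_num) h) hi⟩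
  exact hsub

/-- search predicate -/
def srch (s : J → Fin n → ℝ) (N : ℕ) : Prop :=
  gd ((Denumerable.eqv ℤ).symm N) s ∨ ∀ M : ℕ, ¬ gd ((Denumerable.eqv ℤ).symm M) s

lemma srch_ex (s : J → Fin n → ℝ) : ∃ N, srch s N := by
  by_cases h : ∃ N : ℕ, gd ((Denumerable.eqv ℤ).symm N) s
  · obtain ⟨N, hN⟩ := h; exact ⟨N, Or.inl hN⟩
  · exact ⟨0, Or.inr (not_exists.1 h)⟩

open Classical in
noncomputable def jhat (s : J → Fin n → ℝ) : ℤ := (Denumerable.eqv ℤ).symm (Nat.find (srch_ex s))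

lemma meas_jhat : Measurable (jhat (n := n) (J := J)) := by
  classical
  have h : Measurable fun s : J → Fin n → ℝ => Nat.find (srch_ex s) := by
    refine measurable_find srch_ex fun N => ?_
    have : {s : J → Fin n → ℝ | srch s N} = {s | gd ((Denumerable.eqv ℤ).symm N) s} ∪
        ⋂ M : ℕ, {s | gd ((Denumerable.eqv ℤ).symm M) s}ᶜ := by
      ext s; simp [srch]
    rw [this]
    exact (meas_gd _).union (MeasurableSet.iInter fun M => (meas_gd _).compl)
  have h2 := (Measurable.of_discrete (f := fun N : ℕ => (Denumerable.eqv ℤ).symm N)).comp h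
  convert h2 using 1
  funext s
  unfold jhat
  simp only [comp]

lemma jhat_spec {s : J → Fin n → ℝ} (h : ∃ l, gd l s) : gd (jhat s) s := by
  classical
  obtain ⟨l, hl⟩ := h
  have := Nat.find_spec (srch_ex s)
  rcases this with h | h
  · unfold jhat; convert h
  · exact absurd (by simpa using hl) (h (Denumerable.eqv ℤ l))

lemma exists_gd {s : J → Fin n → ℝ} {j1 j2 : ℤ} (h2 : cond j2 s) (h1 : ¬ cond j1 s) : ∃ l, gd l s := by
  obtain ⟨l, hl, hm⟩ := Int.exists_greatest_of_bdd (P := fun l => cond l s)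
    ⟨j1, fun z hz => by
      by_contra hlt
      exact h1 (cond_anti (by omega) hz)⟩ ⟨j2, h2⟩
  exact ⟨l, hl, fun h => by have := hm _ h; omega⟩

variable (D : Fin n → Measure ℝ) [∀ i, IsProbabilityMeasure (D i)]

lemma pm_anti {s t : ℝ} (h : s ≤ t) : pm D t ≤ pm D s :=
  measureReal_mono fun _ ⟨i, hi⟩ => ⟨i, h.trans hi⟩

lemma tl_le_pm (i : Fin n) (t : ℝ) : tl (D i) t ≤ pm D t := by
  have h : 1 - pm D t ≤ 1 - tl (D i) t := by
    rw [pm_eq, ← Finset.mul_prod_erase _ _ (mem_univ i)]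
    refine mul_le_of_le_one_right (by linarith [tl_le_one (D i) t]) ?_
    exact Finset.prod_le_one (fun j _ => by linarith [tl_le_one (D j) t])
      fun j _ => by linarith [tl_nonneg (D j) t]
  linarith

lemma exists_pos (hW0 : WW D ≠ 0) : ∃ i t, 0 < t ∧ 0 < tl (D i) t := by
  by_contra hcon
  push Not at hcon
  apply hW0
  have hz : ∀ i, ∀ᵐ x ∂(D i), x ≤ 0 := by
    intro i
    have h1 : ∀ N : ℕ, ∀ᵐ x ∂(D i), x < 1 / ((N:ℝ) + 1) := by
      intro N
      have h2 := hcon i (1 / ((N:ℝ) + 1)) (by positivity)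
      have h3 : (D i).real (Set.Ici (1 / ((N:ℝ) + 1))) = 0 := le_antisymm h2 measureReal_nonneg
      rw [measureReal_eq_zero_iff] at h3
      rw [ae_iff]
      convert h3 using 2
      ext x; simp
    filter_upwards [ae_all_iff.2 h1] with x hx
    by_contra hx0
    obtain ⟨N, hN⟩ := exists_nat_one_div_lt (not_le.1 hx0)
    exact absurd (hx N) (not_lt.2 hN.le)
  have hz' : ∀ᵐ v ∂(Measure.pi D), ∀ i, v i ≤ 0 := by
    rw [ae_all_iff]; intro i
    exact (measurePreserving_eval D i).quasiMeasurePreserving.ae (hz i)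
  unfold WW
  rw [ENNReal.iSup_eq_zero]
  rintro ⟨⟨x, p⟩, h⟩
  unfold LRev
  rw [lintegral_eq_zero_iff (meas_sum h)]
  filter_upwards [hz'] with v hv
  refine Finset.sum_eq_zero fun i _ => ?_
  rw [ENNReal.ofReal_eq_zero]
  have := h.ib v i
  rwa [max_eq_right (hv i)] at this

lemma pm_large (hR : ∀ i, Regular (D i)) (hW0 : WW D ≠ 0) : ∃ j : ℤ, 3 / 4 < pm D ((2:ℝ) ^ j) := by
  obtain ⟨i, t, ht, htl⟩ := exists_pos D hW0
  have hx : 0 < min t (t * tl (D i) t / 8) := lt_min ht (by positivity)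
  obtain ⟨N, hN⟩ := exists_pow_lt_of_lt_one hx (show (1/2:ℝ) < 1 by norm_num)
  refine ⟨-(N:ℤ), ?_⟩
  have e : (2:ℝ) ^ (-(N:ℤ)) = (1 / 2) ^ N := by
    rw [zpow_neg, zpow_natCast, one_div, inv_pow]
  rw [e]
  set s : ℝ := (1 / 2) ^ N with hs
  have hs0 : 0 < s := by positivity
  have h1 := reg_tail (D i) (hR i) hs0 (hN.le.trans (min_le_left _ _))
  have h2 : s < t * tl (D i) t / 8 := hN.trans_le (min_le_right _ _)
  have h3 := tl_le_one (D i) s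
  have h4 := tl_le_pm D i s
  by_contra hcon
  have h5 : tl (D i) s ≤ 3 / 4 := by linarith
  have h6 : 0 < t * tl (D i) t := by positivity
  nlinarith

lemma pm_small (hW : WW D < ∞) : ∃ j : ℤ, pm D ((2:ℝ) ^ j) < 1 / 4 := by
  obtain ⟨N, hN⟩ := pow_unbounded_of_one_lt (4 * (WW D).toReal) (show (1:ℝ) < 2 by norm_num)
  refine ⟨(N:ℤ), ?_⟩
  rw [zpow_natCast]
  have hθ : (0:ℝ) < 2 ^ N := by positivity
  have := posted D hθ
  rw [← ofReal_measureReal, ← ENNReal.ofReal_mul hθ.le] at this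
  have h2 := (ENNReal.ofReal_le_iff_le_toReal hW.ne).1 this
  have h3 : (2:ℝ) ^ N * pm D (2 ^ N) ≤ (WW D).toReal := h2
  by_contra hcon
  nlinarith

lemma zmono {j j' : ℤ} (h : j ≤ j') : (2:ℝ) ^ j ≤ 2 ^ j' := zpow_le_zpow_right₀ (by norm_num) h

/-- good scale -/
def gs (j : ℤ) : Prop := 1 / 4 ≤ pm D ((2:ℝ) ^ j) ∧ pm D (2 * (2:ℝ) ^ j) ≤ 3 / 4

lemma theta_est [Nonempty J] (hR : ∀ i, Regular (D i)) (hW0 : WW D ≠ 0) (hW : WW D < ∞) :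
    (Measure.pi fun _ : J => Measure.pi D).real {s | ¬ gs D (jhat s)} ≤ 8 / Fintype.card J := by
  obtain ⟨ja, hja⟩ := pm_large D hR hW0
  obtain ⟨jb, hjb⟩ := pm_small D hW
  obtain ⟨j1, hj1, hm1⟩ := Int.exists_least_of_bdd (P := fun j => pm D ((2:ℝ) ^ j) < 1 / 4)
    ⟨ja, fun z hz => by
      by_contra hlt
      have := pm_anti D (zmono (show z ≤ ja by omega))
      linarith⟩ ⟨jb, hjb⟩
  obtain ⟨j2, hj2, hm2⟩ := Int.exists_greatest_of_bdd (P := fun j => 3 / 4 < pm D ((2:ℝ) ^ j))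
    ⟨jb, fun z hz => by
      by_contra hlt
      have := pm_anti D (zmono (show jb ≤ z by omega))
      linarith⟩ ⟨ja, hja⟩
  have c1 := fr_cheb (J := J) (Measure.pi D) (meas_max (n := n) ((2:ℝ) ^ j1))
  have c2 := fr_cheb (J := J) (Measure.pi D) (meas_max (n := n) ((2:ℝ) ^ j2))
  refine le_trans (measureReal_mono ?_) ((measureReal_union_le _ _).trans
    ((add_le_add c1 c2).trans (le_of_eq (by ring))))
  intro s hs
  by_contra hcon
  simp only [Set.mem_union, Set.mem_ofPred_eq, not_or, not_le] at hcon
  obtain ⟨a1, a2⟩ := hcon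
  have b1 : ¬ cond j1 s := by
    unfold cond mx
    have := (abs_lt.1 a1).2
    have h : (Measure.pi D).real {v | ∃ i, (2:ℝ) ^ j1 ≤ v i} < 1 / 4 := hj1
    linarith
  have b2 : cond j2 s := by
    unfold cond mx
    have := (abs_lt.1 a2).1
    have h : 3 / 4 < (Measure.pi D).real {v | ∃ i, (2:ℝ) ^ j2 ≤ v i} := hj2
    linarith
  obtain ⟨g1, g2⟩ := jhat_spec (exists_gd b2 b1)
  apply hs
  constructor
  · by_contra h
    have h1 := hm1 _ (not_le.1 h)
    exact b1 (cond_anti h1 g1)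
  · by_contra h
    have e : 2 * (2:ℝ) ^ jhat s = 2 ^ (jhat s + 1) := by
      rw [zpow_add_one₀ (by norm_num)]; ring
    rw [e] at h
    have h1 := hm2 _ (not_le.1 h)
    exact g2 (cond_anti h1 b2)
end theta
end RSC

namespace RSC
open Function Finset
open scoped ENNReal
set_option linter.unusedSectionVars false

section opt
variable {n : ℕ} (D : Fin n → Measure ℝ) [∀ i, IsProbabilityMeasure (D i)]

lemma Rev_le (h0 : ∀ i, D i (Set.Iio 0) = 0) (hW : WW D < ∞) (M : Mech n) (hM : M.Good) :
    Rev M (Measure.pi D) ≤ (WW D).toReal := by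
  obtain ⟨x, p, h, hp⟩ := exists_NM M hM
  unfold Rev
  by_cases hi : Integrable (fun v => ∑ i, M.pay v i) (Measure.pi D)
  · rw [integral_eq_lintegral_pos_part_sub_lintegral_neg_part hi]
    refine (sub_le_self _ ENNReal.toReal_nonneg).trans (ENNReal.toReal_mono hW.ne ?_)
    refine le_trans ?_ (LRev_le_WW D h)
    have hv : ∀ᵐ v ∂(Measure.pi D), ∀ i, 0 ≤ v i := by
      rw [ae_all_iff]; intro i
      have : ∀ᵐ x ∂(D i), 0 ≤ x := by
        rw [ae_iff]
        convert h0 i using 2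
        ext x; simp
      exact (measurePreserving_eval D i).quasiMeasurePreserving.ae this
    refine lintegral_mono_ae ?_
    filter_upwards [hv] with v hv
    rw [← ENNReal.ofReal_sum_of_nonneg fun i _ => h.p0 v i]
    exact ENNReal.ofReal_le_ofReal (Finset.sum_le_sum fun i _ => hp v hv i)
  · rw [integral_undef hi]; exact ENNReal.toReal_nonneg

lemma zero_good : (Mech.mk (n := n) (fun _ _ => 0) (fun _ _ => 0)).Good := by
  refine ⟨fun v => ⟨fun i => ⟨le_rfl, zero_le_one⟩, by simp⟩, ?_, ?_, ?_⟩
  · intro i v _ v' _; simp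
  · intro v _ i; simp
  · exact ⟨fun i => measurable_const, fun i => measurable_const⟩

lemma Opt_nonneg (h0 : ∀ i, D i (Set.Iio 0) = 0) (hW : WW D < ∞) : 0 ≤ Opt (Measure.pi D) := by
  refine le_csSup ⟨(WW D).toReal, ?_⟩ ⟨_, zero_good, ?_⟩
  · rintro r ⟨M, hM, rfl⟩; exact Rev_le D h0 hW M hM
  · simp [Rev]

lemma Opt_le (h0 : ∀ i, D i (Set.Iio 0) = 0) (hW : WW D < ∞) : Opt (Measure.pi D) ≤ (WW D).toReal := by
  refine csSup_le ⟨_, _, zero_good, rfl⟩ ?_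
  rintro r ⟨M, hM, rfl⟩; exact Rev_le D h0 hW M hM
end opt

section final
variable {n : ℕ}

/-- grid mechanism -/
noncomputable def gm (a : ℕ → ℝ) (k : ℕ) (y : (Fin n → ℕ) → Fin n → ℝ) : Mech n :=
  ⟨fun v i => y (cl a k v) i, fun v i => gpay a y (cl a k v) i⟩

/-- second stage -/
noncomputable def stage {J : Type*} [Fintype J] (ε : ℝ) (k : ℕ) (j : ℤ) (s : J → Fin n → ℝ) : Mech n :=
  gm (ga ε ((2:ℝ) ^ j)) k (learned (ga ε ((2:ℝ) ^ j)) k (ε * (2:ℝ) ^ j) s)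

/-- the learning algorithm -/
noncomputable def alg (ε : ℝ) (k : ℕ) (m : ℕ) (s : Fin m → Fin n → ℝ) : Mech n :=
  stage ε k (jhat fun t : {t : Fin m // t.val < m / 2} => s t)
    (fun t : {t : Fin m // ¬ t.val < m / 2} => s t)

lemma stage_good {J : Type*} [Fintype J] {ε : ℝ} (hε : 0 < ε) (k : ℕ) (j : ℤ) (s : J → Fin n → ℝ) :
    (stage ε k j s).Good :=
  (grid_NM (ga_grid hε (by positivity)) k (learned_rule k _ _ s)).good

variable (D : Fin n → Measure ℝ) [∀ i, IsProbabilityMeasure (D i)]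

lemma stage_Rev {J : Type*} [Fintype J] (ε : ℝ) (k : ℕ) (j : ℤ) (s : J → Fin n → ℝ) :
    Rev (stage ε k j s) (Measure.pi D) =
      rv (ga ε ((2:ℝ) ^ j)) k D (learned (ga ε ((2:ℝ) ^ j)) k (ε * (2:ℝ) ^ j) s) :=
  rv_Rev _ _ _ _ _

lemma stage_nonneg {J : Type*} [Fintype J] {ε : ℝ} (hε : 0 < ε) (k : ℕ) (j : ℤ) (s : J → Fin n → ℝ) :
    0 ≤ Rev (stage ε k j s) (Measure.pi D) := by
  rw [stage_Rev]
  exact rv_nonneg k D (ga_grid hε (by positivity)) (learned_rule _ _ _ _)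

lemma stage_meas {J : Type*} [Fintype J] (ε : ℝ) (k : ℕ) (j : ℤ) :
    Measurable fun s : J → Fin n → ℝ => Rev (stage ε k j s) (Measure.pi D) := by
  simp only [stage_Rev]
  exact meas_learned (ga ε ((2:ℝ) ^ j)) k (ε * (2:ℝ) ^ j) (rv (ga ε ((2:ℝ) ^ j)) k D)

lemma joint_meas {J1 J2 : Type*} [Fintype J1] [Fintype J2] (G : (J2 → Fin n → ℝ) → ℤ → ℝ)
    (h : ∀ j, Measurable fun s => G s j) :
    Measurable fun z : (J1 → Fin n → ℝ) × (J2 → Fin n → ℝ) => G z.2 (jhat z.1) := by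
  have h1 : Measurable (fun w : (J2 → Fin n → ℝ) × ℤ => G w.1 w.2) := by
    apply measurable_from_prod_countable_left
    exact h
  have h2 : Measurable fun z : (J1 → Fin n → ℝ) × (J2 → Fin n → ℝ) => (z.2, jhat z.1) := by
    apply Measurable.prodMk measurable_snd
    exact Measurable.comp (g := jhat) meas_jhat measurable_fst
  exact Measurable.comp h1 h2

lemma two_stage {J1 J2 : Type*} [Fintype J1] [Fintype J2] [Nonempty J1] [Nonempty J2]
    (h0 : ∀ i, D i (Set.Iio 0) = 0) (hR : ∀ i, Regular (D i)) (hW0 : WW D ≠ 0)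
    {ε : ℝ} (hε : 0 < ε) (hε' : ε ≤ 1 / 64) {k : ℕ} (hk : 0 < k)
    (hk1 : ∀ θ, 0 < θ → θ / ε ≤ ga ε θ k ∧ ga ε θ k ≤ 2 * θ / ε)
    (hm : n * ((k + 1 : ℝ) / Fintype.card J2) ≤ ε ^ 3) :
    (1 - 61 * ε) * (WW D).toReal * (1 - 8 / Fintype.card J1) ≤
      ∫ z : (J1 → Fin n → ℝ) × (J2 → Fin n → ℝ), Rev (stage ε k (jhat z.1) z.2) (Measure.pi D)
        ∂((Measure.pi fun _ : J1 => Measure.pi D).prod (Measure.pi fun _ : J2 => Measure.pi D)) := by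
  have hW := WW_lt_top D h0 hR
  have hga : ∀ j : ℤ, Grid (ga ε ((2:ℝ) ^ j)) := fun j => ga_grid hε (by positivity)
  have hmeas : Measurable fun z : (J1 → Fin n → ℝ) × (J2 → Fin n → ℝ) =>
      Rev (stage ε k (jhat z.1) z.2) (Measure.pi D) := by
    exact joint_meas (fun s j => Rev (stage ε k j s) (Measure.pi D)) (stage_meas D ε k)
  have hle : ∀ (j : ℤ) (s : J2 → Fin n → ℝ), Rev (stage ε k j s) (Measure.pi D) ≤ (WW D).toReal := by
    intro j s; rw [stage_Rev]; exact rv_le k D (hga j) hW (learned_rule _ _ _ _)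
  have hint : Integrable (fun z : (J1 → Fin n → ℝ) × (J2 → Fin n → ℝ) =>
      Rev (stage ε k (jhat z.1) z.2) (Measure.pi D))
      ((Measure.pi fun _ : J1 => Measure.pi D).prod (Measure.pi fun _ : J2 => Measure.pi D)) := by
    refine Integrable.of_bound (C := (WW D).toReal) hmeas.aestronglyMeasurable
      (Filter.Eventually.of_forall fun z => ?_)
    rw [Real.norm_eq_abs, abs_of_nonneg (stage_nonneg D hε _ _ _)]
    exact hle _ _
  rw [integral_prod _ hint]
  set c : ℝ := (1 - 61 * ε) * (WW D).toReal with hc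
  have hc0 : 0 ≤ c := mul_nonneg (by linarith) ENNReal.toReal_nonneg
  set G : Set (J1 → Fin n → ℝ) := {s | gs D (jhat s)} with hG
  have hGm : MeasurableSet G := meas_jhat (MeasurableSet.of_discrete (s := {j | gs D j}))
  have hpt : ∀ s1 : J1 → Fin n → ℝ, G.indicator (fun _ => c) s1 ≤
      ∫ s2 : J2 → Fin n → ℝ, Rev (stage ε k (jhat s1) s2) (Measure.pi D)
        ∂(Measure.pi fun _ : J2 => Measure.pi D) := by
    intro s1
    by_cases hs : s1 ∈ G
    · rw [Set.indicator_of_mem hs]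
      simp only [stage_Rev]
      have hθ : (0:ℝ) < 2 ^ jhat s1 := by positivity
      have hs' : gs D (jhat s1) := hs
      exact learn_good D h0 hR hθ hε hε' hk (hk1 _ hθ).1 (hk1 _ hθ).2 hs'.1 hs'.2 hm
    · rw [Set.indicator_of_notMem hs]
      exact integral_nonneg fun s2 => stage_nonneg D hε _ _ _
  have hmono := integral_mono (μ := Measure.pi fun _ : J1 => Measure.pi D)
    ((integrable_const c).indicator hGm) hint.integral_prod_left hpt
  refine le_trans ?_ hmono
  rw [integral_indicator_const _ hGm, smul_eq_mul, mul_comm c]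
  refine mul_le_mul_of_nonneg_right ?_ hc0
  have h1 := theta_est (J := J1) D hR hW0 hW
  have h2 := probReal_compl_eq_one_sub (μ := Measure.pi fun _ : J1 => Measure.pi D) hGm
  have h3 : Gᶜ = {s | ¬ gs D (jhat s)} := rfl
  rw [h3] at h2
  linarith

lemma card_lo (m : ℕ) : Fintype.card {t : Fin m // t.val < m / 2} = m / 2 := by
  rw [Fintype.card_subtype]
  have : (univ.filter fun t : Fin m => t.val < m / 2) =
      (Finset.range (m / 2)).attachFin (fun x hx => by
        have := Finset.mem_range.1 hx; omega) := by
    ext t; simp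
  rw [this, Finset.card_attachFin, Finset.card_range]

lemma card_hi (m : ℕ) : Fintype.card {t : Fin m // ¬ t.val < m / 2} = m - m / 2 := by
  rw [Fintype.card_subtype_compl, card_lo, Fintype.card_fin]

lemma alg_int (ε : ℝ) (k m : ℕ) :
    ∫ s, Rev (alg ε k m s) (Measure.pi D) ∂(Measure.pi fun _ : Fin m => Measure.pi D) =
    ∫ z : ({t : Fin m // t.val < m / 2} → Fin n → ℝ) × ({t : Fin m // ¬ t.val < m / 2} → Fin n → ℝ),
      Rev (stage ε k (jhat z.1) z.2) (Measure.pi D)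
        ∂((Measure.pi fun _ => Measure.pi D).prod (Measure.pi fun _ => Measure.pi D)) := by
  have h := measurePreserving_piEquivPiSubtypeProd (fun _ : Fin m => Measure.pi D)
    (fun t : Fin m => t.val < m / 2)
  rw [← h.integral_comp']
  rfl
end final
end RSC

/-- **Sample complexity for regular product distributions.** There is a
universal constant `C > 0` such that for all `n ≥ 1` and `ε ∈ (0,1/4]` there
is a learning rule `A` from samples to measurable DSIC and IR mechanisms such
that for every product Borel distribution `D = D¹×⋯×Dⁿ` on `[0,∞)ⁿ` with every
`Dⁱ` regular, whenever `m ≥ C·n·ε⁻⁴·(log(n/ε))²`, the expected revenue (over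
`m` i.i.d. samples from `D`) of the learned mechanism on `D` is at least
`(1 - C·ε)·Opt(D)`. -/
theorem regular_sample_complexity :
    ∃ C : ℝ, 0 < C ∧
      ∀ (n : ℕ), 1 ≤ n → ∀ ε : ℝ, ε ∈ Set.Ioc (0 : ℝ) (1 / 4) →
      ∃ A : (m : ℕ) → (Fin m → (Fin n → ℝ)) → Mech n,
        (∀ m s, (A m s).Good) ∧
        ∀ D : Fin n → Measure ℝ, (∀ i, IsProbabilityMeasure (D i)) →
          (∀ i, D i (Set.Iio 0) = 0) → (∀ i, Regular (D i)) →
          ∀ m : ℕ,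
            C * n / ε ^ 4 * (Real.log ((n : ℝ) / ε)) ^ 2 ≤ (m : ℝ) →
            (1 - C * ε) * Opt (Measure.pi D) ≤
              ∫ s, Rev (A m s) (Measure.pi D)
                ∂(Measure.pi fun _ : Fin m => Measure.pi D) := by
  refine ⟨1000, by norm_num, fun n hn ε hε => ?_⟩
  obtain ⟨hε0, hε4⟩ := hε
  obtain ⟨k, hk, hk1, hk2⟩ := RSC.exists_k hε0 hε4
  refine ⟨fun m s => RSC.alg ε k m s, fun m s => RSC.stage_good hε0 _ _ _, ?_⟩
  intro D hD h0 hR m hm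
  have hW := RSC.WW_lt_top D h0 hR
  have hO := RSC.Opt_le D h0 hW
  have hO0 := RSC.Opt_nonneg D h0 hW
  have hI0 : 0 ≤ ∫ s, Rev (RSC.alg ε k m s) (Measure.pi D)
      ∂(Measure.pi fun _ : Fin m => Measure.pi D) :=
    integral_nonneg fun s => RSC.stage_nonneg D hε0 _ _ _
  by_cases hε1 : 1 / 64 < ε
  · refine le_trans ?_ hI0
    exact mul_nonpos_of_nonpos_of_nonneg (by linarith) hO0
  by_cases hW0 : RSC.WW D = 0
  · rw [hW0] at hO
    have : Opt (Measure.pi D) = 0 := le_antisymm (by simpa using hO) hO0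
    rw [this]; simpa using hI0
  have hε64 : ε ≤ 1 / 64 := not_lt.1 hε1
  set W := (RSC.WW D).toReal with hWd
  -- numeric estimates
  have hn1 : (1:ℝ) ≤ n := by exact_mod_cast hn
  set L := Real.log ((n:ℝ) / ε) with hL
  have hL0 : Real.log (1 / ε) ≤ L := Real.log_le_log (by positivity) (by gcongr)
  have hL1 : 1 ≤ Real.log (1 / ε) := by
    rw [Real.le_log_iff_exp_le (by positivity)]
    have := Real.exp_one_lt_d9
    have h64 : 64 ≤ 1 / ε := by rw [le_div_iff₀ hε0]; linarith
    linarith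
  have hLL : L ≤ L ^ 2 := by nlinarith
  have hmL : 1000 * n / ε ^ 4 * L ≤ m := le_trans (by gcongr) hm
  have hmL' : 1000 * n * L ≤ m * ε ^ 4 := by
    have e : 1000 * n / ε ^ 4 * L = 1000 * n * L / ε ^ 4 := by ring
    rw [e, div_le_iff₀ (by positivity)] at hmL
    exact hmL
  have hnL : 1 ≤ n * L := by nlinarith
  have he1 : ε ^ 4 ≤ ε := by
    have := pow_le_pow_of_le_one hε0.le (by linarith) (show 1 ≤ 4 by norm_num)
    simpa using this
  have hm1 : 1000 ≤ m * ε := by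
    have : (m:ℝ) * ε ^ 4 ≤ m * ε := by gcongr
    nlinarith
  have hm2 : (1000:ℝ) ≤ m := by nlinarith [show (0:ℝ) ≤ m by positivity]
  have hm3 : 1000 ≤ m := by exact_mod_cast hm2
  have hlo : (m:ℝ) / 4 ≤ ((m / 2 : ℕ) : ℝ) := by
    have : m ≤ 4 * (m / 2) := by omega
    have : (m:ℝ) ≤ 4 * ((m / 2 : ℕ) : ℝ) := by exact_mod_cast this
    linarith
  have hhi : (m:ℝ) / 2 ≤ ((m - m / 2 : ℕ) : ℝ) := by
    have : m ≤ 2 * (m - m / 2) := by omega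
    have : (m:ℝ) ≤ 2 * ((m - m / 2 : ℕ) : ℝ) := by exact_mod_cast this
    linarith
  have : Nonempty {t : Fin m // t.val < m / 2} :=
    Fintype.card_pos_iff.1 (by rw [RSC.card_lo]; omega)
  have : Nonempty {t : Fin m // ¬ t.val < m / 2} :=
    Fintype.card_pos_iff.1 (by rw [RSC.card_hi]; omega)
  have hmain := RSC.two_stage (J1 := {t : Fin m // t.val < m / 2})
    (J2 := {t : Fin m // ¬ t.val < m / 2}) D h0 hR hW0 hε0 hε64 hk hk1 (by
      rw [RSC.card_hi, ← mul_div_assoc, div_le_iff₀ (by linarith)]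
      have hk3 : (k + 1 : ℝ) * ε ≤ 6 * L := by
        rw [le_div_iff₀ hε0] at hk2; linarith
      have h1 : n * (k + 1 : ℝ) * ε ≤ ε ^ 3 * (m / 2) * ε := by
        have : n * ((k + 1 : ℝ) * ε) ≤ n * (6 * L) := by gcongr
        nlinarith
      have h2 := le_of_mul_le_mul_right h1 hε0
      refine h2.trans ?_
      gcongr)
  rw [RSC.card_lo, ← RSC.alg_int] at hmain
  refine le_trans ?_ hmain
  have h8 : 8 / ((m / 2 : ℕ) : ℝ) ≤ ε := by
    rw [div_le_iff₀ (by linarith)]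
    nlinarith
  have hWn : 0 ≤ W := ENNReal.toReal_nonneg
  have hfin : (1 - 61 * ε) * W * (1 - ε) ≤ (1 - 61 * ε) * W * (1 - 8 / ((m / 2 : ℕ) : ℝ)) := by
    refine mul_le_mul_of_nonneg_left (by linarith) (mul_nonneg (by linarith) hWn)
  refine le_trans ?_ hfin
  have h62 : (1 - 62 * ε) * W ≤ (1 - 61 * ε) * W * (1 - ε) := by
    nlinarith [mul_nonneg (mul_nonneg hε0.le hε0.le) hWn]
  refine le_trans ?_ h62
  rcases le_total (1 - 1000 * ε) 0 with hneg | hpos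
  · exact (mul_nonpos_of_nonpos_of_nonneg hneg hO0).trans (mul_nonneg (by linarith) hWn)
  · exact (mul_le_mul_of_nonneg_left hO hpos).trans (mul_le_mul_of_nonneg_right (by linarith) hWn)
end

section
/- Let 𝐌 ⊆ 2^{[n]} be a downward-closed family of feasible sets (S ∈ 𝐌 and T ⊆ S imply T ∈ 𝐌) that contains every singleton {i}. Let ε ∈ (0,1/4], let D = D¹ × ⋯ × Dⁿ be a product Borel probability distribution on [0,∞)ⁿ in which every Dⁱ is regular, and let v̄ ≥ (1/ε)·Opt_𝐌(D). For each i let D̄ⁱ be the pushforward of Dⁱ under v ↦ min(v, v̄). Then Opt_𝐌(D̄¹ × ⋯ × D̄ⁿ) ≥ (1 − 4ε)·Opt_𝐌(D). -/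
open MeasureTheory

/-- The `{0,1}` indicator vector of a set of agents. -/
def indicatorVec {n : ℕ} (S : Finset (Fin n)) : Fin n → ℝ :=
  fun i => if i ∈ S then 1 else 0

/-- The allocation always lies in the convex hull of the indicator vectors of
the feasible sets in `F`. -/
def Mech.ValidEnv {n : ℕ} (F : Finset (Finset (Fin n))) (M : Mech n) : Prop :=
  ∀ v : Fin n → ℝ,
    M.alloc v ∈ convexHull ℝ {x : Fin n → ℝ | ∃ S ∈ F, x = indicatorVec S}

/-- Optimal revenue in the environment `F`: supremum of revenue over
measurable DSIC and IR mechanisms feasible for `F`. -/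
noncomputable def OptEnv {n : ℕ} (F : Finset (Finset (Fin n)))
    (D : Measure (Fin n → ℝ)) : ℝ :=
  sSup {r : ℝ | ∃ M : Mech n,
    M.ValidEnv F ∧ M.DSIC ∧ M.IR ∧ M.Meas ∧ r = Rev M D}

namespace TR

open Set Filter

lemma reg_bound (μ : Measure ℝ) [IsProbabilityMeasure μ] (hreg : Regular μ) (a : ℝ) (ha : 0 < a)
    (hq : μ.real (Ici a) < 1) (t : ℝ) (ht : a ≤ t) :
    t * μ.real (Ici t) ≤ a * μ.real (Ici a) / (1 - μ.real (Ici a)) := by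
  set q := μ.real (Ici a) with hqdef
  set r := μ.real (Ici t) with hrdef
  have hrq : r ≤ q := measureReal_mono (Ici_subset_Ici.2 ht)
  have hr0 : 0 ≤ r := measureReal_nonneg
  have ht0 : 0 < t := lt_of_lt_of_le ha ht
  have hIio : ∀ s, μ (Iio s) = ENNReal.ofReal (1 - μ.real (Ici s)) := by
    intro s
    have h1 : μ.real (Iio s) = 1 - μ.real (Ici s) := by
      have := probReal_compl_eq_one_sub (μ := μ) (s := Ici s) measurableSet_Ici
      rwa [compl_Ici] at this
    rw [← h1, ofReal_measureReal]
  have hnn : ∀ s, 0 ≤ qval μ s := fun s => Real.sInf_nonneg (fun x hx => hx.1)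
  -- upper bound at q
  have hup : qval μ q ≤ a := by
    apply csInf_le ⟨0, fun x hx => hx.1⟩
    refine ⟨ha.le, ?_⟩
    rw [← hIio a]
    exact measure_mono Iio_subset_Iic_self
  have hlow : ∀ s, 0 < s → s < r → t ≤ qval μ s := by
    intro s hs hsr
    apply le_csInf
    · have h1 := tendsto_measure_Iic_atTop μ
      rw [measure_univ] at h1
      have h2 : ENNReal.ofReal (1 - s) < 1 := by
        rw [ENNReal.ofReal_lt_one]; linarith
      obtain ⟨x, hx⟩ := ((h1.eventually (lt_mem_nhds h2)).and (eventually_ge_atTop 0)).exists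
      exact ⟨x, hx.2, hx.1.le⟩
    · intro x hx
      by_contra hlt
      push Not at hlt
      have h1 : μ (Iic x) ≤ μ (Iio t) := measure_mono (fun y hy => lt_of_le_of_lt hy hlt)
      have h2 := hx.2.trans h1
      rw [hIio t] at h2
      have h3 : r ≤ 1 := measureReal_le_one
      rw [ENNReal.ofReal_le_ofReal_iff (by linarith)] at h2
      linarith
  have key : ∀ s, 0 < s → s < r → s * t ≤ a * q / (1 - q) := by
    intro s hs hsr
    have hs1 : s < 1 := by linarith
    have h1q : 0 < 1 - q := by linarith
    have h1s : 0 < 1 - s := by linarith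
    have hc := hreg.2 (show s ∈ Icc (0:ℝ) 1 from ⟨hs.le, hs1.le⟩)
      (show (1:ℝ) ∈ Icc (0:ℝ) 1 from ⟨zero_le_one, le_rfl⟩)
      (show 0 ≤ (1 - q) / (1 - s) by positivity)
      (show 0 ≤ (q - s) / (1 - s) from div_nonneg (by linarith) h1s.le)
      (by field_simp; ring)
    have he : ((1 - q) / (1 - s)) • s + ((q - s) / (1 - s)) • (1:ℝ) = q := by
      simp only [smul_eq_mul]; field_simp; ring
    simp only [he] at hc
    simp only [smul_eq_mul] at hc
    have h4 : 0 ≤ (q - s) / (1 - s) * (1 * qval μ 1) :=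
      mul_nonneg (div_nonneg (by linarith) h1s.le) (by linarith [hnn 1])
    have h5 : (1 - q) * (s * t) ≤ (1 - q) / (1 - s) * (s * qval μ s) := by
      have : s * t ≤ s * qval μ s := mul_le_mul_of_nonneg_left (hlow s hs hsr) hs.le
      apply mul_le_mul _ this (by positivity) (by positivity)
      rw [le_div_iff₀ h1s]
      nlinarith
    have h6 : q * qval μ q ≤ a * q := by nlinarith
    rw [le_div_iff₀ h1q]
    linarith
  rcases hr0.eq_or_lt with h0 | h0
  · rw [← h0]; simp only [mul_zero]
    apply div_nonneg _ (by linarith)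
    exact mul_nonneg ha.le (by linarith)
  · have hten : Tendsto (fun s : ℝ => s * t) (nhdsWithin r (Iio r)) (nhds (r * t)) :=
      ((continuous_id.mul continuous_const).tendsto r).mono_left nhdsWithin_le_nhds
    rw [mul_comm t r]
    apply le_of_tendsto hten
    filter_upwards [Ioo_mem_nhdsLT h0] with s hs using key s hs.1 hs.2

lemma single (μ : Measure ℝ) [IsProbabilityMeasure μ] (a C : ℝ) (ha : 0 < a)
    (hR : ∀ t, a ≤ t → t * μ.real (Ici t) ≤ C) (x p : ℝ → ℝ)
    (hx : ∀ t, a ≤ t → 0 ≤ x t ∧ x t ≤ 1)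
    (ic : ∀ s, a ≤ s → ∀ t, a ≤ t → s * x t - p t ≤ s * x s - p s)
    (h0 : p a = a * x a) :
    ∫⁻ t in Ici a, ENNReal.ofReal (p t) ∂μ ≤ ENNReal.ofReal C := by
  have hC : 0 ≤ C := le_trans (mul_nonneg ha.le measureReal_nonneg) (hR a le_rfl)
  have xmono : ∀ s t, a ≤ s → s ≤ t → x s ≤ x t := by
    intro s t hs hst
    rcases hst.eq_or_lt with h | h
    · rw [h]
    · have h1 := ic s hs t (hs.trans hst)
      have h2 := ic t (hs.trans hst) s hs
      nlinarith
  have pmono : ∀ s t, a ≤ s → s ≤ t → p s ≤ p t := by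
    intro s t hs hst
    have h1 := ic t (hs.trans hst) s hs
    have h2 := ic s hs t (hs.trans hst)
    have h3 := xmono s t hs hst
    nlinarith [ic s hs t (hs.trans hst)]
  have main : ∀ l : ℝ, 1 < l →
      ∫⁻ t in Ici a, ENNReal.ofReal (p t) ∂μ ≤ ENNReal.ofReal (l * C) := by
    intro l hl
    have hl0 : 0 < l := by linarith
    set w : ℕ → ℝ := fun i => a * l ^ i with hw
    have hwa : ∀ i, a ≤ w i := fun i => by
      have : 1 ≤ l ^ i := one_le_pow₀ hl.le
      simp only [hw]; nlinarith
    have hws : ∀ i, w (i+1) = l * w i := fun i => by simp only [hw, pow_succ]; ring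
    have hwm : ∀ i, w i ≤ w (i+1) := fun i => by
      rw [hws]; nlinarith [hwa i]
    have hwmono : Monotone w := monotone_nat_of_le_succ hwm
    set d : ℕ → ℝ := fun i => x (w (i+1)) - x (w i) with hd
    have hd0 : ∀ i, 0 ≤ d i := fun i => sub_nonneg.2 (xmono _ _ (hwa i) (hwm i))
    have hp : ∀ k, p (w k) ≤ a * x a + ∑ i ∈ Finset.range k, w (i+1) * d i := by
      intro k
      induction k with
      | zero => simp [hw, h0]
      | succ k ih =>
        rw [Finset.sum_range_succ]
        have := ic (w (k+1)) (hwa _) (w k) (hwa _)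
        simp only [hd] at ih ⊢
        linarith
    have hpt : ∀ t ∈ Ici a, ENNReal.ofReal (p t) ≤ ENNReal.ofReal (a * x a) +
        ∑' i, (Ici (w i)).indicator (fun _ => ENNReal.ofReal (w (i+1) * d i)) t := by
      intro t ht
      obtain ⟨k, hk1, hk2⟩ := exists_nat_pow_near (x := t / a) (y := l)
        ((one_le_div ha).2 ht) hl
      have hk1' : w k ≤ t := by rw [le_div_iff₀ ha] at hk1; simp only [hw]; linarith
      have hk2' : t ≤ w (k+1) := by rw [div_lt_iff₀ ha] at hk2; simp only [hw]; linarith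
      calc ENNReal.ofReal (p t)
          ≤ ENNReal.ofReal (a * x a + ∑ i ∈ Finset.range (k+1), w (i+1) * d i) :=
            ENNReal.ofReal_le_ofReal ((pmono _ _ ht hk2').trans (hp _))
        _ ≤ ENNReal.ofReal (a * x a) +
              ENNReal.ofReal (∑ i ∈ Finset.range (k+1), w (i+1) * d i) := ENNReal.ofReal_add_le
        _ = ENNReal.ofReal (a * x a) +
              ∑ i ∈ Finset.range (k+1), ENNReal.ofReal (w (i+1) * d i) := by
            rw [ENNReal.ofReal_sum_of_nonneg]
            intro i _
            exact mul_nonneg (ha.le.trans (hwa _)) (hd0 i)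
        _ = ENNReal.ofReal (a * x a) + ∑ i ∈ Finset.range (k+1),
              (Ici (w i)).indicator (fun _ => ENNReal.ofReal (w (i+1) * d i)) t := by
            congr 1
            apply Finset.sum_congr rfl
            intro i hi
            rw [indicator_of_mem]
            exact (hwmono (Nat.lt_succ_iff.1 (Finset.mem_range.1 hi))).trans hk1'
        _ ≤ _ := by gcongr; exact ENNReal.sum_le_tsum _
    have hconv : ∀ (c s : ℝ), 0 ≤ c →
        ENNReal.ofReal c * μ (Ici s) = ENNReal.ofReal (c * μ.real (Ici s)) := by
      intro c s hc
      rw [ENNReal.ofReal_mul hc, ofReal_measureReal]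
    have hxa := hx a le_rfl
    calc ∫⁻ t in Ici a, ENNReal.ofReal (p t) ∂μ
        ≤ ∫⁻ t in Ici a, (ENNReal.ofReal (a * x a) +
        ∑' i, (Ici (w i)).indicator (fun _ => ENNReal.ofReal (w (i+1) * d i)) t) ∂μ :=
          setLIntegral_mono' measurableSet_Ici hpt
      _ = ENNReal.ofReal (a * x a) * μ (Ici a) +
          ∑' i, ENNReal.ofReal (w (i+1) * d i) * (μ.restrict (Ici a)) (Ici (w i)) := by
          rw [lintegral_add_left measurable_const, lintegral_tsum]
          · simp [lintegral_indicator_const measurableSet_Ici]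
          · intro i
            exact (measurable_const.indicator measurableSet_Ici).aemeasurable
      _ ≤ ENNReal.ofReal (l * C * x a) + ∑' i, ENNReal.ofReal (l * C * d i) := by
          apply add_le_add
          · rw [hconv _ _ (mul_nonneg ha.le hxa.1)]
            apply ENNReal.ofReal_le_ofReal
            have h1 := hR a le_rfl
            have h2 : C * x a ≤ l * (C * x a) := by
              nlinarith [mul_nonneg hC hxa.1]
            have h3 := mul_le_mul_of_nonneg_right h1 hxa.1
            linarith
          · apply ENNReal.tsum_le_tsum
            intro i
            have hwd : 0 ≤ w (i+1) * d i := mul_nonneg (ha.le.trans (hwa _)) (hd0 i)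
            calc _ ≤ ENNReal.ofReal (w (i+1) * d i) * μ (Ici (w i)) := by
                  gcongr
                  exact Measure.restrict_le_self
              _ = _ := hconv _ _ hwd
              _ ≤ _ := by
                  apply ENNReal.ofReal_le_ofReal
                  have h1 := hR (w i) (hwa i)
                  rw [hws]
                  have := mul_le_mul_of_nonneg_left h1 (mul_nonneg hl0.le (hd0 i))
                  linarith
      _ ≤ ENNReal.ofReal (l * C) := by
          have hsum : ∑' i, ENNReal.ofReal (l * C * d i) ≤ ENNReal.ofReal (l * C * (1 - x a)) := by
            apply ENNReal.tsum_le_of_sum_range_le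
            intro N
            rw [← ENNReal.ofReal_sum_of_nonneg
              (fun i _ => mul_nonneg (mul_nonneg hl0.le hC) (hd0 i))]
            apply ENNReal.ofReal_le_ofReal
            rw [← Finset.mul_sum]
            apply mul_le_mul_of_nonneg_left _ (mul_nonneg hl0.le hC)
            simp only [hd]
            rw [Finset.sum_range_sub (fun i => x (w i))]
            have hw0 : w 0 = a := by simp [hw]
            rw [hw0]
            linarith [(hx (w N) (hwa N)).2]
          calc _ ≤ ENNReal.ofReal (l * C * x a) + ENNReal.ofReal (l * C * (1 - x a)) := by
                gcongr
            _ = ENNReal.ofReal (l * C) := by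
                rw [← ENNReal.ofReal_add]
                · congr 1; ring
                · exact mul_nonneg (mul_nonneg hl0.le hC) hxa.1
                · exact mul_nonneg (mul_nonneg hl0.le hC) (by linarith [hxa.2])
  have hten : Tendsto (fun l : ℝ => ENNReal.ofReal (l * C)) (nhdsWithin 1 (Ioi 1))
      (nhds (ENNReal.ofReal (1 * C))) := by
    apply (ENNReal.continuous_ofReal.tendsto _).comp
    exact ((continuous_id.mul continuous_const).tendsto 1).mono_left nhdsWithin_le_nhds
  rw [one_mul] at hten
  apply ge_of_tendsto hten
  filter_upwards [self_mem_nhdsWithin] with l hl using main l hl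

end TR

namespace TR

open Set Filter

variable {n : ℕ}

structure Good (F : Finset (Finset (Fin n))) (M : Mech n) : Prop where
  valid : M.ValidEnv F
  dsic : M.DSIC
  ir : M.IR
  meas : M.Meas

def revSet (F : Finset (Finset (Fin n))) (D : Measure (Fin n → ℝ)) : Set ℝ :=
  {r : ℝ | ∃ M : Mech n, M.ValidEnv F ∧ M.DSIC ∧ M.IR ∧ M.Meas ∧ r = Rev M D}

lemma hull_bounds {F : Finset (Finset (Fin n))} {x : Fin n → ℝ}
    (hx : x ∈ convexHull ℝ {x : Fin n → ℝ | ∃ S ∈ F, x = indicatorVec S}) (i : Fin n) :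
    0 ≤ x i ∧ x i ≤ 1 := by
  have h : convexHull ℝ {x : Fin n → ℝ | ∃ S ∈ F, x = indicatorVec S} ⊆
      Icc (0 : Fin n → ℝ) 1 := by
    apply convexHull_min _ (convex_Icc _ _)
    rintro _ ⟨S, -, rfl⟩
    constructor <;> intro j <;> simp only [indicatorVec] <;> split_ifs <;> simp
  exact ⟨(h hx).1 i, (h hx).2 i⟩

lemma hull_zero {F : Finset (Finset (Fin n))} (hdc : ∀ S ∈ F, ∀ T ⊆ S, T ∈ F) {x : Fin n → ℝ}
    (hx : x ∈ convexHull ℝ {x : Fin n → ℝ | ∃ S ∈ F, x = indicatorVec S}) (k : Fin n) :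
    (fun i => if i = k then 0 else x i) ∈
      convexHull ℝ {x : Fin n → ℝ | ∃ S ∈ F, x = indicatorVec S} := by
  let Z : (Fin n → ℝ) →ₗ[ℝ] (Fin n → ℝ) :=
    { toFun := fun x i => if i = k then 0 else x i
      map_add' := by intro x y; ext i; by_cases h : i = k <;> simp [h]
      map_smul' := by intro c x; ext i; by_cases h : i = k <;> simp [h] }
  have h1 : Z x ∈ Z '' convexHull ℝ {x : Fin n → ℝ | ∃ S ∈ F, x = indicatorVec S} :=
    ⟨x, hx, rfl⟩
  rw [LinearMap.image_convexHull] at h1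
  refine convexHull_mono ?_ h1
  rintro _ ⟨_, ⟨S, hS, rfl⟩, rfl⟩
  refine ⟨S.erase k, hdc S hS _ (Finset.erase_subset _ _), ?_⟩
  ext i
  by_cases h : i = k <;> simp [Z, indicatorVec, h]

lemma dsic_upd {M : Mech n} (h : M.DSIC) (i : Fin n) (v : Fin n → ℝ) (hv : ∀ j, 0 ≤ v j)
    (s t : ℝ) (hs : 0 ≤ s) (ht : 0 ≤ t) :
    s * M.alloc (Function.update v i t) i - M.pay (Function.update v i t) i ≤
      s * M.alloc (Function.update v i s) i - M.pay (Function.update v i s) i := by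
  have := h i (Function.update v i s) (by
    intro j; by_cases hj : j = i
    · subst hj; simpa using hs
    · simpa [hj] using hv j) t ht
  simpa using this

lemma upd_nonneg {v : Fin n → ℝ} (hv : ∀ j, 0 ≤ v j) (i : Fin n) {s : ℝ} (hs : 0 ≤ s) :
    ∀ j, 0 ≤ Function.update v i s j := by
  intro j; by_cases hj : j = i
  · subst hj; simpa using hs
  · simpa [hj] using hv j

lemma alloc_mono {M : Mech n} (h : M.DSIC) (i : Fin n) (v : Fin n → ℝ) (hv : ∀ j, 0 ≤ v j)
    (s t : ℝ) (hs : 0 ≤ s) (hst : s ≤ t) :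
    M.alloc (Function.update v i s) i ≤ M.alloc (Function.update v i t) i := by
  rcases hst.eq_or_lt with h1 | h1
  · rw [h1]
  · have h2 := dsic_upd h i v hv s t hs (hs.trans hst)
    have h3 := dsic_upd h i v hv t s (hs.trans hst) hs
    nlinarith

def trunc (M : Mech n) (K : ℝ) : Mech n where
  alloc v := M.alloc (fun j => min (v j) K)
  pay v := M.pay (fun j => min (v j) K)

lemma trunc_upd (v : Fin n → ℝ) (i : Fin n) (s K : ℝ) :
    (fun j => min (Function.update v i s j) K) =
      Function.update (fun j => min (v j) K) i (min s K) := by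
  ext j; by_cases hj : j = i
  · subst hj; simp
  · simp [hj]

lemma meas_trunc (K : ℝ) : Measurable (fun (v : Fin n → ℝ) (j : Fin n) => min (v j) K) :=
  measurable_pi_lambda _ (fun j => (measurable_pi_apply j).min measurable_const)

lemma trunc_good {F : Finset (Finset (Fin n))} {M : Mech n} (h : Good F M) {K : ℝ} (hK : 0 ≤ K) :
    Good F (trunc M K) := by
  have hcore : ∀ (i : Fin n) (v : Fin n → ℝ), (∀ j, 0 ≤ v j) → ∀ v' : ℝ, 0 ≤ v' →
      v i * M.alloc (Function.update (fun j => min (v j) K) i (min v' K)) i -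
        M.pay (Function.update (fun j => min (v j) K) i (min v' K)) i ≤
      v i * M.alloc (fun j => min (v j) K) i - M.pay (fun j => min (v j) K) i := by
    intro i v hv v' hv'
    set w : Fin n → ℝ := fun j => min (v j) K with hw
    have hw0 : ∀ j, 0 ≤ w j := fun j => le_min (hv j) hK
    have h1 := h.dsic i w hw0 (min v' K) (le_min hv' hK)
    rcases le_total (v i) K with h2 | h2
    · have : w i = v i := min_eq_left h2
      rwa [this] at h1
    · have h3 : w i = K := min_eq_right h2
      have h4 := alloc_mono h.dsic i w hw0 (min v' K) K (le_min hv' hK) (min_le_right _ _)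
      rw [← h3, Function.update_eq_self, h3] at h4
      rw [h3] at h1
      nlinarith
  refine ⟨fun v => h.valid _, ?_, ?_, ?_, ?_⟩
  · intro i v hv v' hv'
    simp only [trunc, trunc_upd]
    exact hcore i v hv v' hv'
  · intro v hv i
    have h1 := h.ir (fun j => min (v j) K) (fun j => le_min (hv j) hK) i
    have h2 := (hull_bounds (h.valid (fun j => min (v j) K)) i).1
    have h3 : min (v i) K ≤ v i := min_le_left _ _
    simp only [trunc]
    nlinarith only [h1, h2, h3]
  · intro i
    exact (h.meas.1 i).comp (meas_trunc K)
  · intro i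
    exact (h.meas.2 i).comp (meas_trunc K)

lemma rev_trunc (D : Fin n → Measure ℝ) [∀ i, IsProbabilityMeasure (D i)]
    {M : Mech n} (hM : M.Meas) (K : ℝ) :
    Rev M (Measure.pi fun i => Measure.map (fun v : ℝ => min v K) (D i)) =
      Rev (trunc M K) (Measure.pi D) := by
  have hm : Measurable (fun v : ℝ => min v K) := measurable_id.min measurable_const
  have : ∀ i, IsProbabilityMeasure (Measure.map (fun v : ℝ => min v K) (D i)) :=
    fun i => Measure.isProbabilityMeasure_map hm.aemeasurable
  unfold Rev
  rw [← Measure.pi_map_pi (fun i => hm.aemeasurable), integral_map]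
  · rfl
  · exact (meas_trunc K).aemeasurable
  · exact (Finset.measurable_sum _ (fun i _ => hM.2 i)).aestronglyMeasurable

lemma zero_good {F : Finset (Finset (Fin n))} (hF : ∅ ∈ F) : Good F ⟨fun _ _ => 0, fun _ _ => 0⟩ := by
  refine ⟨fun v => subset_convexHull _ _ ⟨∅, hF, ?_⟩, ?_, ?_, ?_, ?_⟩
  · ext i; simp [indicatorVec]
  · intro i v _ v' _; simp
  · intro v _ i; simp
  · intro i; exact measurable_const
  · intro i; exact measurable_const

lemma zero_mem {F : Finset (Finset (Fin n))} (hF : ∅ ∈ F) (D : Measure (Fin n → ℝ)) :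
    (0:ℝ) ∈ revSet F D := by
  have h := zero_good hF
  exact ⟨_, h.valid, h.dsic, h.ir, h.meas, by simp [Rev]⟩

lemma opt_nonneg {F : Finset (Finset (Fin n))} (hF : ∅ ∈ F) (D : Measure (Fin n → ℝ)) :
    0 ≤ OptEnv F D := by
  change 0 ≤ sSup (revSet F D)
  by_cases hb : BddAbove (revSet F D)
  · exact le_csSup hb (zero_mem hF D)
  · rw [Real.sSup_of_not_bddAbove hb]

lemma trunc_subset (D : Fin n → Measure ℝ) [∀ i, IsProbabilityMeasure (D i)]
    {F : Finset (Finset (Fin n))} {K : ℝ} (hK : 0 ≤ K) :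
    revSet F (Measure.pi fun i => Measure.map (fun v : ℝ => min v K) (D i)) ⊆
      revSet F (Measure.pi D) := by
  rintro r ⟨M, h1, h2, h3, h4, rfl⟩
  have h := trunc_good ⟨h1, h2, h3, h4⟩ hK
  exact ⟨_, h.valid, h.dsic, h.ir, h.meas, rev_trunc D h4 K⟩

lemma lint_eq_rev {F : Finset (Finset (Fin n))} (P : Measure (Fin n → ℝ)) [IsProbabilityMeasure P]
    (h0 : ∀ᵐ v ∂P, ∀ j, 0 ≤ v j) {M : Mech n} (hM : Good F M)
    (hp : ∀ v, (∀ j, 0 ≤ v j) → ∀ i, 0 ≤ M.pay v i)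
    (hfin : ∫⁻ v, ∑ i, ENNReal.ofReal (M.pay v i) ∂P ≠ ⊤) :
    ENNReal.ofReal (Rev M P) = ∫⁻ v, ∑ i, ENNReal.ofReal (M.pay v i) ∂P := by
  have he : ∫⁻ v, ∑ i, ENNReal.ofReal (M.pay v i) ∂P =
      ∫⁻ v, ENNReal.ofReal (∑ i, M.pay v i) ∂P := by
    apply lintegral_congr_ae
    filter_upwards [h0] with v hv
    rw [ENNReal.ofReal_sum_of_nonneg (fun i _ => hp v hv i)]
  have hnn : 0 ≤ᵐ[P] fun v => ∑ i, M.pay v i := by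
    filter_upwards [h0] with v hv
    exact Finset.sum_nonneg (fun i _ => hp v hv i)
  have hmeas : AEStronglyMeasurable (fun v => ∑ i, M.pay v i) P :=
    (Finset.measurable_sum _ (fun i _ => hM.meas.2 i)).aestronglyMeasurable
  rw [he] at hfin ⊢
  unfold Rev
  rw [integral_eq_lintegral_of_nonneg_ae hnn hmeas, ENNReal.ofReal_toReal hfin]

lemma lint_le {F : Finset (Finset (Fin n))} (P : Measure (Fin n → ℝ)) [IsProbabilityMeasure P]
    (h0 : ∀ᵐ v ∂P, ∀ j, 0 ≤ v j) (hb : BddAbove (revSet F P)) {M : Mech n} (hM : Good F M)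
    (hp : ∀ v, (∀ j, 0 ≤ v j) → ∀ i, 0 ≤ M.pay v i) :
    ∫⁻ v, ∑ i, ENNReal.ofReal (M.pay v i) ∂P ≤ ENNReal.ofReal (OptEnv F P) := by
  have hN : ∀ N : ℕ, ∫⁻ v, ∑ i, ENNReal.ofReal ((trunc M N).pay v i) ∂P ≤
      ENNReal.ofReal (OptEnv F P) := by
    intro N
    have hN0 : (0:ℝ) ≤ N := Nat.cast_nonneg N
    have hg := trunc_good hM hN0
    have hfin : ∫⁻ v, ∑ i, ENNReal.ofReal ((trunc M N).pay v i) ∂P ≠ ⊤ := by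
      have : ∫⁻ v, ∑ i, ENNReal.ofReal ((trunc M N).pay v i) ∂P ≤
          ∫⁻ v, ∑ i : Fin n, ENNReal.ofReal N ∂P := by
        apply lintegral_mono_ae
        filter_upwards [h0] with v hv
        apply Finset.sum_le_sum
        intro i _
        apply ENNReal.ofReal_le_ofReal
        have h1 := hM.ir (fun j => min (v j) N) (fun j => le_min (hv j) hN0) i
        have h2 := hull_bounds (hM.valid (fun j => min (v j) N)) i
        have h3 : min (v i) N ≤ (N:ℝ) := min_le_right _ _
        have h4 : 0 ≤ min (v i) (N:ℝ) := le_min (hv i) hN0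
        simp only [trunc]
        nlinarith
      refine ne_top_of_le_ne_top ?_ this
      simp [ENNReal.mul_eq_top]
    rw [← lint_eq_rev P h0 hg (fun v hv i => hp _ (fun j => le_min (hv j) hN0) i) hfin]
    apply ENNReal.ofReal_le_ofReal
    exact le_csSup hb ⟨_, hg.valid, hg.dsic, hg.ir, hg.meas, rfl⟩
  calc ∫⁻ v, ∑ i, ENNReal.ofReal (M.pay v i) ∂P
      = ∫⁻ v, liminf (fun N : ℕ => ∑ i, ENNReal.ofReal ((trunc M N).pay v i)) atTop ∂P := by
        apply lintegral_congr
        intro v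
        symm
        apply Tendsto.liminf_eq
        apply tendsto_const_nhds.congr'
        have : ∀ᶠ N : ℕ in atTop, ∀ j, v j ≤ N := by
          rw [eventually_all]
          intro j
          obtain ⟨N, hN⟩ := exists_nat_ge (v j)
          filter_upwards [eventually_ge_atTop N] with m hm
          exact hN.trans (by exact_mod_cast hm)
        filter_upwards [this] with N hN
        have : (fun j => min (v j) (N:ℝ)) = v := funext fun j => min_eq_left (hN j)
        simp only [trunc, this]
    _ ≤ liminf (fun N : ℕ => ∫⁻ v, ∑ i, ENNReal.ofReal ((trunc M N).pay v i) ∂P) atTop := by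
        apply lintegral_liminf_le
        intro N
        exact Finset.measurable_sum _
          (fun i _ => ((hM.meas.2 i).comp (meas_trunc _)).ennreal_ofReal)
    _ ≤ liminf (fun _ : ℕ => ENNReal.ofReal (OptEnv F P)) atTop :=
        liminf_le_liminf (Eventually.of_forall hN)
    _ = _ := by simp

/-- resampling one coordinate -/
lemma resample (D : Fin n → Measure ℝ) [∀ i, IsProbabilityMeasure (D i)] (j : Fin n) :
    Measure.map (fun z : (Fin n → ℝ) × ℝ => Function.update z.1 j z.2)
      ((Measure.pi D).prod (D j)) = Measure.pi D := by
  symm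
  apply Measure.pi_eq
  intro s hs
  rw [Measure.map_apply measurable_update' (MeasurableSet.univ_pi hs)]
  have : (fun z : (Fin n → ℝ) × ℝ => Function.update z.1 j z.2) ⁻¹' (univ.pi s) =
      (univ.pi (Function.update s j univ)) ×ˢ (s j) := by
    ext z
    simp only [mem_preimage, mem_univ_pi, mem_prod]
    constructor
    · intro h
      refine ⟨fun i => ?_, by simpa using h j⟩
      by_cases hi : i = j
      · subst hi; simp
      · simpa [hi] using h i
    · rintro ⟨h1, h2⟩ i
      by_cases hi : i = j
      · subst hi; simpa using h2
      · simpa [hi] using h1 i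
  rw [this, Measure.prod_prod, Measure.pi_pi]
  rw [← Finset.mul_prod_erase Finset.univ _ (Finset.mem_univ j),
    ← Finset.mul_prod_erase Finset.univ (fun i => D i (s i)) (Finset.mem_univ j)]
  simp only [Function.update_self, measure_univ, one_mul]
  rw [mul_comm]
  congr 1
  apply Finset.prod_congr rfl
  intro i hi
  rw [Function.update_of_ne (Finset.ne_of_mem_erase hi)]

lemma lint_resample (D : Fin n → Measure ℝ) [∀ i, IsProbabilityMeasure (D i)] (j : Fin n)
    (f : (Fin n → ℝ) → ENNReal) (hf : Measurable f) :
    ∫⁻ v, f v ∂(Measure.pi D) = ∫⁻ v, ∫⁻ t, f (Function.update v j t) ∂(D j) ∂(Measure.pi D) := by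
  conv_lhs => rw [← resample D j]
  rw [lintegral_map hf measurable_update']
  exact lintegral_prod (fun z : (Fin n → ℝ) × ℝ => f (Function.update z.1 j z.2))
    (hf.comp measurable_update').aemeasurable

lemma lint_resample' (D : Fin n → Measure ℝ) [∀ i, IsProbabilityMeasure (D i)] (j : Fin n)
    (f : (Fin n → ℝ) → ENNReal) (hf : Measurable f) :
    ∫⁻ v, f v ∂(Measure.pi D) = ∫⁻ t, ∫⁻ v, f (Function.update v j t) ∂(Measure.pi D) ∂(D j) := by
  conv_lhs => rw [← resample D j]
  rw [lintegral_map hf measurable_update']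
  exact lintegral_prod_symm' (fun z : (Fin n → ℝ) × ℝ => f (Function.update z.1 j z.2))
    (hf.comp measurable_update')

end TR

namespace TR

open Set Filter

variable {n : ℕ}

def normM (M : Mech n) : Mech n where
  alloc := M.alloc
  pay v i := M.pay v i - M.pay (Function.update v i 0) i

lemma meas_upd (i : Fin n) (t : ℝ) : Measurable (fun v : Fin n → ℝ => Function.update v i t) :=
  measurable_update'.comp (measurable_id.prodMk measurable_const)

lemma norm_good {F : Finset (Finset (Fin n))} {M : Mech n} (h : Good F M) : Good F (normM M) := by
  refine ⟨h.valid, ?_, ?_, h.meas.1, ?_⟩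
  · intro i v hv v' hv'
    have := h.dsic i v hv v' hv'
    simp only [normM, Function.update_idem]
    linarith
  · intro v hv i
    have h1 := h.dsic i v hv 0 le_rfl
    have h2 := mul_nonneg (hv i) (hull_bounds (h.valid (Function.update v i 0)) i).1
    simp only [normM]
    linarith
  · intro i
    exact (h.meas.2 i).sub ((h.meas.2 i).comp (meas_upd i 0))

lemma norm_nonneg {F : Finset (Finset (Fin n))} {M : Mech n} (h : Good F M) :
    ∀ v, (∀ j, 0 ≤ v j) → ∀ i, 0 ≤ (normM M).pay v i := by
  intro v hv i
  have h1 := dsic_upd h.dsic i v hv 0 (v i) le_rfl (hv i)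
  rw [Function.update_eq_self] at h1
  simp only [normM]
  linarith

lemma norm_ge {F : Finset (Finset (Fin n))} {M : Mech n} (h : Good F M) :
    ∀ v, (∀ j, 0 ≤ v j) → ∀ i, M.pay v i ≤ (normM M).pay v i := by
  intro v hv i
  have h1 := h.ir (Function.update v i 0) (upd_nonneg hv i le_rfl) i
  simp only [Function.update_self] at h1
  simp only [normM]
  linarith

def kill (M : Mech n) (k : Fin n) (t : ℝ) : Mech n where
  alloc v i := if i = k then 0 else M.alloc (Function.update v k t) i
  pay v i := if i = k then 0 else M.pay (Function.update v k t) i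

lemma kill_good {F : Finset (Finset (Fin n))} (hdc : ∀ S ∈ F, ∀ T ⊆ S, T ∈ F)
    {M : Mech n} (h : Good F M) (k : Fin n) {t : ℝ} (ht : 0 ≤ t) : Good F (kill M k t) := by
  refine ⟨fun v => hull_zero hdc (h.valid _) k, ?_, ?_, ?_, ?_⟩
  · intro i v hv v' hv'
    by_cases hi : i = k
    · simp [kill, hi]
    · have := h.dsic i (Function.update v k t) (upd_nonneg hv k ht) v' hv'
      simp only [kill, hi, if_false]
      rw [Function.update_comm hi]
      rwa [Function.update_of_ne hi] at this
  · intro v hv i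
    by_cases hi : i = k
    · simp [kill, hi]
    · have := h.ir (Function.update v k t) (upd_nonneg hv k ht) i
      simp only [kill, hi, if_false]
      rwa [Function.update_of_ne hi] at this
  · intro i
    by_cases hi : i = k
    · simp [kill, hi]
    · simp only [kill, hi, if_false]
      exact (h.meas.1 i).comp (meas_upd k t)
  · intro i
    by_cases hi : i = k
    · simp [kill, hi]
    · simp only [kill, hi, if_false]
      exact (h.meas.2 i).comp (meas_upd k t)

lemma third {F : Finset (Finset (Fin n))} (hdc : ∀ S ∈ F, ∀ T ⊆ S, T ∈ F)
    (D : Fin n → Measure ℝ) [∀ i, IsProbabilityMeasure (D i)]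
    (h0 : ∀ᵐ v ∂(Measure.pi D), ∀ j, 0 ≤ v j) (hb : BddAbove (revSet F (Measure.pi D)))
    {M : Mech n} (hM : Good F M)
    (hp : ∀ v, (∀ j, 0 ≤ v j) → ∀ i, 0 ≤ M.pay v i) (a : ℝ) (ha : 0 ≤ a) (k : Fin n) :
    ∫⁻ v, (if a ≤ v k then ∑ i, (if i = k then 0 else ENNReal.ofReal (M.pay v i)) else 0)
      ∂(Measure.pi D) ≤ D k (Ici a) * ENNReal.ofReal (OptEnv F (Measure.pi D)) := by
  rw [lint_resample' D k]
  · calc _ ≤ ∫⁻ t, (Ici a).indicator (fun _ => ENNReal.ofReal (OptEnv F (Measure.pi D))) t ∂(D k) := by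
          apply lintegral_mono
          intro t
          by_cases ht : a ≤ t
          · simp only [Function.update_self, ht, if_true]
            rw [indicator_of_mem (show t ∈ Ici a from ht)]
            have ht0 := ha.trans ht
            have := lint_le (Measure.pi D) h0 hb (kill_good hdc hM k ht0) (by
              intro v hv i
              by_cases hi : i = k
              · simp [kill, hi]
              · simp only [kill, hi, if_false]
                exact hp _ (upd_nonneg hv k ht0) i)
            refine le_trans (le_of_eq ?_) this
            apply lintegral_congr
            intro v
            apply Finset.sum_congr rfl
            intro i _
            by_cases hi : i = k <;> simp [kill, hi]
          · simp [ht]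
      _ = _ := by
          rw [lintegral_indicator_const measurableSet_Ici, mul_comm]
  · apply Measurable.ite (measurableSet_le measurable_const (measurable_pi_apply k)) _ measurable_const
    apply Finset.measurable_sum
    intro i _
    by_cases hi : i = k
    · simp [hi]
    · simp only [hi, if_false]
      exact (hM.meas.2 i).ennreal_ofReal

open Classical in
noncomputable def post (n : ℕ) (a : ℝ) : Mech n where
  alloc v i := if a ≤ v i ∧ ∀ k < i, v k < a then 1 else 0
  pay v i := if a ≤ v i ∧ ∀ k < i, v k < a then a else 0

def rect (n : ℕ) (a : ℝ) (i : Fin n) : Fin n → Set ℝ :=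
  fun k => if k = i then Ici a else if k < i then Iio a else univ

lemma rect_meas (n : ℕ) (a : ℝ) (i : Fin n) : ∀ k, MeasurableSet (rect n a i k) := by
  intro k
  unfold rect
  split_ifs
  · exact measurableSet_Ici
  · exact measurableSet_Iio
  · exact MeasurableSet.univ

lemma rect_eq (a : ℝ) (i : Fin n) :
    {v : Fin n → ℝ | a ≤ v i ∧ ∀ k < i, v k < a} = univ.pi (rect n a i) := by
  ext v
  simp only [mem_ofPred_eq, mem_univ_pi, rect]
  constructor
  · rintro ⟨h1, h2⟩ k
    split_ifs with h3 h4
    · rw [h3]; exact h1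
    · exact h2 k h4
    · trivial
  · intro h
    refine ⟨by simpa using h i, fun k hk => ?_⟩
    have := h k
    simpa [hk.ne, hk] using this

lemma post_good {F : Finset (Finset (Fin n))} (hdc : ∀ S ∈ F, ∀ T ⊆ S, T ∈ F) (hF : ∅ ∈ F)
    (hsingle : ∀ i : Fin n, {i} ∈ F) (a : ℝ) : Good F (post n a) := by
  classical
  have hms : ∀ i, MeasurableSet {v : Fin n → ℝ | a ≤ v i ∧ ∀ k < i, v k < a} := by
    intro i; rw [rect_eq]; exact MeasurableSet.univ_pi (rect_meas n a i)
  refine ⟨fun v => subset_convexHull _ _ ?_, ?_, ?_, ?_, ?_⟩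
  · refine ⟨Finset.univ.filter (fun i => a ≤ v i ∧ ∀ k < i, v k < a), ?_, ?_⟩
    · rcases Finset.eq_empty_or_nonempty
        (Finset.univ.filter (fun i => a ≤ v i ∧ ∀ k < i, v k < a)) with h | ⟨i, hi⟩
      · rw [h]; exact hF
      · apply hdc _ (hsingle i)
        intro j hj
        rw [Finset.mem_filter] at hi hj
        rw [Finset.mem_singleton]
        rcases lt_trichotomy i j with h | h | h
        · linarith [hj.2.2 i h, hi.2.1]
        · exact h.symm
        · linarith [hi.2.2 j h, hj.2.1]
    · ext i; simp [post, indicatorVec]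
  · intro i v hv v' hv'
    have hB : (∀ k < i, Function.update v i v' k < a) ↔ ∀ k < i, v k < a := by
      apply forall_congr'; intro k
      apply forall_congr'; intro hk
      rw [Function.update_of_ne hk.ne]
    simp only [post, hB, Function.update_self]
    split_ifs with c1 c2 c2
    · exact le_rfl
    · have : ¬ a ≤ v i := fun h => c2 ⟨h, c1.2⟩
      linarith
    · linarith [c2.1]
    · exact le_rfl
  · intro v hv i
    simp only [post]
    split_ifs with h
    · linarith [h.1]
    · simp
  · intro i
    exact Measurable.ite (hms i) measurable_const measurable_const
  · intro i
    exact Measurable.ite (hms i) measurable_const measurable_const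

lemma post_bound {F : Finset (Finset (Fin n))} (hdc : ∀ S ∈ F, ∀ T ⊆ S, T ∈ F) (hF : ∅ ∈ F)
    (hsingle : ∀ i : Fin n, {i} ∈ F) 
    (D : Fin n → Measure ℝ) [∀ i, IsProbabilityMeasure (D i)]
    (h0 : ∀ᵐ v ∂(Measure.pi D), ∀ j, 0 ≤ v j) (hb : BddAbove (revSet F (Measure.pi D)))
    (a : ℝ) (ha : 0 ≤ a) :
    a * ∑ i, ((D i).real (Ici a) * ∏ j ∈ Finset.univ.filter (· < i), (1 - (D j).real (Ici a))) ≤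
      OptEnv F (Measure.pi D) := by
  classical
  have h := lint_le (Measure.pi D) h0 hb (post_good hdc hF hsingle a) (by
    intro v hv i; simp only [post]; split_ifs <;> simp [ha])
  have hms : ∀ i, MeasurableSet {v : Fin n → ℝ | a ≤ v i ∧ ∀ k < i, v k < a} := by
    intro i; rw [rect_eq]; exact MeasurableSet.univ_pi (rect_meas n a i)
  have hR : ∀ i, (Measure.pi D).real {v : Fin n → ℝ | a ≤ v i ∧ ∀ k < i, v k < a} =
      (D i).real (Ici a) * ∏ j ∈ Finset.univ.filter (· < i), (1 - (D j).real (Ici a)) := by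
    intro i
    rw [rect_eq, measureReal_def, Measure.pi_pi, ENNReal.toReal_prod,
      ← Finset.mul_prod_erase Finset.univ _ (Finset.mem_univ i)]
    congr 1
    · simp [rect, measureReal_def]
    · rw [Finset.prod_filter, ← Finset.mul_prod_erase Finset.univ (fun j => if j < i then _ else _) (Finset.mem_univ i)]
      simp only [lt_irrefl, if_false, one_mul]
      apply Finset.prod_congr rfl
      intro k hk
      have hk' := Finset.ne_of_mem_erase hk
      simp only [rect, hk', if_false]
      split_ifs with h3
      · rw [← probReal_compl_eq_one_sub measurableSet_Ici, compl_Ici, measureReal_def]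
      · simp
  have hi : ∀ i, ∫⁻ v, ENNReal.ofReal ((post n a).pay v i) ∂(Measure.pi D) =
      ENNReal.ofReal (a * ((D i).real (Ici a) *
        ∏ j ∈ Finset.univ.filter (· < i), (1 - (D j).real (Ici a)))) := by
    intro i
    rw [← hR i, ENNReal.ofReal_mul ha, ofReal_measureReal, ← lintegral_indicator_const (hms i)]
    apply lintegral_congr
    intro v
    simp only [post, indicator, mem_ofPred_eq]
    split_ifs <;> simp
  have hnn : ∀ i, 0 ≤ a * ((D i).real (Ici a) *
        ∏ j ∈ Finset.univ.filter (· < i), (1 - (D j).real (Ici a))) := by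
    intro i; rw [← hR i]; exact mul_nonneg ha measureReal_nonneg
  rw [lintegral_finsetSum _ (fun i _ => ((post_good hdc hF hsingle a).meas.2 i).ennreal_ofReal)] at h
  simp only [hi] at h
  rw [← ENNReal.ofReal_sum_of_nonneg (fun i _ => hnn i), ← Finset.mul_sum,
    ENNReal.ofReal_le_ofReal_iff (opt_nonneg hF _)] at h
  exact h

open Classical in
noncomputable def mp (M : Mech n) (a : ℝ) : Mech n where
  alloc v j := if ∀ k, k ≠ j → v k < a then (if v j < a then M.alloc v j else 1) else 0
  pay v j := if ∀ k, k ≠ j → v k < a then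
    (if v j < a then M.pay v j else
      a - (a * M.alloc (Function.update v j a) j - M.pay (Function.update v j a) j)) else 0

lemma mp_meas_set (a : ℝ) (j : Fin n) : MeasurableSet {v : Fin n → ℝ | ∀ k, k ≠ j → v k < a} := by
  have : {v : Fin n → ℝ | ∀ k, k ≠ j → v k < a} = ⋂ k, ⋂ (_ : k ≠ j), {v | v k < a} := by
    ext v; simp
  rw [this]
  exact MeasurableSet.iInter fun k => MeasurableSet.iInter fun _ =>
    measurableSet_lt (measurable_pi_apply k) measurable_const

lemma mp_good {F : Finset (Finset (Fin n))} (hF : ∅ ∈ F)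
    (hsingle : ∀ i : Fin n, {i} ∈ F) {M : Mech n} (h : Good F M) {a : ℝ} (ha : 0 ≤ a) :
    Good F (mp M a) := by
  classical
  have hms := mp_meas_set (n := n) a
  refine ⟨fun v => ?_, ?_, ?_, ?_, ?_⟩
  · by_cases h1 : ∀ k, v k < a
    · have : (mp M a).alloc v = M.alloc v := by
        ext j; simp [mp, h1]
      rw [this]; exact h.valid v
    · push Not at h1
      obtain ⟨k, hk⟩ := h1
      apply subset_convexHull
      have hne : ∀ j, j ≠ k → (mp M a).alloc v j = 0 := by
        intro j hj
        simp only [mp]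
        rw [if_neg]
        intro h2
        linarith [h2 k hj.symm]
      by_cases h2 : ∀ i, i ≠ k → v i < a
      · refine ⟨{k}, hsingle k, ?_⟩
        ext j
        by_cases hj : j = k
        · subst hj
          simp only [mp, indicatorVec, Finset.mem_singleton, if_true]
          rw [if_pos h2, if_neg (not_lt.2 hk)]
        · rw [hne j hj]; simp [indicatorVec, hj]
      · refine ⟨∅, hF, ?_⟩
        ext j
        by_cases hj : j = k
        · subst hj
          simp only [mp, indicatorVec]
          rw [if_neg h2]; simp
        · rw [hne j hj]; simp [indicatorVec]
  · intro i v hv v' hv'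
    have hB : (∀ k, k ≠ i → Function.update v i v' k < a) ↔ ∀ k, k ≠ i → v k < a := by
      apply forall_congr'; intro k
      apply forall_congr'; intro hk
      rw [Function.update_of_ne hk]
    simp only [mp, hB, Function.update_self, Function.update_idem]
    have e1 := dsic_upd h.dsic i v hv (v i) v' (hv i) hv'
    have e2 := dsic_upd h.dsic i v hv (v i) a (hv i) ha
    have e3 := dsic_upd h.dsic i v hv a v' ha hv'
    have b1 := hull_bounds (h.valid (Function.update v i v')) i
    have b2 := hull_bounds (h.valid (Function.update v i a)) i
    rw [Function.update_eq_self] at e1 e2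
    split_ifs with h1 h2 h3 h3
    · exact e1
    · nlinarith
    · nlinarith
    · linarith
    · linarith
  · intro v hv i
    have e1 := h.ir v hv i
    have e2 := h.ir (Function.update v i a) (upd_nonneg hv i ha) i
    simp only [Function.update_self] at e2
    simp only [mp]
    split_ifs with h1 h2
    · exact e1
    · linarith
    · simp
  · intro i
    exact Measurable.ite (hms i) (Measurable.ite (measurableSet_lt (measurable_pi_apply i)
      measurable_const) (h.meas.1 i) measurable_const) measurable_const
  · intro i
    exact Measurable.ite (hms i) (Measurable.ite (measurableSet_lt (measurable_pi_apply i)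
      measurable_const) (h.meas.2 i) (measurable_const.sub
      ((measurable_const.mul ((h.meas.1 i).comp (meas_upd i a))).sub
        ((h.meas.2 i).comp (meas_upd i a))))) measurable_const

lemma mp_nonneg {F : Finset (Finset (Fin n))} {M : Mech n} (h : Good F M) {a : ℝ} (ha : 0 ≤ a)
    (hp : ∀ v, (∀ j, 0 ≤ v j) → ∀ i, 0 ≤ M.pay v i) :
    ∀ v, (∀ j, 0 ≤ v j) → ∀ i, 0 ≤ (mp M a).pay v i := by
  intro v hv i
  simp only [mp]
  have b2 := hull_bounds (h.valid (Function.update v i a)) i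
  split_ifs with h1 h2
  · exact hp v hv i
  · have := hp _ (upd_nonneg hv i ha) i
    nlinarith
  · exact le_rfl

lemma mp_trunc (M : Mech n) (a : ℝ) (v : Fin n → ℝ) :
    (trunc (mp M a) a).pay v = (mp M a).pay v := by
  ext j
  have h1 : ∀ k, min (v k) a < a ↔ v k < a := by intro k; simp
  simp only [trunc, mp, h1]
  by_cases h2 : ∀ k, k ≠ j → v k < a
  · have h3 : Function.update (fun k => min (v k) a) j a = Function.update v j a := by
      ext k; by_cases hk : k = j
      · subst hk; simp
      · simp [hk, (h2 k hk).le]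
    rw [if_pos h2, if_pos h2, h3]
    split_ifs with h4
    · have : (fun k => min (v k) a) = v := by
        ext k; by_cases hk : k = j
        · subst hk; exact min_eq_left h4.le
        · exact min_eq_left (h2 k hk).le
      rw [this]
    · rfl
  · rw [if_neg h2, if_neg h2]

end TR

namespace TR

open Set Filter

variable {n : ℕ}

noncomputable def tail (M : Mech n) (a : ℝ) (j : Fin n) (v : Fin n → ℝ) : ENNReal :=
  ∑ k, if a ≤ v k then (if j = k then 0 else ENNReal.ofReal (M.pay v j)) else 0

lemma tail_meas {M : Mech n} (hM : M.Meas) (a : ℝ) (j : Fin n) : Measurable (tail M a j) := by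
  unfold tail
  apply Finset.measurable_sum
  intro k _
  apply Measurable.ite (measurableSet_le measurable_const (measurable_pi_apply k)) _ measurable_const
  by_cases hi : j = k
  · simp [hi]
  · simp only [hi, if_false]
    exact (hM.2 j).ennreal_ofReal

lemma slice {F : Finset (Finset (Fin n))} (μ : Measure ℝ) [IsProbabilityMeasure μ]
    (hreg : Regular μ) {M : Mech n} (hM : Good F M)
    (hp : ∀ v, (∀ j, 0 ≤ v j) → ∀ i, 0 ≤ M.pay v i) (a : ℝ) (ha : 0 < a)
    (j : Fin n) (hq : μ.real (Ici a) < 1) (v : Fin n → ℝ) (hv : ∀ k, 0 ≤ v k)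
    (hG : ∀ k, k ≠ j → v k < a) :
    ∫⁻ t, ENNReal.ofReal (M.pay (Function.update v j t) j) ∂μ ≤
      ∫⁻ t, ENNReal.ofReal ((mp M a).pay (Function.update v j t) j) ∂μ +
      ENNReal.ofReal (a * μ.real (Ici a) * (μ.real (Ici a) / (1 - μ.real (Ici a)))) := by
  set q := μ.real (Ici a) with hqd
  have hq0 : 0 ≤ q := measureReal_nonneg
  have h1q : 0 < 1 - q := by linarith
  set u := a * M.alloc (Function.update v j a) j - M.pay (Function.update v j a) j with hu
  have hva := upd_nonneg hv j ha.le
  have hu0 : 0 ≤ u := by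
    have := hM.ir _ hva j
    rwa [Function.update_self] at this
  have hua : u ≤ a := by
    have h1 := hp _ hva j
    have h2 := hull_bounds (hM.valid (Function.update v j a)) j
    rw [hu]; nlinarith
  have hmu : μ (Ici a) = ENNReal.ofReal q := by rw [hqd, ofReal_measureReal]
  have hB : ∀ t, (∀ k, k ≠ j → Function.update v j t k < a) := by
    intro t k hk
    rw [Function.update_of_ne hk]; exact hG k hk
  have hs := single μ a (a * q / (1 - q)) ha (fun t ht => reg_bound μ hreg a ha hq t ht)
    (fun t => M.alloc (Function.update v j t) j)
    (fun t => M.pay (Function.update v j t) j + u)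
    (fun t _ => hull_bounds (hM.valid _) j)
    (by
      intro s hs t ht
      have := dsic_upd hM.dsic j v hv s t (ha.le.trans hs) (ha.le.trans ht)
      linarith)
    (by simp only [hu]; ring)
  have hs' : ∫⁻ t in Ici a, ENNReal.ofReal (M.pay (Function.update v j t) j + u) ∂μ =
      ∫⁻ t in Ici a, ENNReal.ofReal (M.pay (Function.update v j t) j) ∂μ +
        ENNReal.ofReal u * ENNReal.ofReal q := by
    rw [← hmu, ← setLIntegral_const, ← lintegral_add_right _ measurable_const]
    apply setLIntegral_congr_fun measurableSet_Ici
    intro t ht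
    simp only
    rw [ENNReal.ofReal_add (hp _ (upd_nonneg hv j (ha.le.trans ht)) j) hu0]
  have hg : ∫⁻ t in Ici a, ENNReal.ofReal ((mp M a).pay (Function.update v j t) j) ∂μ =
      ENNReal.ofReal (a - u) * ENNReal.ofReal q := by
    rw [← hmu, ← setLIntegral_const]
    apply setLIntegral_congr_fun measurableSet_Ici
    intro t ht
    have ht' : ¬ t < a := not_lt.2 ht
    simp only [mp, Function.update_self, Function.update_idem]
    rw [if_pos (hB t), if_neg ht']
  have hgc : ∫⁻ t in (Ici a)ᶜ, ENNReal.ofReal ((mp M a).pay (Function.update v j t) j) ∂μ =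
      ∫⁻ t in (Ici a)ᶜ, ENNReal.ofReal (M.pay (Function.update v j t) j) ∂μ := by
    apply setLIntegral_congr_fun measurableSet_Ici.compl
    intro t ht
    have ht' : t < a := not_le.1 ht
    simp only [mp, Function.update_self]
    rw [if_pos (hB t), if_pos ht']
  rw [hs'] at hs
  rw [← lintegral_add_compl _ (measurableSet_Ici (a := a)),
    ← lintegral_add_compl (fun t => ENNReal.ofReal ((mp M a).pay (Function.update v j t) j))
      (measurableSet_Ici (a := a)), hg, hgc]
  have hkey : ∫⁻ t in Ici a, ENNReal.ofReal (M.pay (Function.update v j t) j) ∂μ ≤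
      ENNReal.ofReal (a - u) * ENNReal.ofReal q + ENNReal.ofReal (a * q * (q / (1 - q))) := by
    have hfin : ENNReal.ofReal u * ENNReal.ofReal q ≠ ⊤ :=
      ENNReal.mul_ne_top ENNReal.ofReal_ne_top ENNReal.ofReal_ne_top
    rw [← ENNReal.add_le_add_iff_right hfin]
    refine hs.trans (le_of_eq ?_)
    rw [← ENNReal.ofReal_mul (by linarith), ← ENNReal.ofReal_mul hu0, ← ENNReal.ofReal_add,
      ← ENNReal.ofReal_add]
    · congr 1; field_simp; ring
    · have := mul_nonneg (sub_nonneg.2 hua) hq0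
      positivity
    · positivity
    · exact mul_nonneg (sub_nonneg.2 hua) hq0
    · positivity
  calc _ ≤ _ := add_le_add_left hkey _
    _ = _ := by ring

lemma claim {F : Finset (Finset (Fin n))} (D : Fin n → Measure ℝ) [∀ i, IsProbabilityMeasure (D i)]
    (h0 : ∀ᵐ v ∂(Measure.pi D), ∀ j, 0 ≤ v j) {M : Mech n} (hM : Good F M)
    (hF : ∅ ∈ F) (hsingle : ∀ i : Fin n, {i} ∈ F)
    (hp : ∀ v, (∀ j, 0 ≤ v j) → ∀ i, 0 ≤ M.pay v i) (a : ℝ) (ha : 0 < a)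
    (j : Fin n) (hreg : Regular (D j)) (hq : (D j).real (Ici a) < 1) :
    ∫⁻ v, ENNReal.ofReal (M.pay v j) ∂(Measure.pi D) ≤
      ∫⁻ v, ENNReal.ofReal ((mp M a).pay v j) ∂(Measure.pi D) +
      ENNReal.ofReal (a * (D j).real (Ici a) *
        ((D j).real (Ici a) / (1 - (D j).real (Ici a)))) +
      ∫⁻ v, tail M a j v ∂(Measure.pi D) := by
  set c := ENNReal.ofReal (a * (D j).real (Ici a) *
        ((D j).real (Ici a) / (1 - (D j).real (Ici a)))) with hc
  have hmg := ((mp_good hF hsingle hM ha.le).meas.2 j).ennreal_ofReal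
  have hmf := (hM.meas.2 j).ennreal_ofReal
  have hmt := tail_meas hM.meas a j
  rw [lint_resample D j _ hmf, lint_resample D j _ hmg, lint_resample D j _ hmt]
  have hc' : c = ∫⁻ _ : Fin n → ℝ, c ∂(Measure.pi D) := by simp
  rw [hc', ← lintegral_add_right _ measurable_const, ← lintegral_add_right]
  swap
  · exact (hmt.comp measurable_update').lintegral_prod_right'
  apply lintegral_mono_ae
  filter_upwards [h0] with v hv
  by_cases hG : ∀ k, k ≠ j → v k < a
  · exact (slice (D j) hreg hM hp a ha j hq v hv hG).trans le_self_add
  · push Not at hG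
    obtain ⟨k, hk, hka⟩ := hG
    refine le_trans (lintegral_mono ?_) le_add_self
    intro t
    simp only [tail]
    refine le_trans (le_of_eq ?_) (Finset.single_le_sum (fun _ _ => bot_le) (Finset.mem_univ k))
    simp only [Function.update_of_ne hk, hka, if_true, hk.symm, if_false]

lemma total {F : Finset (Finset (Fin n))} (hdc : ∀ S ∈ F, ∀ T ⊆ S, T ∈ F)
    (D : Fin n → Measure ℝ) [∀ i, IsProbabilityMeasure (D i)]
    (h0 : ∀ᵐ v ∂(Measure.pi D), ∀ j, 0 ≤ v j) (hb : BddAbove (revSet F (Measure.pi D)))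
    {M : Mech n} (hM : Good F M)
    (hF : ∅ ∈ F) (hsingle : ∀ i : Fin n, {i} ∈ F)
    (hp : ∀ v, (∀ j, 0 ≤ v j) → ∀ i, 0 ≤ M.pay v i) (a : ℝ) (ha : 0 < a)
    (hreg : ∀ j, Regular (D j)) (hq : ∀ j, (D j).real (Ici a) < 1) :
    Rev M (Measure.pi D) ≤ Rev (mp M a) (Measure.pi D) +
      ∑ j, a * (D j).real (Ici a) * ((D j).real (Ici a) / (1 - (D j).real (Ici a))) +
      (∑ j, (D j).real (Ici a)) * OptEnv F (Measure.pi D) := by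
  have hg := mp_good hF hsingle hM ha.le
  have hgp := mp_nonneg hM ha.le hp
  have hopt := opt_nonneg hF (Measure.pi D)
  have hfinM := ne_top_of_le_ne_top ENNReal.ofReal_ne_top (lint_le _ h0 hb hM hp)
  have hfing := ne_top_of_le_ne_top ENNReal.ofReal_ne_top (lint_le _ h0 hb hg hgp)
  have e1 := lint_eq_rev _ h0 hM hp hfinM
  have e2 := lint_eq_rev _ h0 hg hgp hfing
  have hq0 : ∀ j, 0 ≤ (D j).real (Ici a) := fun j => measureReal_nonneg
  have hc0 : ∀ j, 0 ≤ a * (D j).real (Ici a) * ((D j).real (Ici a) / (1 - (D j).real (Ici a))) :=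
    fun j => mul_nonneg (mul_nonneg ha.le (hq0 j)) (div_nonneg (hq0 j) (by linarith [hq j]))
  have hrev0 : 0 ≤ Rev (mp M a) (Measure.pi D) := by
    apply integral_nonneg_of_ae
    filter_upwards [h0] with v hv
    exact Finset.sum_nonneg (fun i _ => hgp v hv i)
  have hS1 := Finset.sum_nonneg (s := Finset.univ) (fun j _ => hc0 j)
  have hS2 := mul_nonneg (Finset.sum_nonneg (s := Finset.univ) (fun j _ => hq0 j)) hopt
  have htail : ∑ j, ∫⁻ v, tail M a j v ∂(Measure.pi D) ≤
      ENNReal.ofReal ((∑ j, (D j).real (Ici a)) * OptEnv F (Measure.pi D)) := by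
    rw [← lintegral_finsetSum _ (fun j _ => tail_meas hM.meas a j)]
    have : ∀ v, ∑ j, tail M a j v = ∑ k, (if a ≤ v k then
        ∑ i, (if i = k then 0 else ENNReal.ofReal (M.pay v i)) else 0) := by
      intro v
      unfold tail
      rw [Finset.sum_comm]
      apply Finset.sum_congr rfl
      intro k _
      split_ifs <;> simp
    simp only [this]
    rw [lintegral_finsetSum]
    · rw [Finset.sum_mul, ENNReal.ofReal_sum_of_nonneg (fun j _ => mul_nonneg (hq0 j) hopt)]
      apply Finset.sum_le_sum
      intro k _
      rw [ENNReal.ofReal_mul (hq0 k), ofReal_measureReal]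
      exact third hdc D h0 hb hM hp a ha.le k
    · intro k _
      apply Measurable.ite (measurableSet_le measurable_const (measurable_pi_apply k)) _
        measurable_const
      apply Finset.measurable_sum
      intro i _
      by_cases hi : i = k
      · simp [hi]
      · simp only [hi, if_false]
        exact (hM.meas.2 i).ennreal_ofReal
  rw [← ENNReal.ofReal_le_ofReal_iff (by positivity), ENNReal.ofReal_add (by positivity) hS2,
    ENNReal.ofReal_add hrev0 hS1, e1, e2, ENNReal.ofReal_sum_of_nonneg (fun j _ => hc0 j),
    lintegral_finsetSum _ (fun i _ => (hM.meas.2 i).ennreal_ofReal),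
    lintegral_finsetSum _ (fun i _ => (hg.meas.2 i).ennreal_ofReal)]
  refine le_trans (Finset.sum_le_sum (fun j _ =>
    claim D h0 hM hF hsingle hp a ha j (hreg j) (hq j))) ?_
  rw [Finset.sum_add_distrib, Finset.sum_add_distrib]
  gcongr

end TR

/-- **Truncation lemma for downward-closed environments.** Let `F` be a
downward-closed family of feasible sets containing all singletons, let
`ε ∈ (0,1/4]`, let `D` be a regular product distribution on `[0,∞)ⁿ`, and let
`v̄ ≥ (1/ε)·Opt_F(D)`.  Truncating every coordinate at `v̄` loses at most a
`4ε` fraction of the optimal revenue. -/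
theorem truncation_downward_closed {n : ℕ} (hn : 1 ≤ n)
    (F : Finset (Finset (Fin n)))
    (hdc : ∀ S ∈ F, ∀ T ⊆ S, T ∈ F)
    (hsingle : ∀ i : Fin n, {i} ∈ F)
    (ε : ℝ) (hε : ε ∈ Set.Ioc (0 : ℝ) (1 / 4))
    (D : Fin n → Measure ℝ)
    (hprob : ∀ i, IsProbabilityMeasure (D i))
    (hnonneg : ∀ i, D i (Set.Iio 0) = 0)
    (hreg : ∀ i, Regular (D i))
    (vbar : ℝ) (hvbar : (1 / ε) * OptEnv F (Measure.pi D) ≤ vbar) :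
    (1 - 4 * ε) * OptEnv F (Measure.pi D) ≤
      OptEnv F (Measure.pi fun i => Measure.map (fun v : ℝ => min v vbar) (D i)) := by
  have hε0 : 0 < ε := hε.1
  have hε4 : ε ≤ 1 / 4 := hε.2
  have hF : ∅ ∈ F := hdc _ (hsingle ⟨0, hn⟩) ∅ (Finset.empty_subset _)
  set O := OptEnv F (Measure.pi D) with hO
  have hO0 : 0 ≤ O := TR.opt_nonneg hF _
  have hT0 := TR.opt_nonneg hF
    (Measure.pi fun i => Measure.map (fun v : ℝ => min v vbar) (D i))
  rcases hO0.eq_or_lt with hz | hpos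
  · rw [← hz]; simpa using hT0
  have hb : BddAbove (TR.revSet F (Measure.pi D)) := by
    by_contra hb
    have : O = 0 := Real.sSup_of_not_bddAbove hb
    linarith
  have hOe : O ≤ ε * vbar := by
    rw [one_div, inv_mul_le_iff₀ hε0] at hvbar
    exact hvbar
  have ha : 0 < vbar := by
    by_contra h
    push Not at h
    nlinarith
  have h0 : ∀ᵐ v ∂(Measure.pi D), ∀ j, 0 ≤ v j := by
    rw [ae_all_iff]
    intro j
    have h1 : ∀ᵐ t ∂(D j), 0 ≤ t := by
      rw [ae_iff]
      have : {t : ℝ | ¬ 0 ≤ t} = Set.Iio 0 := by ext t; simp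
      rw [this]; exact hnonneg j
    exact (measurePreserving_eval D j).quasiMeasurePreserving.ae h1
  -- quantile estimates
  set q : Fin n → ℝ := fun j => (D j).real (Set.Ici vbar) with hqdef
  have hq0 : ∀ j, 0 ≤ q j := fun j => measureReal_nonneg
  have hq1 : ∀ j, q j ≤ 1 := fun j => measureReal_le_one
  set B := ∑ i, (q i * ∏ j ∈ Finset.univ.filter (· < i), (1 - q j)) with hB
  have hBO : vbar * B ≤ O := TR.post_bound hdc hF hsingle D h0 hb vbar ha.le
  have hBe : B ≤ ε := by
    by_contra h
    push Not at h
    nlinarith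
  have hprod : ∏ i, (1 - q i) = 1 - B := Finset.prod_one_sub_ordered Finset.univ q
  set Q := ∑ j, q j with hQ
  have hQ0 : 0 ≤ Q := Finset.sum_nonneg (fun j _ => hq0 j)
  have hQB : 3 / 4 * Q ≤ B := by
    rw [hQ, hB, Finset.mul_sum]
    apply Finset.sum_le_sum
    intro i _
    have h1 : ∏ j, (1 - q j) ≤ ∏ j ∈ Finset.univ.filter (· < i), (1 - q j) := by
      rw [← Finset.prod_filter_mul_prod_filter_not Finset.univ (· < i)]
      apply mul_le_of_le_one_right
      · exact Finset.prod_nonneg (fun j _ => by linarith [hq1 j])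
      · exact Finset.prod_le_one (fun j _ => by linarith [hq1 j]) (fun j _ => by linarith [hq0 j])
    have h2 : 3 / 4 ≤ ∏ j ∈ Finset.univ.filter (· < i), (1 - q j) := by
      rw [hprod] at h1; linarith
    nlinarith [hq0 i]
  have hQe : Q ≤ 4 / 3 * ε := by linarith
  have hQO : vbar * Q ≤ 4 / 3 * O := by nlinarith
  have hqQ : ∀ j, q j ≤ Q := fun j => Finset.single_le_sum (fun i _ => hq0 i) (Finset.mem_univ j)
  have hq3 : ∀ j, q j ≤ 1 / 3 := fun j => by linarith [hqQ j]
  have hsum : ∑ j, vbar * q j * (q j / (1 - q j)) ≤ 8 / 3 * ε * O := by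
    calc ∑ j, vbar * q j * (q j / (1 - q j)) ≤ ∑ j, vbar * q j * (2 * ε) := by
          apply Finset.sum_le_sum
          intro j _
          apply mul_le_mul_of_nonneg_left _ (mul_nonneg ha.le (hq0 j))
          rw [div_le_iff₀ (by linarith [hq3 j])]
          nlinarith [hqQ j, hq3 j]
      _ = (vbar * Q) * (2 * ε) := by rw [← Finset.sum_mul, ← Finset.mul_sum]
      _ ≤ 8 / 3 * ε * O := by nlinarith
  have hfinal : ∀ r ∈ TR.revSet F (Measure.pi D), r ≤
      OptEnv F (Measure.pi fun i => Measure.map (fun v : ℝ => min v vbar) (D i)) + 4 * ε * O := by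
    rintro r ⟨M, m1, m2, m3, m4, rfl⟩
    have hM : TR.Good F M := ⟨m1, m2, m3, m4⟩
    have hN := TR.norm_good hM
    have hNp := TR.norm_nonneg hM
    have hle : Rev M (Measure.pi D) ≤ Rev (TR.normM M) (Measure.pi D) := by
      have hfin := ne_top_of_le_ne_top ENNReal.ofReal_ne_top (TR.lint_le _ h0 hb hN hNp)
      have hnn : 0 ≤ᵐ[Measure.pi D] fun v => ∑ i, (TR.normM M).pay v i := by
        filter_upwards [h0] with v hv
        exact Finset.sum_nonneg (fun i _ => hNp v hv i)
      have hms : Measurable (fun v => ∑ i, (TR.normM M).pay v i) :=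
        Finset.measurable_sum _ (fun i _ => hN.meas.2 i)
      by_cases hi : Integrable (fun v => ∑ i, M.pay v i) (Measure.pi D)
      · have hi2 : Integrable (fun v => ∑ i, (TR.normM M).pay v i) (Measure.pi D) := by
          refine ⟨hms.aestronglyMeasurable, ?_⟩
          rw [hasFiniteIntegral_iff_ofReal hnn]
          refine lt_of_le_of_lt (lintegral_mono_ae ?_) hfin.lt_top
          filter_upwards [h0] with v hv
          rw [ENNReal.ofReal_sum_of_nonneg (fun i _ => hNp v hv i)]
        apply integral_mono_ae hi hi2
        filter_upwards [h0] with v hv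
        exact Finset.sum_le_sum (fun i _ => TR.norm_ge hM v hv i)
      · unfold Rev
        rw [integral_undef hi]
        exact integral_nonneg_of_ae hnn
    have ht := TR.total hdc D h0 hb hN hF hsingle hNp vbar ha hreg
      (fun j => by have := hq3 j; simp only [hqdef] at this; linarith)
    have hmp := TR.mp_good hF hsingle hN ha.le
    have hr : Rev (TR.mp (TR.normM M) vbar) (Measure.pi D) ≤
        OptEnv F (Measure.pi fun i => Measure.map (fun v : ℝ => min v vbar) (D i)) := by
      apply le_csSup (hb.mono (TR.trunc_subset D ha.le))
      refine ⟨_, hmp.valid, hmp.dsic, hmp.ir, hmp.meas, ?_⟩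
      rw [TR.rev_trunc D hmp.meas]
      unfold Rev
      simp only [TR.mp_trunc]
    have hQOO : Q * O ≤ 4 / 3 * ε * O := mul_le_mul_of_nonneg_right hQe hO0
    change _ ≤ _ + ∑ j, vbar * q j * (q j / (1 - q j)) + Q * O at ht
    linarith
  have : O ≤ _ := csSup_le ⟨0, TR.zero_mem hF _⟩ hfinal
  linarith
end
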